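/- arXiv:1710.05079 — 3 statements merged into one kernel-verified Lean document; each statement's English description precedes it below -/
import Mathlib

section
/- There is no sequence (A_n)_{n∈ℕ} of Σ¹₁-parametrizable collections of Borel graphs such that for every closed set C ⊆ [ℕ]^ℕ the shift graph restricted to C has infinite Borel chromatic number if and only if there exist a sequence (n_i)_{i∈ℕ} of natural numbers and graphs A_{n_i} ∈ A_{n_i} with A_{n_i} ≤_B G_S|_C for every i. In particular, there is no countable sequence (G_n)_{n∈ℕ} of Borel graphs with χ_B(G_n) < ∞ and χ_B(G_n) unbounded such that every Borel graph H with infinite Borel chromatic number satisfies G_n ≤_B H for every n. -/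
open MeasureTheory Set

/-- The Baire space `ℕ^ℕ`. -/
abbrev NN : Type := ℕ → ℕ

/-- The space `[ℕ]^ℕ` of infinite subsets of `ℕ`, identified with their increasing
enumerations, with the topology inherited from `ℕ^ℕ`. -/
abbrev IncSeq : Type := {x : NN // StrictMono x}

/-- The shift map `S(x) = x \ {min x}`. -/
def shift (x : IncSeq) : IncSeq :=
  ⟨fun n => x.1 (n + 1), fun _ _ h => x.2 (Nat.add_lt_add_right h 1)⟩

/-- The edge relation of the shift graph `G_S` on `[ℕ]^ℕ`. -/
def shiftEdge (x y : IncSeq) : Prop := x ≠ y ∧ (shift x = y ∨ shift y = x)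

/-- `G_S|_B` admits a Borel coloring with `n` colors. -/
def BorelColoringLE (B : Set IncSeq) (n : ℕ) : Prop :=
  ∃ c : B → Fin n, Measurable c ∧ ∀ x y : B, shiftEdge x.1 y.1 → c x ≠ c y

/-- A Borel coloring with `n` colors of the graph with Borel edge set `E` on a
standard Borel space `Z`. -/
def GBorelColoringLE {Z : Type} [MeasurableSpace Z] (E : Set (Z × Z)) (n : ℕ) : Prop :=
  ∃ c : Z → Fin n, Measurable c ∧ ∀ x y : Z, (x, y) ∈ E → c x ≠ c y

/-- The first `n` values of `w`, latest first. -/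
def pre (w : NN) : ℕ → List ℕ
  | 0 => []
  | n + 1 => w n :: pre w n

@[simp] lemma length_pre (w : NN) (n : ℕ) : (pre w n).length = n := by
  induction n with
  | zero => rfl
  | succ n ih => simp [pre, ih]

lemma pre_eq_pre {w w' : NN} {n : ℕ} : pre w n = pre w' n ↔ ∀ i < n, w i = w' i := by
  induction n with
  | zero => simp [pre]
  | succ n ih =>
    simp only [pre, List.cons.injEq, ih, Nat.lt_succ_iff_lt_or_eq, or_imp, forall_and,
      forall_eq]
    exact and_comm

lemma exists_pre_eq (σ : List ℕ) : ∃ w, pre w σ.length = σ := by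
  induction σ with
  | nil => exact ⟨0, rfl⟩
  | cons m σ ih =>
    obtain ⟨w, hw⟩ := ih
    refine ⟨Function.update w σ.length m, ?_⟩
    simp only [List.length_cons, pre, Function.update_self, List.cons.injEq, true_and]
    conv_rhs => rw [← hw]
    refine pre_eq_pre.2 fun i hi => ?_
    rw [Function.update_of_ne hi.ne]

lemma pre_succ_eq_append (w : NN) (n : ℕ) :
    pre w (n + 1) = pre (fun i => w (i + 1)) n ++ [w 0] := by
  induction n with
  | zero => rfl
  | succ n ih => rw [pre, ih, pre, List.cons_append]

lemma pre_mem_tails (w : NN) {m n : ℕ} (h : m ≤ n) : pre w m ∈ (pre w n).tails := by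
  induction n, h using Nat.le_induction with
  | base => simp
  | succ n _ ih =>
    rw [List.mem_tails] at ih ⊢
    exact ih.trans (List.suffix_cons _ _)

lemma mem_pre (w : NN) {m n : ℕ} (h : m < n) : w m ∈ pre w n := by
  have := pre_mem_tails w (Nat.succ_le_of_lt h)
  rw [List.mem_tails] at this
  exact this.subset (by simp [pre])

lemma exists_forall_mem_pre (F : List ℕ → Set ℕ) (hF : ∀ t, (F t).Nonempty) :
    ∃ x : NN, ∀ n, x n ∈ F (pre x n) := by
  choose c hc using hF
  let l : ℕ → List ℕ := fun n => Nat.rec [] (fun _ t => c t :: t) n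
  have hl : ∀ n, pre (fun i => c (l i)) n = l n := by
    intro n
    induction n with
    | zero => rfl
    | succ n ih => rw [pre, ih]
  exact ⟨fun i => c (l i), fun n => by rw [hl]; exact hc _⟩

/-- The sequences extending `s` whose later values lie in the sets prescribed by `A`. -/
def body (s : List ℕ) (A : List ℕ → Set ℕ) : Set NN :=
  {x | pre x s.length = s ∧ ∀ n, s.length ≤ n → x n ∈ A (pre x n)}

/-- Some `hyperfilter`-branching tree with stem `s` has all its branches in `B`. -/
def Forces (s : List ℕ) (B : Set NN) : Prop :=
  ∃ A : List ℕ → Set ℕ, (∀ t, A t ∈ Filter.hyperfilter ℕ) ∧ body s A ⊆ B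

lemma body_mono {s : List ℕ} {A A' : List ℕ → Set ℕ} (h : ∀ t, A t ⊆ A' t) :
    body s A ⊆ body s A' := fun _ hx => ⟨hx.1, fun n hn => h _ (hx.2 n hn)⟩

lemma biInter_list_mem {α β : Type*} {l : Filter α} (t : List β) {f : β → Set α}
    (h : ∀ b, f b ∈ l) : (⋂ b ∈ {b | b ∈ t}, f b) ∈ l :=
  (Filter.biInter_mem (List.finite_toSet t)).2 fun b _ => h b

lemma forces_iUnion_or {B : ℕ → Set NN} (hB : ∀ n s, Forces s (B n) ∨ Forces s (B n)ᶜ)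
    (s : List ℕ) : Forces s (⋃ n, B n) ∨ Forces s (⋃ n, B n)ᶜ := by
  let U : Filter ℕ := Filter.hyperfilter ℕ
  let O : Set (List ℕ) := {t | ∃ n, Forces t (B n)}
  let Gd : Set (List ℕ) := {s | ∃ A : List ℕ → Set ℕ, (∀ t, A t ∈ U) ∧
    ∀ x ∈ body s A, ∃ k, s.length ≤ k ∧ pre x k ∈ O}
  have step : ∀ s, {n | n :: s ∈ Gd} ∈ U → s ∈ Gd := by
    intro s hs
    have : ∀ n, ∃ A : List ℕ → Set ℕ, (∀ t, A t ∈ U) ∧ (n :: s ∈ Gd →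
        ∀ x ∈ body (n :: s) A, ∃ k, (n :: s).length ≤ k ∧ pre x k ∈ O) := by
      intro n
      by_cases h : n :: s ∈ Gd
      · obtain ⟨A, hA, h'⟩ := h
        exact ⟨A, hA, fun _ => h'⟩
      · exact ⟨fun _ => univ, fun _ => Filter.univ_mem, fun h' => (h h').elim⟩
    choose A hA hA' using this
    refine ⟨fun t => {n | n :: s ∈ Gd} ∩ ⋂ n ∈ {n | n ∈ t}, A n t,
      fun t => Filter.inter_mem hs (biInter_list_mem t fun n => hA n t), fun x hx => ?_⟩
    obtain ⟨k, hk, hk'⟩ := hA' (x s.length) (hx.2 _ le_rfl).1 x ⟨by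
      rw [List.length_cons, pre, hx.1], fun n hn => by
      have := (hx.2 n (by simp at hn; omega)).2
      simp only [mem_iInter] at this
      exact this _ (mem_pre x (by simpa using hn))⟩
    exact ⟨k, by simp at hk; omega, hk'⟩
  by_cases hs : s ∈ Gd
  · left
    obtain ⟨A, hA, hA'⟩ := hs
    have : ∀ t, ∃ D : List ℕ → Set ℕ, (∀ t, D t ∈ U) ∧ (t ∈ O → body t D ⊆ ⋃ n, B n) := by
      intro t
      by_cases h : t ∈ O
      · obtain ⟨n, D, hD, h'⟩ := h
        exact ⟨D, hD, fun _ => h'.trans (subset_iUnion _ _)⟩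
      · exact ⟨fun _ => univ, fun _ => Filter.univ_mem, fun h' => (h h').elim⟩
    choose D hD hD' using this
    refine ⟨fun t => A t ∩ ⋂ t' ∈ {t' | t' ∈ t.tails}, D t' t,
      fun t => Filter.inter_mem (hA t) (biInter_list_mem _ fun t' => hD t' t), fun x hx => ?_⟩
    obtain ⟨k, hk, hkO⟩ := hA' x (body_mono (fun t => inter_subset_left) hx)
    refine hD' _ hkO ⟨by rw [length_pre], fun n hn => ?_⟩
    rw [length_pre] at hn
    have := (hx.2 n (hk.trans hn)).2
    simp only [mem_iInter] at this
    exact this _ (pre_mem_tails x hn)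
  · right
    have hbad : ∀ t, t ∉ Gd → {n | n :: t ∉ Gd} ∈ U := fun t ht =>
      Ultrafilter.compl_mem_iff_notMem.2 fun h => ht (step t h)
    have hO : ∀ t, t ∉ Gd → t ∉ O := fun t ht h => ht
      ⟨fun _ => univ, fun _ => Filter.univ_mem, fun x hx => ⟨t.length, le_rfl, by rwa [hx.1]⟩⟩
    have : ∀ t n, ∃ D : List ℕ → Set ℕ, (∀ t, D t ∈ U) ∧ (t ∉ Gd → body t D ⊆ (B n)ᶜ) := by
      intro t n
      rcases hB n t with h | ⟨D, hD, h⟩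
      · exact ⟨fun _ => univ, fun _ => Filter.univ_mem, fun h' => (hO t h' ⟨n, h⟩).elim⟩
      · exact ⟨D, hD, fun _ => h⟩
    choose D hD hD' using this
    refine ⟨fun t => {n | t ∉ Gd → n :: t ∉ Gd} ∩
      ⋂ p ∈ {p | p ∈ t.tails ×ˢ List.range (t.length + 1)}, D p.1 p.2 t,
      fun t => Filter.inter_mem ?_ (biInter_list_mem _ fun p => hD p.1 p.2 t), fun x hx => ?_⟩
    · by_cases ht : t ∉ Gd
      · exact Filter.mem_of_superset (hbad t ht) fun n hn _ => hn
      · simp [ht]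
    have hx' : ∀ n, s.length ≤ n → pre x n ∉ Gd := by
      intro n hn
      induction n, hn using Nat.le_induction with
      | base => rwa [hx.1]
      | succ n hn ih => exact (hx.2 n hn).1 ih
    simp only [compl_iUnion, mem_iInter]
    intro n
    refine hD' (pre x (max s.length n)) n (hx' _ (le_max_left _ _)) ⟨by simp, fun k hk => ?_⟩
    rw [length_pre, max_le_iff] at hk
    have := (hx.2 k hk.1).2
    simp only [mem_iInter] at this
    refine this (pre x (max s.length n), n) ?_
    rw [length_pre]
    exact List.pair_mem_product.2 ⟨pre_mem_tails x (max_le hk.1 hk.2), by simp; omega⟩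

lemma forces_or_forces_compl {B : Set NN} (hB : MeasurableSet B) (s : List ℕ) :
    Forces s B ∨ Forces s Bᶜ := by
  let M : MeasurableSpace NN :=
    { MeasurableSet' := fun B => ∀ s, Forces s B ∨ Forces s Bᶜ
      measurableSet_empty := fun s =>
        Or.inr ⟨fun _ => univ, fun _ => Filter.univ_mem, by simp⟩
      measurableSet_compl := fun B h s => by rw [compl_compl]; exact (h s).symm
      measurableSet_iUnion := fun B h => forces_iUnion_or h }
  have key : (MeasurableSpace.pi : MeasurableSpace NN) ≤ M := by
    refine iSup_le fun i => ?_
    rw [← measurable_iff_comap_le]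
    refine @measurable_to_countable' _ _ _ _ M _ fun j s => ?_
    by_cases hi : i < s.length
    · by_cases hj : ∀ x, pre x s.length = s → x i = j
      · exact Or.inl ⟨fun _ => univ, fun _ => Filter.univ_mem, fun x hx => hj x hx.1⟩
      · push Not at hj
        obtain ⟨x, hx, hxj⟩ := hj
        refine Or.inr ⟨fun _ => univ, fun _ => Filter.univ_mem, fun y hy h => hxj ?_⟩
        rw [pre_eq_pre.1 (hx.trans hy.1.symm) i hi]
        exact h
    · refine Or.inr ⟨fun _ => {j}ᶜ, fun _ => Filter.hyperfilter_le_cofinite (by simp),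
        fun y hy h => hy.2 i (not_lt.1 hi) h⟩
  exact key B hB s

lemma measurableSet_strictMono : MeasurableSet {x : NN | StrictMono x} := by
  simp only [StrictMono, ofPred_forall]
  refine MeasurableSet.iInter fun a => MeasurableSet.iInter fun b => MeasurableSet.iInter fun _ =>
    measurableSet_lt (measurable_pi_apply a) (measurable_pi_apply b)

/-- A consequence of the Galvin–Prikry theorem. -/
theorem exists_eq_shift {κ : IncSeq → ℕ} (hκ : Measurable κ) {m : ℕ} (hm : ∀ x, κ x < m) :
    ∃ x, κ x = κ (shift x) := by
  let B : ℕ → Set NN := fun i => Subtype.val '' (κ ⁻¹' {i})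
  have hB : ∀ i, MeasurableSet (B i) := fun i =>
    measurableSet_strictMono.subtype_image (hκ (measurableSet_singleton i))
  let I : List ℕ → Set ℕ := fun t => ⋂ a ∈ {a | a ∈ t}, Ioi a
  have hI : ∀ t, I t ∈ Filter.hyperfilter ℕ := fun t =>
    biInter_list_mem t fun a => Filter.hyperfilter_le_cofinite (by
      rw [Filter.mem_cofinite, compl_Ioi]; exact finite_Iic a)
  have mono : ∀ x : NN, (∀ n, x n ∈ I (pre x n)) → StrictMono x := fun x hx =>
    strictMono_nat_of_lt_succ fun n => by
      have := hx (n + 1)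
      simp only [I, mem_iInter] at this
      exact this _ (mem_pre x n.lt_succ_self)
  obtain ⟨i, A, hA, hAB⟩ : ∃ i, Forces [] (B i) := by
    by_contra! h
    choose A hA hAB using fun i => (forces_or_forces_compl (hB i) []).resolve_left (h i)
    obtain ⟨x, hx⟩ := exists_forall_mem_pre
      (fun t => I t ∩ ⋂ i ∈ {i | i ∈ List.range m}, A i t) fun t => Ultrafilter.nonempty_of_mem
        (Filter.inter_mem (hI t) (biInter_list_mem _ fun i => hA i t))
    have hx' := mono x fun n => (hx n).1
    refine hAB (κ ⟨x, hx'⟩) (a := x) ⟨rfl, fun n _ => ?_⟩ ⟨⟨x, hx'⟩, rfl, rfl⟩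
    have := (hx n).2
    simp only [mem_iInter] at this
    exact this _ (by simpa using hm _)
  obtain ⟨x, hx⟩ := exists_forall_mem_pre
    (fun t => I t ∩ (A t ∩ A t.dropLast)) fun t => Ultrafilter.nonempty_of_mem
      (Filter.inter_mem (hI t) (Filter.inter_mem (hA _) (hA _)))
  have hx' := mono x fun n => (hx n).1
  have h1 : x ∈ B i := hAB ⟨rfl, fun n _ => (hx n).2.1⟩
  have h2 : (shift ⟨x, hx'⟩).1 ∈ B i := hAB ⟨rfl, fun n _ => by
    have := (hx (n + 1)).2.2
    rwa [pre_succ_eq_append, List.dropLast_concat] at this⟩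
  obtain ⟨y, hy, hy'⟩ := h1
  obtain ⟨y', hy1, hy2⟩ := h2
  rw [mem_preimage, mem_singleton_iff] at hy hy1
  refine ⟨⟨x, hx'⟩, ?_⟩
  rw [← Subtype.ext hy2, hy1, ← hy]
  congr 1
  exact Subtype.ext hy'.symm

lemma exists_pre_of_chain {f : ℕ → List ℕ} (hf : ∀ n, ∃ m, f (n + 1) = m :: f n) :
    ∃ w, ∀ n, f n = pre w ((f 0).length + n) := by
  choose c hc using hf
  obtain ⟨w, hw⟩ := exists_pre_eq (f 0)
  refine ⟨fun i => if i < (f 0).length then w i else c (i - (f 0).length), fun n => ?_⟩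
  induction n with
  | zero =>
    conv_lhs => rw [← hw]
    exact pre_eq_pre.2 fun i hi => by simp_all
  | succ n ih => rw [hc, ih, ← add_assoc, pre]; simp

/-- The label of `σ` in the labelled tree coded by `p`. -/
def lab (p : NN) (σ : List ℕ) : ℕ := p (Encodable.encode σ)

/-- The code of a labelled tree. -/
def ofLab (g : List ℕ → ℕ) : NN := fun i => g (Denumerable.ofNat (List ℕ) i)

@[simp] lemma lab_ofLab (g : List ℕ → ℕ) (σ : List ℕ) : lab (ofLab g) σ = g σ := by
  simp [lab, ofLab]

lemma measurable_lab (σ : List ℕ) : Measurable fun p => lab p σ := measurable_pi_apply _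

lemma measurable_ofLab {α : Type*} [MeasurableSpace α] {g : α → List ℕ → ℕ}
    (hg : ∀ σ, Measurable fun a => g a σ) : Measurable fun a => ofLab (g a) :=
  measurable_pi_lambda _ fun _ => hg _

open Classical in
/-- `0` if `f` has no zero, and otherwise the successor of its least zero. -/
noncomputable def mu (f : NN) : ℕ := if h : ∃ m, f m = 0 then Nat.find h + 1 else 0

lemma mu_eq_zero {f : NN} : mu f = 0 ↔ ∀ m, f m ≠ 0 := by
  unfold mu
  split_ifs with h <;> simpa using h

lemma mu_eq_succ {f : NN} {n : ℕ} : mu f = n + 1 ↔ f n = 0 ∧ ∀ m < n, f m ≠ 0 := by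
  unfold mu
  split_ifs with h
  · rw [Nat.add_right_cancel_iff, Nat.find_eq_iff]
  · exact iff_of_false id fun h' => h ⟨n, h'.1⟩

lemma measurable_mu : Measurable mu := by
  refine measurable_to_countable' fun n => ?_
  have h : ∀ m, MeasurableSet {f : NN | f m = 0} := fun m =>
    measurable_pi_apply m (measurableSet_singleton 0)
  cases n with
  | zero =>
    have : mu ⁻¹' {0} = ⋂ m, {f | f m = 0}ᶜ := by ext f; simp [mu_eq_zero]
    rw [this]
    exact MeasurableSet.iInter fun m => (h m).compl
  | succ n =>
    have : mu ⁻¹' {n + 1} = {f | f n = 0} ∩ ⋂ m, ⋂ (_ : m < n), {f | f m = 0}ᶜ := by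
      ext f; simp [mu_eq_succ]
    rw [this]
    exact (h n).inter (MeasurableSet.iInter fun m => MeasurableSet.iInter fun _ => (h m).compl)

/-- The value at a node with label `k` of the evaluation at `q`, given the values `f` at its
children. -/
noncomputable def node : ℕ → NN → NN → ℕ
  | 0, _, f => mu f
  | k + 1, q, _ => if q k.unpair.1 = k.unpair.2 then 0 else 1

lemma measurable_node (k : ℕ) : Measurable fun a : NN × NN => node k a.1 a.2 := by
  cases k with
  | zero => exact measurable_mu.comp measurable_snd
  | succ k =>
    refine Measurable.ite ?_ measurable_const measurable_const
    exact ((measurable_pi_apply _).comp measurable_fst) (measurableSet_singleton _)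

/-- `v` is an evaluation at `q` of the Borel function coded by `p`. -/
def IsEval (p q v : NN) : Prop :=
  ∀ m σ, lab v (m :: σ) = node (lab p (m :: σ)) q fun j => lab v (j :: m :: σ)

/-- Every branch of the labelled tree has infinitely many nodes with a nonzero label. -/
def WF (g : List ℕ → ℕ) : Prop := ∀ w N, ∃ n ≥ N, g (pre w n) ≠ 0

lemma WF.wellFounded {g : List ℕ → ℕ} (hg : WF g) :
    WellFounded fun τ' τ => g τ = 0 ∧ ∃ m, τ' = m :: τ := by
  refine ⟨fun σ => ?_⟩
  by_contra h
  obtain ⟨f, hf, hf'⟩ := not_acc_iff_exists_descending_chain.1 h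
  obtain ⟨w, hw⟩ := exists_pre_of_chain fun n => (hf' n).2
  obtain ⟨n, hn, hn'⟩ := hg w (f 0).length
  obtain ⟨k, rfl⟩ := Nat.exists_eq_add_of_le hn
  exact hn' (hw k ▸ (hf' k).1)

lemma exists_eval {p : NN} (hp : WF (lab p)) :
    ∃ V : NN → NN, Measurable V ∧ ∀ q, IsEval p q (V q) := by
  let G : List ℕ → NN → ℕ := hp.wellFounded.fix fun σ ih q =>
    if h : lab p σ = 0 then mu fun j => ih (j :: σ) ⟨h, j, rfl⟩ q else node (lab p σ) q 0
  have hG : ∀ σ q, G σ q = node (lab p σ) q fun j => G (j :: σ) q := by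
    intro σ q
    rw [show G σ = _ from hp.wellFounded.fix_eq _ σ]
    split_ifs with h
    · conv_rhs => rw [h]
      rfl
    · obtain ⟨k, hk⟩ := Nat.exists_eq_succ_of_ne_zero h
      rw [hk]; rfl
  have hG' : ∀ σ, Measurable (G σ) := by
    intro σ
    induction σ using hp.wellFounded.induction with
    | _ σ ih =>
      rw [funext (hG σ)]
      by_cases h : lab p σ = 0
      · exact (measurable_node _).comp (measurable_id.prodMk
          (measurable_pi_lambda _ fun j => ih _ ⟨h, j, rfl⟩))
      · obtain ⟨k, hk⟩ := Nat.exists_eq_succ_of_ne_zero h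
        rw [hk]
        exact (measurable_node (k + 1)).comp (measurable_id.prodMk (measurable_const (a := 0)))
  exact ⟨fun q => ofLab fun σ => G σ q, measurable_ofLab hG', fun q m σ => by simpa using hG _ q⟩

/-- The labelled tree with root label `k` and immediate subtrees `g i`. -/
def graft (k : ℕ) (g : ℕ → List ℕ → ℕ) (σ : List ℕ) : ℕ :=
  match σ.getLast? with
  | none => k
  | some i => g i σ.dropLast

lemma graft_concat (k : ℕ) (g : ℕ → List ℕ → ℕ) (σ : List ℕ) (i : ℕ) :
    graft k g (σ ++ [i]) = g i σ := by
  simp [graft]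

lemma wf_graft (k : ℕ) {g : ℕ → List ℕ → ℕ} (hg : ∀ i, WF (g i)) : WF (graft k g) := by
  intro w N
  obtain ⟨n, hn, h⟩ := hg (w 0) (fun i => w (i + 1)) N
  exact ⟨n + 1, by omega, by rwa [pre_succ_eq_append, graft_concat]⟩

/-- `S` is the set of points at which the labelled tree `g` evaluates to zero. -/
def Codes (g : List ℕ → ℕ) (S : Set NN) : Prop :=
  ∀ q (u : List ℕ → ℕ), (∀ σ, u σ = node (g σ) q fun j => u (j :: σ)) → (u [] = 0 ↔ q ∈ S)

lemma codes_graft {g : ℕ → List ℕ → ℕ} {S : ℕ → Set NN} (h : ∀ i, Codes (g i) (S i)) :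
    Codes (graft 0 g) (⋂ i, (S i)ᶜ) := by
  intro q u hu
  have := fun i => h i q (fun σ => u (σ ++ [i])) fun σ => by
    rw [hu, graft_concat]; rfl
  have h0 : u [] = mu fun j => u [j] := hu []
  simp only [List.nil_append] at this
  rw [h0, mu_eq_zero]
  simp [this]

lemma exists_codes {S : Set NN} (hS : MeasurableSet S) : ∃ g, WF g ∧ Codes g S := by
  let P : Set NN → Prop := fun S => ∃ g, WF g ∧ Codes g S
  have hI : ∀ S : ℕ → Set NN, (∀ i, P (S i)) → P (⋂ i, (S i)ᶜ) := by
    intro S h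
    choose g hg hg' using h
    exact ⟨_, wf_graft 0 hg, codes_graft hg'⟩
  have hC : ∀ S, P S → P Sᶜ := fun S h => by
    have := hI (fun _ => S) fun _ => h
    rwa [iInter_const] at this
  have hcyl : ∀ i j, P {q | q i = j} := fun i j =>
    ⟨fun _ => Nat.pair i j + 1, fun w N => ⟨N, le_rfl, by simp⟩, fun q u hu => by
      rw [hu]
      simp [node]⟩
  let M : MeasurableSpace NN :=
    { MeasurableSet' := P
      measurableSet_empty := by
        have := hI (fun n => if n = 0 then {q | q 0 = 0} else {q | q 0 = 0}ᶜ) fun n => by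
          split_ifs
          exacts [hcyl 0 0, hC _ (hcyl 0 0)]
        convert this
        symm
        rw [eq_empty_iff_forall_notMem]
        intro q hq
        have h0 := mem_iInter.1 hq 0
        have h1 := mem_iInter.1 hq 1
        simp_all
      measurableSet_compl := hC
      measurableSet_iUnion := fun S h => by
        have := hC _ (hI S h)
        rwa [compl_iInter, iUnion_congr fun i => compl_compl (S i)] at this }
  have key : (MeasurableSpace.pi : MeasurableSpace NN) ≤ M := by
    refine iSup_le fun i => ?_
    rw [← measurable_iff_comap_le]
    exact @measurable_to_countable' _ _ _ _ M _ fun j => hcyl i j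
  exact key S hS

lemma exists_code {F : NN → NN} (hF : Measurable F) (m : ℕ) :
    ∃ p, WF (lab p) ∧ lab p [] = m ∧ ∀ q v, IsEval p q v → ∀ i, lab v [i] = F q i + 1 := by
  choose g hg hg' using fun i j => exists_codes (S := {q | F q i = j})
    ((measurable_pi_apply i).comp hF (measurableSet_singleton j))
  have e : lab (ofLab (graft m fun i => graft 0 (g i))) = graft m fun i => graft 0 (g i) :=
    funext (lab_ofLab _)
  refine ⟨ofLab (graft m fun i => graft 0 (g i)), ?_, ?_, fun q v hv i => ?_⟩
  · rw [e]
    exact wf_graft _ fun i => wf_graft _ (hg i)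
  · rw [e]; rfl
  have h0 : lab v [i] = mu fun j => lab v [j, i] := by
    rw [hv, e]; rfl
  have h1 : ∀ j, lab v [j, i] = 0 ↔ F q i = j := fun j =>
    hg' i j q (fun σ => lab v (σ ++ [j, i])) fun σ => by
      have : σ ++ [j, i] = (σ ++ [j]) ++ [i] := by simp
      obtain ⟨a, t, ht⟩ := List.exists_cons_of_ne_nil (l := σ ++ [j, i]) (by simp)
      simp only [List.cons_append]
      rw [ht, hv, ← ht, e, this, graft_concat, graft_concat, ← this, ht]
  rw [h0, mu_eq_succ, h1]
  refine ⟨rfl, fun m hm h => ?_⟩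
  rw [h1] at h
  omega

/-- The tree `T` has an infinite branch. -/
def IllFounded (T : List ℕ → Prop) : Prop := ∃ w, ∀ k, T (pre w (k + 1))

/-- `τ'` is a child of `τ` in the tree `T`. -/
def Child (T : List ℕ → Prop) (τ' τ : List ℕ) : Prop := T τ' ∧ ∃ m, τ' = m :: τ

lemma acc_of_not_illFounded {T : List ℕ → Prop} (h : ¬ IllFounded T) : Acc (Child T) [] := by
  by_contra h'
  obtain ⟨f, hf, hf'⟩ := not_acc_iff_exists_descending_chain.1 h'
  obtain ⟨w, hw⟩ := exists_pre_of_chain fun n => (hf' n).2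
  refine h ⟨w, fun k => ?_⟩
  have := (hf' k).1
  rwa [hw, hf, List.length_nil, zero_add] at this

/-- The nodes of `T` all of whose nonempty initial segments are in `T`. -/
def Reach (T : List ℕ → Prop) : List ℕ → Prop
  | [] => True
  | m :: τ => T (m :: τ) ∧ Reach T τ

/-- The length-preserving monotone map on finite sequences coded by `v`. -/
def lmap (v : NN) : List ℕ → List ℕ
  | [] => []
  | m :: τ => lab v (m :: τ) :: lmap v τ

/-- `v` codes a length-preserving monotone map from `T` to `S`. -/
def Emb (T S : List ℕ → Prop) (v : NN) : Prop :=
  ∀ m τ, Reach T (m :: τ) → S (lmap v (m :: τ))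

lemma lmap_pre (v w : NN) (k : ℕ) : lmap v (pre w k) = pre (fun i => lab v (pre w (i + 1))) k := by
  induction k with
  | zero => rfl
  | succ k ih => rw [pre, lmap, ih, pre, ← pre]

lemma Emb.illFounded {T S : List ℕ → Prop} {v : NN} (hv : Emb T S v) (hT : IllFounded T) :
    IllFounded S := by
  obtain ⟨w, hw⟩ := hT
  have hr : ∀ k, Reach T (pre w k) := fun k => by
    induction k with
    | zero => trivial
    | succ k ih => exact ⟨hw k, ih⟩
  exact ⟨_, fun k => lmap_pre v w (k + 1) ▸ hv _ _ (hr (k + 1))⟩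

lemma Emb.acc {T S : List ℕ → Prop} {v : NN} (hv : Emb T S v) {σ : List ℕ}
    (h : Acc (Child S) σ) : ∀ τ, Reach T τ → lmap v τ = σ → Acc (Child T) τ := by
  induction h with
  | intro σ _ ih =>
    rintro τ hτ rfl
    refine ⟨_, ?_⟩
    rintro _ ⟨hT, m, rfl⟩
    exact ih (lmap v (m :: τ)) ⟨hv m τ ⟨hT, hτ⟩, _, rfl⟩ _ ⟨hT, hτ⟩ rfl

lemma Emb.rank_le {T S : List ℕ → Prop} {v : NN} (hv : Emb T S v) {τ : List ℕ}
    (h : Acc (Child T) τ) :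
    Reach T τ → ∀ hA : Acc (Child S) (lmap v τ), h.rank ≤ hA.rank := by
  induction h with
  | intro τ h ih =>
    intro hτ hA
    rw [Acc.rank_eq]
    refine Ordinal.iSup_le ?_
    rintro ⟨_, hT, m, rfl⟩
    have hS : Child S (lmap v (m :: τ)) (lmap v τ) := ⟨hv m τ ⟨hT, hτ⟩, _, rfl⟩
    exact Order.succ_le_of_lt ((ih _ ⟨hT, m, rfl⟩ ⟨hT, hτ⟩ (hA.inv hS)).trans_lt
      (Acc.rank_lt_of_rel hA hS))

/-- The map `τ ↦ σ` does not extend to a length-preserving monotone map from `T` to `S`. -/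
inductive Fail (T S : List ℕ → Prop) : List ℕ → List ℕ → Prop
  | mk (τ σ : List ℕ) (m : ℕ) (hT : T (m :: τ))
      (h : ∀ m', S (m' :: σ) → Fail T S (m :: τ) (m' :: σ)) : Fail T S τ σ

lemma fail_iff {T S : List ℕ → Prop} {τ σ : List ℕ} :
    Fail T S τ σ ↔ ∃ m, T (m :: τ) ∧ ∀ m', S (m' :: σ) → Fail T S (m :: τ) (m' :: σ) :=
  ⟨fun ⟨_, _, m, hT, h⟩ => ⟨m, hT, h⟩, fun ⟨m, hT, h⟩ => ⟨_, _, m, hT, h⟩⟩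

lemma Fail.acc {T S : List ℕ → Prop} {τ σ : List ℕ} (h : Fail T S τ σ) : Acc (Child S) σ := by
  induction h with
  | mk τ σ m _ _ ih =>
    refine ⟨_, ?_⟩
    rintro _ ⟨hS, m', rfl⟩
    exact ih m' hS

lemma Fail.rank_lt {T S : List ℕ → Prop} {τ σ : List ℕ} (h : Fail T S τ σ) :
    ∀ (hT : Acc (Child T) τ) (hS : Acc (Child S) σ), hS.rank < hT.rank := by
  induction h with
  | mk τ σ m hm _ ih =>
    intro hT hS
    have hm' : Child T (m :: τ) τ := ⟨hm, m, rfl⟩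
    refine lt_of_le_of_lt ?_ (Acc.rank_lt_of_rel hT hm')
    rw [hS.rank_eq]
    refine Ordinal.iSup_le ?_
    rintro ⟨_, h, m', rfl⟩
    exact Order.succ_le_of_lt (ih m' h _ _)

section Selection

variable {α : Type*} [MeasurableSpace α]

lemma exists_measurable_choice {P : α → ℕ → Prop} (hP : ∀ n, MeasurableSet {a | P a n}) :
    ∃ f : α → ℕ, Measurable f ∧ ∀ a, (∃ n, P a n) → P a (f a) := by
  classical
  have h : ∀ a, ∃ n, P a n ∨ ∀ m, ¬ P a m := fun a => by
    by_cases h : ∃ n, P a n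
    · exact h.imp fun _ => Or.inl
    · exact ⟨0, Or.inr (not_exists.1 h)⟩
  refine ⟨fun a => Nat.find (h a), measurable_find h fun n => ?_, fun a ha => ?_⟩
  · simp only [ofPred_or, ofPred_forall]
    exact (hP n).union (MeasurableSet.iInter fun m => (hP m).compl)
  · exact (Nat.find_spec (h a)).resolve_right fun h' => ha.elim h'

variable {T : List ℕ → Prop} {S : α → List ℕ → Prop}

lemma measurableSet_fail (hS : ∀ σ, MeasurableSet {a | S a σ}) {τ : List ℕ}
    (hτ : Acc (Child T) τ) : ∀ σ, MeasurableSet {a | Fail T (S a) τ σ} := by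
  induction hτ with
  | intro τ _ ih =>
    intro σ
    simp only [fail_iff (τ := τ), ofPred_exists, ofPred_and, ofPred_forall]
    refine MeasurableSet.iUnion fun m => ?_
    by_cases hm : T (m :: τ)
    · refine (MeasurableSet.const _).inter (MeasurableSet.iInter fun m' => ?_)
      simp only [imp_iff_not_or, ofPred_or]
      exact (hS _).compl.union (ih _ ⟨hm, m, rfl⟩ _)
    · simp [hm]

lemma exists_measurable_emb (hT : Acc (Child T) []) (hS : ∀ σ, MeasurableSet {a | S a σ})
    (h : ∀ a, ¬ Fail T (S a) [] []) :
    ∃ v : α → NN, Measurable v ∧ ∀ a, Emb T (S a) (v a) := by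
  have : ∀ τ σ, ∃ f : α → ℕ, Measurable f ∧ (Acc (Child T) τ → ∀ a,
      (∃ m, S a (m :: σ) ∧ ¬ Fail T (S a) τ (m :: σ)) →
        S a (f a :: σ) ∧ ¬ Fail T (S a) τ (f a :: σ)) := by
    intro τ σ
    by_cases hτ : Acc (Child T) τ
    · obtain ⟨f, hf, hf'⟩ := exists_measurable_choice
        (P := fun a m => S a (m :: σ) ∧ ¬ Fail T (S a) τ (m :: σ)) fun m =>
          (hS _).inter (measurableSet_fail hS hτ _).compl
      exact ⟨f, hf, fun _ => hf'⟩
    · exact ⟨fun _ => 0, measurable_const, fun h' => (hτ h').elim⟩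
  choose f hf hf' using this
  let φ : α → List ℕ → List ℕ := fun a τ =>
    List.rec [] (fun m τ σ => f (m :: τ) σ a :: σ) τ
  have hφ : ∀ m τ a, φ a (m :: τ) = f (m :: τ) (φ a τ) a :: φ a τ := fun _ _ _ => rfl
  have hφm : ∀ τ σ, MeasurableSet {a | φ a τ = σ} := by
    intro τ
    induction τ with
    | nil => exact fun σ => MeasurableSet.const ([] = σ)
    | cons m τ ih =>
      rintro (_ | ⟨n, σ⟩)
      · simp [hφ]
      · have : {a | φ a (m :: τ) = n :: σ} = {a | φ a τ = σ} ∩ f (m :: τ) σ ⁻¹' {n} := by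
          ext a
          simp only [hφ, List.cons.injEq, mem_ofPred_eq, mem_inter_iff, mem_preimage,
            mem_singleton_iff]
          constructor <;> rintro ⟨h1, h2⟩ <;> subst h1 <;> simp_all
        rw [this]
        exact (ih σ).inter (hf _ _ (measurableSet_singleton n))
  refine ⟨fun a => ofLab fun τ => (φ a τ).headI, measurable_ofLab fun τ => ?_, fun a => ?_⟩
  · refine measurable_to_countable' fun n => ?_
    have : (fun a => (φ a τ).headI) ⁻¹' {n} =
        ⋃ σ : {σ : List ℕ // σ.headI = n}, {a | φ a τ = σ} := by
      ext a; simp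
    rw [this]
    exact MeasurableSet.iUnion fun σ => hφm _ _
  · have hl : ∀ τ, lmap (ofLab fun τ => (φ a τ).headI) τ = φ a τ := by
      intro τ
      induction τ with
      | nil => rfl
      | cons m τ ih => rw [lmap, ih, lab_ofLab, hφ]; rfl
    have step : ∀ m τ, Acc (Child T) τ → ¬ Fail T (S a) τ (φ a τ) → T (m :: τ) →
        S a (φ a (m :: τ)) ∧ ¬ Fail T (S a) (m :: τ) (φ a (m :: τ)) := by
      intro m τ hτ hF hm
      refine hf' _ _ (hτ.inv ⟨hm, m, rfl⟩) a ?_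
      rw [fail_iff] at hF
      push Not at hF
      exact hF m hm
    have inv : ∀ τ, Reach T τ → Acc (Child T) τ ∧ ¬ Fail T (S a) τ (φ a τ) := by
      intro τ
      induction τ with
      | nil => exact fun _ => ⟨hT, h a⟩
      | cons m τ ih =>
        rintro ⟨hm, hτ⟩
        exact ⟨(ih hτ).1.inv ⟨hm, m, rfl⟩, (step m τ (ih hτ).1 (ih hτ).2 hm).2⟩
    intro m τ hτ
    rw [hl]
    exact (step m τ (inv τ hτ.2).1 (inv τ hτ.2).2 hτ.1).1

end Selection

section LocallyConstant

variable {α : Type*} [TopologicalSpace α]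

lemma IsLocallyConstant.bind {β γ : Type*} {f : α → β} (hf : IsLocallyConstant f)
    {g : β → α → γ} (hg : ∀ b, IsLocallyConstant (g b)) :
    IsLocallyConstant fun a => g (f a) a := by
  rw [IsLocallyConstant.iff_eventually_eq] at hf ⊢
  intro a
  filter_upwards [hf a, (IsLocallyConstant.iff_eventually_eq _).1 (hg (f a)) a] with b h1 h2
  rw [h1, h2]

lemma IsLocallyConstant.isClosed_prop {P : α → Prop} (h : IsLocallyConstant P) :
    IsClosed {a | P a} := by
  convert (h.isClosed_fiber True) using 1
  ext; simp

lemma isLocallyConstant_eval {f : α → NN} (hf : Continuous f) (n : ℕ) :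
    IsLocallyConstant fun a => f a n :=
  IsLocallyConstant.iff_continuous _ |>.2 ((continuous_apply n).comp hf)

lemma isLocallyConstant_pre {f : α → NN} (hf : Continuous f) (n : ℕ) :
    IsLocallyConstant fun a => pre (f a) n := by
  induction n with
  | zero => exact IsLocallyConstant.const _
  | succ n ih => exact (isLocallyConstant_eval hf n).comp₂ ih List.cons

lemma isLocallyConstant_lmap {v : α → NN} (hv : Continuous v) (τ : List ℕ) :
    IsLocallyConstant fun a => lmap (v a) τ := by
  induction τ with
  | nil => exact IsLocallyConstant.const _
  | cons m τ ih => exact (isLocallyConstant_eval hv _).comp₂ ih List.cons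

lemma isLocallyConstant_reach {T : α → List ℕ → Prop}
    (hT : ∀ τ, IsLocallyConstant fun a => T a τ) (τ : List ℕ) :
    IsLocallyConstant fun a => Reach (T a) τ := by
  induction τ with
  | nil => exact IsLocallyConstant.const _
  | cons m τ ih => exact (hT _).comp₂ ih And

end LocallyConstant

lemma tendsto_of_pre_eq {a : ℕ → NN} {x : NN} (h : ∀ n, pre (a n) n = pre x n) :
    Filter.Tendsto a Filter.atTop (nhds x) := by
  rw [tendsto_pi_nhds]
  intro i
  refine tendsto_const_nhds.congr' ?_
  filter_upwards [Filter.eventually_gt_atTop i] with n hn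
  exact (pre_eq_pre.1 (h n) i hn).symm

lemma pre_eq_of_le {w w' : NN} {m n : ℕ} (h : pre w n = pre w' n) (hmn : m ≤ n) :
    pre w m = pre w' m :=
  pre_eq_pre.2 fun i hi => pre_eq_pre.1 h i (hi.trans_le hmn)

lemma exists_mem_iInter_of_bounded {F : ℕ → Set NN} (hF : Antitone F)
    (hF' : ∀ n r r', pre r n = pre r' n → r ∈ F n → r' ∈ F n) (b : NN)
    (h : ∀ n, ∃ r ∈ F n, ∀ i < n, r i ≤ b i) : ∃ r, (∀ n, r ∈ F n) ∧ ∀ i, r i ≤ b i := by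
  have hK : IsCompact (Set.pi univ fun i => Iic (b i)) :=
    isCompact_univ_pi fun i => (finite_Iic _).isCompact
  have hc : ∀ n, IsClosed (F n) := fun n => by
    refine IsLocallyConstant.isClosed_prop (P := fun r => r ∈ F n) ?_
    rw [IsLocallyConstant.iff_eventually_eq]
    intro r
    filter_upwards [(IsLocallyConstant.iff_eventually_eq _).1
      (isLocallyConstant_pre continuous_id n) r] with r' hr
    exact propext ⟨hF' n _ _ hr, hF' n _ _ hr.symm⟩
  obtain ⟨r, hr⟩ := IsCompact.nonempty_iInter_of_sequence_nonempty_isCompact_isClosed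
    (fun n => (Set.pi univ fun i => Iic (b i)) ∩ F n)
    (fun n => inter_subset_inter_right _ (hF n.le_succ))
    (fun n => by
      obtain ⟨r, hr, hb⟩ := h n
      refine ⟨fun i => if i < n then r i else 0, fun i _ => ?_,
        hF' n r _ (pre_eq_pre.2 fun i hi => by simp [hi]) hr⟩
      by_cases hi : i < n
      · simpa [hi] using hb i hi
      · simp [hi])
    (hK.inter_right (hc 0)) (fun n => hK.isClosed.inter (hc n))
  rw [mem_iInter] at hr
  exact ⟨r, fun n => (hr n).2, fun i => (hr 0).1 i trivial⟩

lemma exists_fixedPoint {Φ : NN → NN} (h : ∀ u u' i, pre u i = pre u' i → Φ u i = Φ u' i) :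
    ∃ u, Φ u = u := by
  choose e he using exists_pre_eq
  obtain ⟨u, hu⟩ := exists_forall_mem_pre (fun t => {Φ (e t) t.length}) fun t =>
    singleton_nonempty _
  refine ⟨u, funext fun n => ?_⟩
  rw [mem_singleton_iff.1 (hu n), length_pre]
  exact h _ _ _ (by have := he (pre u n); rw [length_pre] at this; exact this.symm)

lemma MeasureTheory.AnalyticSet.exists_isClosed {α : Type*} [TopologicalSpace α] [T2Space α]
    {s : Set α} (hs : AnalyticSet s) :
    ∃ D : Set (α × NN), IsClosed D ∧ ∀ a, a ∈ s ↔ ∃ b, (a, b) ∈ D := by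
  rw [AnalyticSet] at hs
  rcases hs with rfl | ⟨f, hf, rfl⟩
  · exact ⟨∅, isClosed_empty, by simp⟩
  · exact ⟨{x | f x.2 = x.1}, isClosed_eq (hf.comp continuous_snd) continuous_fst, by simp⟩

/-- The tree whose characteristic function is coded by `u`. -/
def setTree (u : NN) (σ : List ℕ) : Prop := lab u σ = 1

lemma length_ofNat_le (i : ℕ) : (Denumerable.ofNat (List ℕ) i).length ≤ i := by
  conv_rhs => rw [← Denumerable.encode_ofNat (α := List ℕ) i]
  exact Encodable.length_le_encode _

lemma exists_selfReferential {W : Set (NN × NN × NN)} (hW : AnalyticSet W) :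
    ∃ u : NN → NN → NN, (Continuous fun a : NN × NN => u a.1 a.2) ∧
      ∀ z p, IllFounded (setTree (u z p)) ↔ (u z p, z, p) ∈ W := by
  classical
  obtain ⟨D, hD, hDW⟩ := hW.exists_isClosed
  let P : NN → NN → NN → List ℕ → Prop := fun z p u σ => ∃ u' z' p' b', ((u', z', p'), b') ∈ D ∧
    pre u' σ.length = pre u σ.length ∧ pre z' σ.length = pre z σ.length ∧
    pre p' σ.length = pre p σ.length ∧ pre b' σ.length = σ
  have hP : ∀ {z z' p p' u u' : NN} {n : ℕ} {σ : List ℕ}, pre z n = pre z' n →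
      pre p n = pre p' n → pre u n = pre u' n → σ.length ≤ n → (P z p u σ ↔ P z' p' u' σ) := by
    intro z z' p p' u u' n σ hz hp hu hn
    simp only [P, pre_eq_of_le hz hn, pre_eq_of_le hp hn, pre_eq_of_le hu hn]
  choose u hu using fun z p => exists_fixedPoint
    (Φ := fun u i => if P z p u (Denumerable.ofNat _ i) then 1 else 0) fun u u' i h =>
      if_congr (hP (z := z) rfl (p := p) rfl h (length_ofNat_le i)) rfl rfl
  have hu' : ∀ z p i, u z p i = if P z p (u z p) (Denumerable.ofNat _ i) then 1 else 0 :=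
    fun z p i => (congrFun (hu z p) i).symm
  have hlab : ∀ z p σ, setTree (u z p) σ ↔ P z p (u z p) σ := by
    intro z p σ
    rw [setTree, lab, hu', Denumerable.ofNat_encode]
    simp
  have hloc : ∀ z z' p p' n, pre z n = pre z' n → pre p n = pre p' n →
      pre (u z p) n = pre (u z' p') n := by
    intro z z' p p' n hz hp
    induction n with
    | zero => rfl
    | succ n ih =>
      have hz' := pre_eq_of_le hz n.le_succ
      have hp' := pre_eq_of_le hp n.le_succ
      rw [pre, pre, ih hz' hp', hu', hu' z']
      simp only [hP hz' hp' (ih hz' hp') (length_ofNat_le n)]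
  refine ⟨u, continuous_pi fun i => ?_, fun z p => ⟨?_, ?_⟩⟩
  · rw [← IsLocallyConstant.iff_continuous, IsLocallyConstant.iff_eventually_eq]
    intro a
    filter_upwards [(IsLocallyConstant.iff_eventually_eq _).1
      (isLocallyConstant_pre continuous_fst (i + 1)) a,
      (IsLocallyConstant.iff_eventually_eq _).1
      (isLocallyConstant_pre continuous_snd (i + 1)) a] with b h1 h2
    exact pre_eq_pre.1 (hloc _ _ _ _ _ h1 h2) i i.lt_succ_self
  · rintro ⟨w, hw⟩
    have : ∀ n, ∃ u' z' p' b', ((u', z', p'), b') ∈ D ∧ pre u' n = pre (u z p) n ∧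
        pre z' n = pre z n ∧ pre p' n = pre p n ∧ pre b' n = pre w n := by
      intro n
      obtain ⟨u', z', p', b', h, h1, h2, h3, h4⟩ := (hlab z p _).1 (hw n)
      rw [length_pre] at h1 h2 h3 h4
      exact ⟨u', z', p', b', h, pre_eq_of_le h1 n.le_succ, pre_eq_of_le h2 n.le_succ,
        pre_eq_of_le h3 n.le_succ, pre_eq_of_le h4 n.le_succ⟩
    choose u' z' p' b' h h1 h2 h3 h4 using this
    exact (hDW _).2 ⟨w, hD.mem_of_tendsto
      (((tendsto_of_pre_eq h1).prodMk_nhds ((tendsto_of_pre_eq h2).prodMk_nhds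
        (tendsto_of_pre_eq h3))).prodMk_nhds (tendsto_of_pre_eq h4)) (.of_forall h)⟩
  · intro h
    obtain ⟨b, hb⟩ := (hDW _).1 h
    exact ⟨b, fun k => (hlab z p _).2 ⟨_, _, _, b, hb, rfl, rfl, rfl, by rw [length_pre]⟩⟩

/-- For `z = g` a code of a closed set, the section at `(g, y)` of the tree of that set. -/
def sectionTree (z y : NN) (τ : List ℕ) : Prop :=
  z (Encodable.encode (pre z τ.length, pre y τ.length, τ)) = 0

/-- The sequence of first coordinates of a sequence of pairs. -/
def fstSeq (r : NN) : NN := fun i => (r i).unpair.1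

/-- The sequence of second coordinates of a sequence of pairs. -/
def sndSeq (r : NN) : NN := fun i => (r i).unpair.2

lemma continuous_fstSeq : Continuous fstSeq :=
  continuous_pi fun i => (continuous_of_discreteTopology (f := fun k : ℕ =>
    k.unpair.1)).comp (continuous_apply i)

lemma continuous_sndSeq : Continuous sndSeq :=
  continuous_pi fun i => (continuous_of_discreteTopology (f := fun k : ℕ =>
    k.unpair.2)).comp (continuous_apply i)

/-- `r` codes a section and a map from the tree of that section to the tree coded by `u`. -/
def Reduces (u z r : NN) : Prop := Emb (sectionTree z (fstSeq r)) (setTree u) (sndSeq r)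

section LocallyConstant

variable {α : Type*} [TopologicalSpace α] {u z r x h p q : α → NN}

lemma isLocallyConstant_sectionTree {y : α → NN} (hz : Continuous z) (hy : Continuous y)
    (τ : List ℕ) : IsLocallyConstant fun a => sectionTree (z a) (y a) τ :=
  (((isLocallyConstant_pre hz τ.length).prodMk (isLocallyConstant_pre hy τ.length)).bind
    (g := fun l a => z a (Encodable.encode (l.1, l.2, τ)))
    fun _ => isLocallyConstant_eval hz _).comp (· = 0)

lemma isClosed_reduces (hu : Continuous u) (hz : Continuous z) (hr : Continuous r) :
    IsClosed {a | Reduces (u a) (z a) (r a)} := by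
  simp only [Reduces, Emb, ofPred_forall]
  refine isClosed_iInter fun m => isClosed_iInter fun τ => IsLocallyConstant.isClosed_prop
    (P := fun a => Reach (sectionTree (z a) (fstSeq (r a))) (m :: τ) →
      setTree (u a) (lmap (sndSeq (r a)) (m :: τ))) ?_
  refine (isLocallyConstant_reach (isLocallyConstant_sectionTree hz
    (continuous_fstSeq.comp hr)) _).comp₂ (h := fun P Q => P → Q) ?_
  exact (isLocallyConstant_lmap (continuous_sndSeq.comp hr) _).bind
    (g := fun l a => setTree (u a) l) fun l => (isLocallyConstant_eval hu _).comp (· = 1)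

/-- Up to precision `n` there is a reduction below the shift of `x` by `k`. -/
def BddReduces (u z : NN) (n : ℕ) (x : NN) (k : ℕ) : Prop :=
  ∃ u' z' r', Reduces u' z' r' ∧ pre u' n = pre u n ∧ pre z' n = pre z n ∧
    ∀ i < n, r' i ≤ x (k + i)

lemma isLocallyConstant_bddReduces (hu : Continuous u) (hz : Continuous z) (hx : Continuous x)
    (n k : ℕ) : IsLocallyConstant fun a => BddReduces (u a) (z a) n (x a) k := by
  rw [IsLocallyConstant.iff_eventually_eq]
  intro a
  filter_upwards [(IsLocallyConstant.iff_eventually_eq _).1 (isLocallyConstant_pre hu n) a,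
    (IsLocallyConstant.iff_eventually_eq _).1 (isLocallyConstant_pre hz n) a,
    (IsLocallyConstant.iff_eventually_eq _).1 (isLocallyConstant_pre hx (k + n)) a]
    with b h1 h2 h3
  have : ∀ i < n, x b (k + i) = x a (k + i) := fun i hi => pre_eq_pre.1 h3 _ (by omega)
  simp +contextual only [BddReduces, h1, h2, this]

/-- `h` witnesses that no reduction is below any shift of `x`. -/
def Escapes (u z x h : NN) : Prop := ∀ k, ¬ BddReduces u z (h k) x k

lemma isClosed_escapes (hu : Continuous u) (hz : Continuous z) (hx : Continuous x)
    (hh : Continuous h) : IsClosed {a | Escapes (u a) (z a) (x a) (h a)} := by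
  simp only [Escapes, ofPred_forall]
  exact isClosed_iInter fun k => IsLocallyConstant.isClosed_prop
    (((isLocallyConstant_eval hh k).bind (g := fun n a => BddReduces (u a) (z a) n (x a) k) fun n =>
      isLocallyConstant_bddReduces hu hz hx n k).comp Not)

/-- `q` is an increasing sequence of triples whose first components increase and whose last
components code initial segments of `p`. -/
def Encodes (p q : NN) : Prop :=
  StrictMono q ∧ StrictMono (fstSeq q) ∧
    ∀ n, sndSeq (sndSeq q) n = Encodable.encode (pre p (fstSeq q n))

lemma isClosed_strictMono (hq : Continuous q) : IsClosed {a | StrictMono (q a)} := by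
  simp only [StrictMono, ofPred_forall]
  exact isClosed_iInter fun i => isClosed_iInter fun j => isClosed_iInter fun _ =>
    IsLocallyConstant.isClosed_prop
      ((isLocallyConstant_eval hq i).comp₂ (isLocallyConstant_eval hq j) (· < ·))

lemma isClosed_encodes (hp : Continuous p) (hq : Continuous q) :
    IsClosed {a | Encodes (p a) (q a)} := by
  refine (isClosed_strictMono hq).inter ((isClosed_strictMono (continuous_fstSeq.comp hq)).inter ?_)
  rw [show (fun a => ∀ n, sndSeq (sndSeq (q a)) n = Encodable.encode (pre (p a) (fstSeq (q a) n)))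
    = fun a => a ∈ ⋂ n, {a | sndSeq (sndSeq (q a)) n =
      Encodable.encode (pre (p a) (fstSeq (q a) n))} by simp]
  exact isClosed_iInter fun n => IsLocallyConstant.isClosed_prop
    ((isLocallyConstant_eval (continuous_sndSeq.comp (continuous_sndSeq.comp hq)) n).comp₂
      ((isLocallyConstant_eval (continuous_fstSeq.comp hq) n).bind
        (g := fun k a => Encodable.encode (pre (p a) k)) fun k =>
          (isLocallyConstant_pre hp k).comp _) Eq)

/-- The sequence whose initial segments are coded in `q`. -/
def decoded (q : NN) : NN := fun i =>
  (Denumerable.ofNat (List ℕ) (sndSeq (sndSeq q) (i + 1))).reverse.getD i 0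

lemma continuous_decoded : Continuous decoded :=
  continuous_pi fun i => (continuous_of_discreteTopology (f := fun k =>
    (Denumerable.ofNat (List ℕ) k).reverse.getD i 0)).comp
      ((continuous_apply (i + 1)).comp (continuous_sndSeq.comp continuous_sndSeq))

lemma getD_reverse_pre (p : NN) {i n : ℕ} (h : i < n) : (pre p n).reverse.getD i 0 = p i := by
  induction n, h using Nat.le_induction with
  | base => simp [pre, List.getD_eq_getElem?_getD]
  | succ n h ih =>
    rw [pre, List.reverse_cons, List.getD_append _ _ _ _ (by simpa using h), ih]

lemma Encodes.decoded_eq {p q : NN} (h : Encodes p q) : decoded q = p := by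
  funext i
  rw [decoded, h.2.2, Denumerable.ofNat_encode, getD_reverse_pre]
  exact i.lt_succ_self.trans_le (h.2.1.le_apply)

/-- The sequence `q` encodes `p` and escapes all reductions of sections at `z` to `u`. -/
def Mem (u z p q : NN) : Prop := Encodes p q ∧ Escapes u z (fstSeq q) (fstSeq (sndSeq q))

lemma isClosed_mem (hu : Continuous u) (hz : Continuous z) (hp : Continuous p)
    (hq : Continuous q) : IsClosed {a | Mem (u a) (z a) (p a) (q a)} :=
  (isClosed_encodes hp hq).inter (isClosed_escapes hu hz (continuous_fstSeq.comp hq)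
    (continuous_fstSeq.comp (continuous_sndSeq.comp hq)))

/-- The shift on sequences. -/
def tailSeq (q : NN) : NN := fun i => q (i + 1)

lemma Mem.tailSeq {u z p q : NN} (h : Mem u z p q) : Mem u z p (tailSeq q) := by
  refine ⟨⟨fun i j hij => h.1.1 (Nat.add_lt_add_right hij 1),
    fun i j hij => h.1.2.1 (Nat.add_lt_add_right hij 1), fun n => h.1.2.2 (n + 1)⟩,
    fun k => ?_⟩
  rintro ⟨u', z', r', h', h1, h2, h3⟩
  refine h.2 (k + 1) ⟨u', z', r', h', h1, h2, fun i hi => ?_⟩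
  rw [add_right_comm]
  exact h3 i hi

end LocallyConstant

section Measurable

variable {α : Type*} [MeasurableSpace α]

lemma measurableSet_isEval {p q v : α → NN} (hp : Measurable p) (hq : Measurable q)
    (hv : Measurable v) : MeasurableSet {a | IsEval (p a) (q a) (v a)} := by
  have hn : Measurable fun a : ℕ × NN × NN => node a.1 a.2.1 a.2.2 :=
    measurable_from_prod_countable_right measurable_node
  simp only [IsEval, ofPred_forall]
  refine MeasurableSet.iInter fun m => MeasurableSet.iInter fun σ => measurableSet_eq_fun
    ((measurable_lab _).comp hv) (hn.comp (((measurable_lab _).comp hp).prodMk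
      (hq.prodMk (measurable_pi_lambda _ fun j => (measurable_lab _).comp hv))))

lemma measurableSet_eventually_zero {p w : α → NN} (hp : Measurable p) (hw : Measurable w) :
    MeasurableSet {a | ∃ N, ∀ n ≥ N, lab (p a) (pre (w a) n) = 0} := by
  have h : ∀ n, Measurable fun b : NN × NN => lab b.1 (pre b.2 n) := fun n =>
    (IsLocallyConstant.bind (isLocallyConstant_pre continuous_snd n)
      (g := fun l (b : NN × NN) => lab b.1 l) fun l =>
        isLocallyConstant_eval continuous_fst _).continuous.measurable
  simp only [ofPred_forall, ofPred_exists]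
  exact MeasurableSet.iUnion fun N => MeasurableSet.iInter fun n => MeasurableSet.iInter fun _ =>
    ((h n).comp (hp.prodMk hw)) (measurableSet_singleton 0)

end Measurable

lemma not_wf_iff {g : List ℕ → ℕ} : ¬ WF g ↔ ∃ w, ∃ N, ∀ n ≥ N, g (pre w n) = 0 := by
  simp [WF]

/-- The parameter `p` is ill-founded, or some `q` and its shift get the same color from the
function coded by `p`. -/
def Refuted (u z p : NN) : Prop :=
  ¬ WF (lab p) ∨ ∃ q v v', Mem u z p q ∧ IsEval p q v ∧ IsEval p (tailSeq q) v' ∧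
    lab v [0] % (p 0 + 1) = lab v' [0] % (p 0 + 1)

set_option synthInstance.maxSize 2000 in
lemma analyticSet_refuted : AnalyticSet {a : NN × NN × NN | Refuted a.1 a.2.1 a.2.2} := by
  let M : Set ((NN × NN × NN) × NN × NN × NN) :=
    {a | ∃ N, ∀ n ≥ N, lab a.1.2.2 (pre a.2.1 n) = 0} ∪
    ({a | Mem a.1.1 a.1.2.1 a.1.2.2 a.2.1} ∩ ({a | IsEval a.1.2.2 a.2.1 a.2.2.1} ∩
      ({a | IsEval a.1.2.2 (tailSeq a.2.1) a.2.2.2} ∩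
        {a | lab a.2.2.1 [0] % (a.1.2.2 0 + 1) = lab a.2.2.2 [0] % (a.1.2.2 0 + 1)})))
  have ht : Measurable tailSeq := measurable_pi_lambda _ fun i => measurable_pi_apply _
  have hM : MeasurableSet M := by
    refine (measurableSet_eventually_zero (by fun_prop) (by fun_prop)).union
      (MeasurableSet.inter ?_ ((measurableSet_isEval (by fun_prop) (by fun_prop)
        (by fun_prop)).inter ((measurableSet_isEval (by fun_prop) (ht.comp (by fun_prop))
          (by fun_prop)).inter (measurableSet_eq_fun ?_ ?_))))
    · exact (isClosed_mem (by fun_prop) (by fun_prop) (by fun_prop) (by fun_prop)).measurableSet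
    all_goals
      exact (measurable_of_countable fun k : ℕ × ℕ => k.1 % (k.2 + 1)).comp
        (((measurable_lab _).comp (by fun_prop)).prodMk
          ((measurable_pi_apply 0).comp (by fun_prop)))
  convert hM.analyticSet.image_of_continuous continuous_fst
  ext a
  simp only [mem_ofPred_eq, Refuted, not_wf_iff, mem_image, Prod.exists, exists_and_right,
    exists_eq_right, M, mem_union, mem_inter_iff]
  constructor
  · rintro (⟨w, h⟩ | ⟨q, v, v', h⟩)
    exacts [⟨w, 0, 0, Or.inl h⟩, ⟨q, v, v', Or.inr h⟩]
  · rintro ⟨q, v, w, h | h⟩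
    exacts [Or.inl ⟨q, h⟩, Or.inr ⟨q, v, w, h⟩]

/-- The self-referential choice of a tree for the parameters `z` and `p`. -/
noncomputable def selfRef : NN → NN → NN :=
  Classical.choose (exists_selfReferential analyticSet_refuted)

lemma continuous_selfRef : Continuous fun a : NN × NN => selfRef a.1 a.2 :=
  (Classical.choose_spec (exists_selfReferential analyticSet_refuted)).1

lemma illFounded_selfRef {z p : NN} :
    IllFounded (setTree (selfRef z p)) ↔ Refuted (selfRef z p) z p :=
  (Classical.choose_spec (exists_selfReferential analyticSet_refuted)).2 z p

/-- The vertices of the shift graph associated with `z`. -/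
def vertices (z : NN) : Set IncSeq :=
  {q | Mem (selfRef z (decoded q.1)) z (decoded q.1) q.1}

lemma isClosed_vertices_prod : IsClosed {a : NN × IncSeq | a.2 ∈ vertices a.1} := by
  have hq : Continuous fun a : NN × IncSeq => a.2.1 := continuous_subtype_val.comp continuous_snd
  have hp := continuous_decoded.comp hq
  have hu : Continuous fun a : NN × IncSeq => selfRef a.1 (decoded a.2.1) :=
    continuous_selfRef.comp (continuous_fst.prodMk hp)
  exact isClosed_mem hu continuous_fst hp hq

lemma isClosed_vertices (z : NN) : IsClosed (vertices z) :=
  isClosed_vertices_prod.preimage (f := fun q : IncSeq => (z, q)) (by fun_prop)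

lemma mem_vertices {z p : NN} {q : IncSeq} (h : Mem (selfRef z p) z p q.1) : q ∈ vertices z := by
  rw [vertices, mem_ofPred_eq, h.1.decoded_eq]
  exact h

lemma shift_mem_vertices {z : NN} {q : IncSeq} (h : q ∈ vertices z) : shift q ∈ vertices z :=
  mem_vertices (q := shift q) (Mem.tailSeq h)

lemma exists_reduces_of_bddReduces {u z x : NN} {k : ℕ} (h : ∀ n, BddReduces u z n x k) :
    ∃ r, Reduces u z r := by
  obtain ⟨r, hr, -⟩ := exists_mem_iInter_of_bounded
    (F := fun n => {r | ∃ u' z' r', Reduces u' z' r' ∧ pre u' n = pre u n ∧ pre z' n = pre z n ∧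
      pre r' n = pre r n})
    (fun m n hmn r ⟨u', z', r', h, h1, h2, h3⟩ => ⟨u', z', r', h, pre_eq_of_le h1 hmn,
      pre_eq_of_le h2 hmn, pre_eq_of_le h3 hmn⟩)
    (fun n r r' hr ⟨u', z', r'', h, h1, h2, h3⟩ => ⟨u', z', r'', h, h1, h2, h3.trans hr⟩)
    (fun i => x (k + i)) fun n => by
      obtain ⟨u', z', r', h, h1, h2, h3⟩ := h n
      exact ⟨r', ⟨u', z', r', h, h1, h2, rfl⟩, h3⟩
  choose u' z' r' h' h1 h2 h3 using hr
  have hc : IsClosed {a : NN × NN × NN | Reduces a.1 a.2.1 a.2.2} :=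
    isClosed_reduces (by fun_prop) (by fun_prop) (by fun_prop)
  exact ⟨r, hc.mem_of_tendsto ((tendsto_of_pre_eq h1).prodMk_nhds
    ((tendsto_of_pre_eq h2).prodMk_nhds (tendsto_of_pre_eq h3))) (.of_forall h')⟩

lemma monotone_encode_pre (p : NN) : Monotone fun n => Encodable.encode (pre p n) :=
  monotone_nat_of_le_succ fun n => by
    rw [pre, Encodable.encode_list_cons]
    exact (Nat.right_le_pair _ _).trans (Nat.le_succ _)

lemma monotone_pair (a : ℕ) : Monotone (Nat.pair a) :=
  StrictMono.monotone fun _ _ => Nat.pair_lt_pair_right a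

/-- If no section at `z` reduces to the tree `selfRef z p`, then this tree is ill-founded. -/
lemma illFounded_of_forall_not_reduces {z p : NN} (h : ∀ r, ¬ Reduces (selfRef z p) z r) :
    IllFounded (setTree (selfRef z p)) := by
  rw [illFounded_selfRef]
  by_cases hp : WF (lab p)
  swap
  · exact Or.inl hp
  right
  set u := selfRef z p
  have esc : ∀ (x : IncSeq) k, ∃ n, ¬ BddReduces u z n x.1 k := fun x k => by
    by_contra! hx
    obtain ⟨r, hr⟩ := exists_reduces_of_bddReduces hx
    exact h r hr
  let H : IncSeq → NN := fun x k => sInf {n | ¬ BddReduces u z n x.1 k}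
  have hH : ∀ x k, ¬ BddReduces u z (H x k) x.1 k := fun x k => Nat.sInf_mem (esc x k)
  have hHmono : ∀ x, Monotone (H x) := fun x => monotone_nat_of_le_succ fun k =>
    Nat.sInf_le fun ⟨u', z', r', h', h1, h2, h3⟩ => hH x (k + 1)
      ⟨u', z', r', h', h1, h2, fun i hi => (h3 i hi).trans (x.2.monotone (by omega))⟩
  have hHmeas : Measurable H := measurable_pi_lambda _ fun k => by
    classical
    have : (fun x => H x k) = fun x => Nat.find (esc x k) := funext fun x => by
      convert Nat.sInf_def (esc x k)
      rfl
    rw [this]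
    exact measurable_find _ fun n => (((isLocallyConstant_bddReduces continuous_const
      continuous_const continuous_subtype_val n k).comp Not).isClosed_prop).measurableSet
  let Q : IncSeq → NN := fun x n =>
    Nat.pair (x.1 n) (Nat.pair (H x n) (Encodable.encode (pre p (x.1 n))))
  have hQmeas : Measurable Q := measurable_pi_lambda _ fun n =>
    (measurable_of_countable fun k : ℕ × ℕ =>
      Nat.pair k.1 (Nat.pair k.2 (Encodable.encode (pre p k.1)))).comp
        (((measurable_pi_apply n).comp measurable_subtype_coe).prodMk
          ((measurable_pi_apply n).comp hHmeas))
  have h1 : ∀ x, fstSeq (Q x) = x.1 := fun x => by funext n; simp [fstSeq, Q]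
  have h2 : ∀ x, fstSeq (sndSeq (Q x)) = H x := fun x => by funext n; simp [fstSeq, sndSeq, Q]
  have h3 : ∀ x n, sndSeq (sndSeq (Q x)) n = Encodable.encode (pre p (x.1 n)) := fun x n => by
    simp [sndSeq, Q]
  have hQ : ∀ x, Mem u z p (Q x) := by
    refine fun x => ⟨⟨strictMono_nat_of_lt_succ fun n => ?_, ?_, fun n => ?_⟩, ?_⟩
    · refine (Nat.pair_lt_pair_left _ (x.2 n.lt_succ_self)).trans_le (monotone_pair _ ?_)
      refine le_trans ?_ (monotone_pair _ (monotone_encode_pre p (x.2.monotone n.le_succ)))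
      exact (StrictMono.monotone fun _ _ => Nat.pair_lt_pair_left _) (hHmono x n.le_succ)
    · rw [h1]; exact x.2
    · rw [h1, h3]
    · rw [h1, h2]; exact hH x
  have hQS : ∀ x, Q (shift x) = tailSeq (Q x) := by
    intro x
    have : ∀ k, H (shift x) k = H x (k + 1) := fun k => by
      simp only [H, BddReduces, shift, add_right_comm]
    funext n
    simp only [Q, this, tailSeq]
    rfl
  obtain ⟨V, hV, hV'⟩ := exists_eval hp
  obtain ⟨x, hx⟩ := exists_eq_shift (κ := fun x => lab (V (Q x)) [0] % (p 0 + 1))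
    ((measurable_of_countable fun k => k % (p 0 + 1)).comp
      ((measurable_lab _).comp (hV.comp hQmeas)))
    (m := p 0 + 1) fun x => Nat.mod_lt _ (Nat.succ_pos _)
  exact ⟨Q x, V (Q x), V (Q (shift x)), hQ x, hV' _, hQS x ▸ hV' _, hx⟩

lemma shiftEdge_shift (x : IncSeq) : shiftEdge x (shift x) := by
  refine ⟨fun h => ?_, Or.inl rfl⟩
  have : x.1 0 = x.1 1 := congrFun (congrArg Subtype.val h) 0
  exact (x.2 zero_lt_one).ne this

lemma not_borelColoringLE_vertices {z : NN} (hz : ∀ y, IllFounded (sectionTree z y)) (m : ℕ) :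
    ¬ BorelColoringLE (vertices z) m := by
  rintro ⟨c, hc, hc'⟩
  have he : MeasurableEmbedding fun q : vertices z => q.1.1 :=
    (MeasurableEmbedding.subtype_coe measurableSet_strictMono).comp
      (MeasurableEmbedding.subtype_coe (isClosed_vertices z).measurableSet)
  obtain ⟨F, hF, hFc⟩ := he.exists_measurable_extend (g := fun q => (c q : ℕ))
    ((measurable_of_countable _).comp hc) fun _ => ⟨0⟩
  obtain ⟨p, hp, hpm, hpv⟩ := exists_code (F := fun q _ => F q)
    (measurable_pi_lambda _ fun _ => hF) m
  have hS : IllFounded (setTree (selfRef z p)) := by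
    by_contra hS
    exact hS (illFounded_of_forall_not_reduces fun r hr => hS (hr.illFounded (hz _)))
  obtain h | ⟨q, v, v', hq, hv, hv', hvv⟩ := illFounded_selfRef.1 hS
  · exact h hp
  let x : IncSeq := ⟨q, hq.1.1⟩
  have hx : x ∈ vertices z := mem_vertices hq
  have h1 : F q = c ⟨x, hx⟩ := congrFun hFc ⟨x, hx⟩
  have h2 : F (tailSeq q) = c ⟨shift x, shift_mem_vertices hx⟩ :=
    congrFun hFc ⟨shift x, shift_mem_vertices hx⟩
  have hpm' : p 0 = m := hpm
  rw [hpv _ _ hv, hpv _ _ hv', h1, h2, hpm', Nat.mod_eq_of_lt, Nat.mod_eq_of_lt] at hvv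
  · refine hc' ⟨x, hx⟩ ⟨shift x, shift_mem_vertices hx⟩
      (shiftEdge_shift x) (Fin.ext ?_)
    omega
  all_goals omega

lemma measurable_shift : Measurable shift :=
  Measurable.subtype_mk (f := fun x : IncSeq => tailSeq x.1) (measurable_pi_lambda _ fun n =>
    (measurable_pi_apply (n + 1)).comp measurable_subtype_coe)

lemma iterate_shift_apply (q : IncSeq) (n i : ℕ) : (shift^[n] q).1 i = q.1 (i + n) := by
  induction n generalizing i with
  | zero => rfl
  | succ n ih =>
    rw [Function.iterate_succ_apply']
    exact (ih (i + 1)).trans (congrArg q.1 (by omega))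

lemma borelColoringLE_three {C A : Set IncSeq} (hA : MeasurableSet A)
    (hC : ∀ q ∈ C, shift q ∈ C) (h1 : ∀ q ∈ C, ∃ n, shift^[n] q ∈ A)
    (h2 : ∀ q ∈ C, ∃ n, shift^[n] q ∉ A) : BorelColoringLE C 3 := by
  classical
  let M : Set IncSeq := A ∩ shift ⁻¹' Aᶜ
  have hit : ∀ n, ∀ q ∈ C, q ∈ A → shift^[n] q ∉ A → ∃ k, shift^[k] q ∈ M := by
    intro n
    induction n with
    | zero => exact fun q _ h h' => (h' h).elim
    | succ n ih =>
      intro q hq h h'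
      by_cases hs : shift q ∈ A
      · obtain ⟨k, hk⟩ := ih (shift q) (hC q hq) hs h'
        exact ⟨k + 1, hk⟩
      · exact ⟨0, h, hs⟩
  have hCn : ∀ n, ∀ q ∈ C, shift^[n] q ∈ C := fun n q hq => by
    induction n with
    | zero => exact hq
    | succ n ih => rw [Function.iterate_succ_apply']; exact hC _ ih
  have hM : ∀ q : C, ∃ n, shift^[n] q.1 ∈ M := by
    intro q
    obtain ⟨n, hn⟩ := h1 q q.2
    obtain ⟨m, hm⟩ := h2 _ (hCn n q q.2)
    obtain ⟨k, hk⟩ := hit m _ (hCn n q q.2) hn hm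
    exact ⟨k + n, by rwa [Function.iterate_add_apply]⟩
  let t : C → ℕ := fun q => Nat.find (hM q)
  have ht : Measurable t := measurable_find hM fun n =>
    (measurable_shift.iterate n).comp measurable_subtype_coe
      (hA.inter (measurable_shift hA.compl))
  have key : ∀ (q : C) (q' : C), shift q.1 = q'.1 →
      (t q = 0 ∧ t q' ≠ 0) ∨ t q = t q' + 1 := by
    intro q q' hq
    by_cases h0 : t q = 0
    · refine Or.inl ⟨h0, fun h => ?_⟩
      have ha : shift^[t q] q.1 ∈ M := Nat.find_spec (hM q)
      have hb : shift^[t q'] q'.1 ∈ M := Nat.find_spec (hM q')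
      rw [h0] at ha
      rw [h] at hb
      exact ha.2 (hq ▸ hb.1)
    · right
      obtain ⟨k, hk⟩ := Nat.exists_eq_succ_of_ne_zero h0
      rw [hk, Nat.succ_eq_add_one, Nat.add_right_cancel_iff]
      have ha : ∀ n, shift^[n] q'.1 = shift^[n + 1] q.1 := fun n => by
        rw [Function.iterate_succ_apply, hq]
      symm
      rw [Nat.find_eq_iff]
      obtain ⟨hs, hl⟩ := (Nat.find_eq_iff (hM q)).1 hk
      exact ⟨by rw [ha]; exact hs, fun n hn => by rw [ha]; exact hl _ (Nat.succ_lt_succ hn)⟩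
  let col : ℕ → Fin 3 := fun n => if n = 0 then 2 else if n % 2 = 0 then 0 else 1
  have hcol : ∀ m n, (m = 0 ∧ n ≠ 0) ∨ m = n + 1 → col m ≠ col n := by
    intro m n h
    simp only [col]
    split_ifs <;> simp <;> omega
  refine ⟨fun q => col (t q), (measurable_of_countable col).comp ht, ?_⟩
  rintro q q' ⟨-, h | h⟩
  · exact hcol _ _ (key q q' h)
  · exact (hcol _ _ (key q' q h)).symm

lemma IllFounded.not_acc {T : List ℕ → Prop} (h : IllFounded T) : ¬ Acc (Child T) [] := by
  obtain ⟨w, hw⟩ := h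
  exact not_acc_iff_exists_descending_chain.2 ⟨fun n => pre w n, rfl, fun n => ⟨hw n, _, rfl⟩⟩

lemma exists_measurable_reduces {z y : NN} (hy : ¬ IllFounded (sectionTree z y)) :
    ∃ r : NN → NN, Measurable r ∧ ∀ p, Reduces (selfRef z p) z (r p) := by
  have hacc : ∀ y : {y // ¬ IllFounded (sectionTree z y)}, Acc (Child (sectionTree z y.1)) [] :=
    fun y => acc_of_not_illFounded y.2
  obtain ⟨y, -, hmin⟩ := WellFounded.has_min
    (InvImage.wf (fun y => (hacc y).rank) Ordinal.lt_wf) univ ⟨⟨y, hy⟩, trivial⟩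
  have hF : ∀ p, ¬ Fail (sectionTree z y.1) (setTree (selfRef z p)) [] [] := by
    intro p hp
    have hS := hp.acc
    refine (illFounded_of_forall_not_reduces fun r hr => ?_).not_acc hS
    have hT : Acc (Child (sectionTree z (fstSeq r))) [] := hr.acc hS [] trivial rfl
    exact hmin ⟨fstSeq r, fun h => h.not_acc hT⟩ trivial
      ((hr.rank_le hT trivial hS).trans_lt (hp.rank_lt (hacc y) hS))
  obtain ⟨v, hv, hv'⟩ := exists_measurable_emb (hacc y)
    (S := fun p => setTree (selfRef z p)) (fun σ => by
      have hc : Continuous fun p => selfRef z p :=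
        continuous_selfRef.comp (continuous_const.prodMk continuous_id)
      exact ((isLocallyConstant_eval hc _).comp (· = 1)).isClosed_prop.measurableSet) hF
  refine ⟨fun p i => Nat.pair (y.1 i) (v p i), measurable_pi_lambda _ fun i =>
    (measurable_of_countable (Nat.pair (y.1 i))).comp ((measurable_pi_apply i).comp hv),
    fun p => ?_⟩
  have h1 : fstSeq (fun i => Nat.pair (y.1 i) (v p i)) = y.1 := by
    funext i
    simp [fstSeq]
  have h2 : sndSeq (fun i => Nat.pair (y.1 i) (v p i)) = v p := by
    funext i
    simp [sndSeq]
  rw [Reduces, h1, h2]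
  exact hv' p

lemma exists_not_crosses {x h r a : NN} (hx : StrictMono x) (ha : StrictMono a)
    (hra : ∀ i, r (i + 1) ≤ a i) (hh : ∀ k, ∃ i < h k, x (k + i) < r i) :
    ∃ n, ¬ ∃ i, x n < a i ∧ a i ≤ x (n + 1) := by
  by_contra! hcross
  have key : ∀ k i, ∃ j ≥ i, a j ≤ x (k + (i + 1)) := by
    intro k i
    induction i with
    | zero =>
      obtain ⟨j, -, hj⟩ := hcross k
      exact ⟨j, Nat.zero_le _, hj⟩
    | succ i ih =>
      obtain ⟨j, hj, hj'⟩ := ih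
      obtain ⟨l, hl, hl'⟩ := hcross (k + (i + 1))
      exact ⟨l, hj.trans_lt (ha.lt_iff_lt.1 (hj'.trans_lt hl)), hl'⟩
  obtain ⟨i, -, hi⟩ := hh (r 0)
  cases i with
  | zero => exact hi.not_ge hx.le_apply
  | succ i =>
    obtain ⟨j, hj, hj'⟩ := key (r 0) i
    exact hi.not_ge ((hra i).trans ((ha.monotone hj).trans hj'))

lemma exists_crosses {x a : NN} (hx : StrictMono x) (ha : StrictMono a) :
    ∃ n, ∃ i, x n < a i ∧ a i ≤ x (n + 1) := by
  have h : ∃ n, a (x 0 + 1) ≤ x n := ⟨_, hx.le_apply⟩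
  have h0 : x 0 < a (x 0 + 1) := (Nat.lt_succ_self _).trans_le ha.le_apply
  classical
  obtain ⟨n, hn⟩ := Nat.exists_eq_succ_of_ne_zero (n := Nat.find h) fun h' =>
    h0.not_ge (by have := Nat.find_spec h; rwa [h'] at this)
  refine ⟨n, x 0 + 1, not_le.1 (Nat.find_min h (by omega)), ?_⟩
  have := Nat.find_spec h
  rwa [hn] at this

lemma borelColoringLE_vertices {z y : NN} (hy : ¬ IllFounded (sectionTree z y)) :
    BorelColoringLE (vertices z) 3 := by
  obtain ⟨r, hr, hr'⟩ := exists_measurable_reduces hy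
  let a : NN → NN := fun p i => ∑ j ∈ Finset.range (i + 2), (r p j + 1)
  have ha : ∀ p, StrictMono (a p) := fun p => strictMono_nat_of_lt_succ fun i => by
    simp only [a, Finset.sum_range_succ _ (i + 2)]
    omega
  have hra : ∀ p i, r p (i + 1) ≤ a p i := fun p i => by
    simp only [a, Finset.sum_range_succ _ (i + 1)]
    omega
  have ham : ∀ i, Measurable fun q : IncSeq => a (decoded q.1) i := fun i =>
    (Finset.measurable_fun_sum _ fun j _ => ((measurable_pi_apply j).comp hr).add_const 1).comp
      (continuous_decoded.measurable.comp measurable_subtype_coe)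
  have hxm : ∀ i, Measurable fun q : IncSeq => fstSeq q.1 i := fun i =>
    (measurable_pi_apply i).comp (continuous_fstSeq.measurable.comp measurable_subtype_coe)
  let A : Set IncSeq := {q | ∃ i, fstSeq q.1 0 < a (decoded q.1) i ∧
    a (decoded q.1) i ≤ fstSeq q.1 1}
  have hA : MeasurableSet A := by
    simp only [A, ofPred_exists]
    exact MeasurableSet.iUnion fun i =>
      (measurableSet_lt (hxm 0) (ham i)).inter (measurableSet_le (ham i) (hxm 1))
  have hit : ∀ q ∈ vertices z, ∀ n, shift^[n] q ∈ A ↔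
      ∃ i, fstSeq q.1 n < a (decoded q.1) i ∧ a (decoded q.1) i ≤ fstSeq q.1 (n + 1) := by
    intro q hq n
    have h1 : decoded (shift^[n] q).1 = decoded q.1 := by
      suffices Mem (selfRef z (decoded q.1)) z (decoded q.1) (shift^[n] q).1 from
        this.1.decoded_eq
      induction n with
      | zero => exact hq
      | succ n ih => rw [Function.iterate_succ_apply']; exact ih.tailSeq
    have h2 : ∀ i, fstSeq (shift^[n] q).1 i = fstSeq q.1 (i + n) := fun i => by
      simp only [fstSeq, iterate_shift_apply]
    simp only [A, mem_ofPred_eq, h1, h2, zero_add, add_comm n 1]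
  refine borelColoringLE_three hA.compl (fun q => shift_mem_vertices) (fun q hq => ?_)
    fun q hq => ?_
  · simp only [mem_compl_iff, hit q hq]
    refine exists_not_crosses (h := fstSeq (sndSeq q.1)) hq.1.2.1 (ha _)
      (hra (decoded q.1)) fun k => ?_
    by_contra! hk
    exact hq.2 k ⟨_, _, _, hr' _, rfl, rfl, hk⟩
  · simp only [mem_compl_iff, not_not, hit q hq]
    exact exists_crosses hq.1.2.1 (ha _)

lemma exists_measurableEmbedding_NN (Y : Type*) [MeasurableSpace Y] [StandardBorelSpace Y] :
    ∃ j : Y → NN, MeasurableEmbedding j := by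
  obtain ⟨j, hj⟩ := exists_measurableEmbedding_real Y
  have h : ¬ Countable NN := by
    intro h
    obtain ⟨f, hf⟩ := exists_surjective_nat NN
    obtain ⟨n, hn⟩ := hf fun i => f i i + 1
    have := congrFun hn n
    omega
  have e : ℝ ≃ᵐ NN := PolishSpace.measurableEquivOfNotCountable not_countable h
  exact ⟨e ∘ j, e.measurableEmbedding.comp hj⟩

/-- The increasing sequence whose successive differences are read off from an evaluation. -/
def decSeq (v : NN) : IncSeq :=
  ⟨fun n => ∑ i ∈ Finset.range (n + 1), (lab v [i] - 1) + n, strictMono_nat_of_lt_succ fun n => by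
    rw [Finset.sum_range_succ _ (n + 1)]
    omega⟩

lemma measurable_decSeq : Measurable decSeq :=
  Measurable.subtype_mk (measurable_pi_lambda _ fun n => by
    refine Measurable.add ?_ measurable_const
    exact Finset.measurable_sum _ fun i _ =>
      (measurable_of_countable fun k : ℕ => k - 1).comp (measurable_lab _))

/-- The successive differences of an increasing sequence. -/
def gaps (x : IncSeq) : NN
  | 0 => x.1 0
  | i + 1 => x.1 (i + 1) - x.1 i - 1

lemma measurable_gaps : Measurable gaps := measurable_pi_lambda _ fun i => by
  have h : ∀ i, Measurable fun x : IncSeq => x.1 i := fun i =>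
    (measurable_pi_apply i).comp measurable_subtype_coe
  cases i with
  | zero => exact h 0
  | succ i =>
    exact (measurable_of_countable fun k : ℕ × ℕ => k.1 - k.2 - 1).comp
      ((h (i + 1)).prodMk (h i))

lemma decSeq_eq {v : NN} {x : IncSeq} (h : ∀ i, lab v [i] = gaps x i + 1) : decSeq v = x := by
  refine Subtype.ext (funext fun n => ?_)
  simp only [decSeq, h, Nat.add_sub_cancel]
  induction n with
  | zero => simp [gaps]
  | succ n ih =>
    have := x.2 n.lt_succ_self
    rw [Finset.sum_range_succ, gaps]
    simp only [Nat.succ_eq_add_one] at this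
    omega

set_option synthInstance.maxSize 2000 in
/-- Borel homomorphisms into the members of a Borel family of graphs, from the members of a
parametrized family, can be coded so that non-codes form an analytic set. -/
lemma exists_analyticSet_hom {X Y : Type} [TopologicalSpace X] [PolishSpace X]
    [TopologicalSpace Y] [PolishSpace Y] [MeasurableSpace Y] [BorelSpace Y]
    {E : Set (X × Y × Y)} (hE : AnalyticSet E) {G : Set X}
    (hG : AnalyticSet G) {R : Set (NN × IncSeq × IncSeq)} (hR : MeasurableSet R) :
    ∃ N : Set (NN × NN), AnalyticSet N ∧ ∀ z, (∃ x ∈ G, ∃ f : Y → IncSeq, Measurable f ∧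
      ∀ a b, (x, a, b) ∈ E → (z, f a, f b) ∈ R) ↔ ∃ y, (z, y) ∉ N := by
  have hG' := hG
  rw [AnalyticSet] at hG'
  rcases hG' with rfl | ⟨φ, hφ, rfl⟩
  · exact ⟨univ, MeasurableSet.univ.analyticSet, by simp⟩
  obtain ⟨D, hD, hDE⟩ := hE.exists_isClosed
  obtain ⟨j, hj⟩ := exists_measurableEmbedding_NN Y
  have hjm := hj.measurable
  have hfst : Measurable fstSeq := continuous_fstSeq.measurable
  have hsnd : Measurable sndSeq := continuous_sndSeq.measurable
  have hdec := measurable_decSeq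
  let M₁ : Set ((NN × NN) × NN) := {a | ∃ N, ∀ n ≥ N, lab (sndSeq a.1.2) (pre a.2 n) = 0}
  have hM₁ : MeasurableSet M₁ := measurableSet_eventually_zero (by fun_prop) (by fun_prop)
  let M₂ : Set ((NN × NN) × (Y × Y × NN) × NN × NN) :=
    {a | ((φ (fstSeq a.1.2), a.2.1.1, a.2.1.2.1), a.2.1.2.2) ∈ D} ∩
      ({a | IsEval (sndSeq a.1.2) (j a.2.1.1) a.2.2.1} ∩
        ({a | IsEval (sndSeq a.1.2) (j a.2.1.2.1) a.2.2.2} ∩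
          {a | (a.1.1, decSeq a.2.2.1, decSeq a.2.2.2) ∈ Rᶜ}))
  have hM₂ : MeasurableSet M₂ := by
    refine MeasurableSet.inter ?_ ((measurableSet_isEval (by fun_prop) (by fun_prop)
      (by fun_prop)).inter ((measurableSet_isEval (by fun_prop) (by fun_prop)
        (by fun_prop)).inter ?_))
    · have hc := continuous_fstSeq
      exact (hD.preimage (by fun_prop)).measurableSet
    · exact hR.compl.preimage (by fun_prop)
  refine ⟨Prod.fst '' M₁ ∪ Prod.fst '' M₂, ?_, fun z => ?_⟩
  · rw [union_eq_iUnion]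
    exact AnalyticSet.iUnion (Bool.forall_bool.2
      ⟨hM₂.analyticSet.image_of_continuous continuous_fst,
        hM₁.analyticSet.image_of_continuous continuous_fst⟩)
  have key : ∀ y, (z, y) ∉ Prod.fst '' M₁ ∪ Prod.fst '' M₂ ↔ WF (lab (sndSeq y)) ∧
      ∀ a b v v', (φ (fstSeq y), a, b) ∈ E → IsEval (sndSeq y) (j a) v →
        IsEval (sndSeq y) (j b) v' → (z, decSeq v, decSeq v') ∈ R := by
    intro y
    rw [mem_union, not_or]
    refine and_congr ?_ ?_
    · rw [← not_iff_not, not_not, not_wf_iff]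
      simp [M₁]
    · simp only [M₂, mem_image, Prod.exists, exists_and_right, exists_eq_right, mem_inter_iff,
        mem_ofPred_eq, mem_compl_iff, hDE]
      push Not
      constructor
      · intro h a b v v' ⟨c, hc⟩ h1 h2
        exact h a b c v v' hc h1 h2
      · intro h a b c v v' hc h1 h2
        exact h a b v v' ⟨c, hc⟩ h1 h2
  simp only [key]
  constructor
  · rintro ⟨_, ⟨y₁, rfl⟩, f, hf, hfE⟩
    obtain ⟨F, hF, hFf⟩ := hj.exists_measurable_extend (measurable_gaps.comp hf) fun _ => ⟨0⟩
    obtain ⟨p, hp, -, hpF⟩ := exists_code hF 0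
    refine ⟨fun i => Nat.pair (y₁ i) (p i), ?_⟩
    have h1 : fstSeq (fun i => Nat.pair (y₁ i) (p i)) = y₁ := by
      funext i
      simp [fstSeq]
    have h2 : sndSeq (fun i => Nat.pair (y₁ i) (p i)) = p := by
      funext i
      simp [sndSeq]
    rw [h1, h2]
    refine ⟨hp, fun a b v v' hab hv hv' => ?_⟩
    have hd : ∀ a v, IsEval p (j a) v → decSeq v = f a := fun a v hv => decSeq_eq fun i => by
      rw [hpF _ _ hv, show F (j a) = gaps (f a) from congrFun hFf a]
    rw [hd _ _ hv, hd _ _ hv']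
    exact hfE _ _ hab
  · rintro ⟨y, hy, h⟩
    obtain ⟨V, hV, hVe⟩ := exists_eval hy
    exact ⟨_, ⟨fstSeq y, rfl⟩, fun a => decSeq (V (j a)), hdec.comp (hV.comp hjm),
      fun a b hab => h a b _ _ hab (hVe _) (hVe _)⟩

/-- Every analytic set has a code whose sections compute the section of the set at that code. -/
lemma exists_sectionTree {N : Set (NN × NN)} (hN : AnalyticSet N) :
    ∃ g : NN, ∀ y, IllFounded (sectionTree g y) ↔ (g, y) ∈ N := by
  classical
  obtain ⟨K, hK, hKN⟩ := hN.exists_isClosed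
  let P : List ℕ × List ℕ × List ℕ → Prop := fun l => ∃ z' y' w', ((z', y'), w') ∈ K ∧
    pre z' l.2.2.length = l.1 ∧ pre y' l.2.2.length = l.2.1 ∧ pre w' l.2.2.length = l.2.2
  let g : NN := fun i => if P (Denumerable.ofNat _ i) then 0 else 1
  refine ⟨g, fun y => ?_⟩
  have hg : ∀ τ, sectionTree g y τ ↔ P (pre g τ.length, pre y τ.length, τ) := fun τ => by
    simp [sectionTree, g]
  rw [hKN]
  simp only [IllFounded, hg, P, length_pre]
  constructor
  · rintro ⟨w, hw⟩
    choose z' y' w' hK' hz hy hw' using hw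
    exact ⟨w, hK.mem_of_tendsto
      (((tendsto_of_pre_eq fun k => pre_eq_of_le (hz k) k.le_succ).prodMk_nhds
        (tendsto_of_pre_eq fun k => pre_eq_of_le (hy k) k.le_succ)).prodMk_nhds
          (tendsto_of_pre_eq fun k => pre_eq_of_le (hw' k) k.le_succ)) (.of_forall hK')⟩
  · rintro ⟨w, hw⟩
    exact ⟨w, fun k => ⟨g, y, w, hw, rfl, rfl, rfl⟩⟩

instance : SecondCountableTopology IncSeq :=
  TopologicalSpace.Subtype.secondCountableTopology _

lemma continuous_shift : Continuous shift :=
  Continuous.subtype_mk (f := fun x : IncSeq => tailSeq x.1) (continuous_pi fun n =>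
    (continuous_apply (n + 1)).comp continuous_subtype_val) _

lemma measurableSet_shiftEdge : MeasurableSet {a : IncSeq × IncSeq | shiftEdge a.1 a.2} := by
  have h₁ : IsClosed {a : IncSeq × IncSeq | a.1 = a.2} := isClosed_eq (by fun_prop) (by fun_prop)
  have h₂ : IsClosed {a : IncSeq × IncSeq | shift a.1 = a.2} :=
    isClosed_eq (continuous_shift.comp continuous_fst) (by fun_prop)
  have h₃ : IsClosed {a : IncSeq × IncSeq | shift a.2 = a.1} :=
    isClosed_eq (continuous_shift.comp continuous_snd) (by fun_prop)
  exact h₁.measurableSet.compl.inter (h₂.union h₃).measurableSet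

set_option synthInstance.maxSize 2000 in
/-- No countable sequence of Borel families of parametrized graphs characterizes infinite Borel
chromatic number by homomorphisms. -/
lemma exists_closed_not_iff {X Y : ℕ → Type} [∀ n, TopologicalSpace (X n)]
    [∀ n, PolishSpace (X n)] [∀ n, TopologicalSpace (Y n)] [∀ n, PolishSpace (Y n)]
    [∀ n, MeasurableSpace (Y n)] [∀ n, BorelSpace (Y n)] {E : ∀ n, Set (X n × Y n × Y n)}
    {G : ∀ n, Set (X n)} (hE : ∀ n, AnalyticSet (E n)) (hG : ∀ n, AnalyticSet (G n)) :
    ∃ C : Set IncSeq, IsClosed C ∧ ¬ ((¬ ∃ m, BorelColoringLE C m) ↔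
      ∃ n, ∃ x ∈ G n, ∃ f : Y n → IncSeq, Measurable f ∧ ∀ a b, (x, a, b) ∈ E n →
        f a ∈ C ∧ f b ∈ C ∧ shiftEdge (f a) (f b)) := by
  let R : Set (NN × IncSeq × IncSeq) :=
    {a | a.2.1 ∈ vertices a.1 ∧ a.2.2 ∈ vertices a.1 ∧ shiftEdge a.2.1 a.2.2}
  have hv := isClosed_vertices_prod.measurableSet
  have hR : MeasurableSet R :=
    (hv.preimage (f := fun a : NN × IncSeq × IncSeq => (a.1, a.2.1)) (by fun_prop)).inter
      ((hv.preimage (f := fun a : NN × IncSeq × IncSeq => (a.1, a.2.2)) (by fun_prop)).inter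
        (measurableSet_shiftEdge.preimage measurable_snd))
  choose N hN hNR using fun n => exists_analyticSet_hom (hE n) (hG n) hR
  have hN' : AnalyticSet {a : NN × NN | (a.1, tailSeq a.2) ∈ N (a.2 0)} := by
    choose D hD hDN using fun n => (hN n).exists_isClosed
    have ht : Continuous tailSeq := continuous_pi fun i => continuous_apply _
    have hM : MeasurableSet {a : (NN × NN) × NN | ((a.1.1, tailSeq a.1.2), a.2) ∈ D (a.1.2 0)} := by
      rw [show {a : (NN × NN) × NN | ((a.1.1, tailSeq a.1.2), a.2) ∈ D (a.1.2 0)} =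
        ⋃ n, {a : (NN × NN) × NN | a.1.2 0 = n} ∩ {a | ((a.1.1, tailSeq a.1.2), a.2) ∈ D n} by
          ext a; simp]
      exact MeasurableSet.iUnion fun n => MeasurableSet.inter
        (measurableSet_eq_fun (by fun_prop) measurable_const)
        ((hD n).preimage (by fun_prop)).measurableSet
    convert hM.analyticSet.image_of_continuous continuous_fst
    ext a
    simp [hDN]
  obtain ⟨g, hg⟩ := exists_sectionTree hN'
  refine ⟨vertices g, isClosed_vertices g, fun h => ?_⟩
  have h' : (¬ ∃ m, BorelColoringLE (vertices g) m) ↔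
      ∃ y, ¬ IllFounded (sectionTree g y) := by
    rw [h]
    simp only [hg]
    constructor
    · rintro ⟨n, hn⟩
      obtain ⟨y, hy⟩ := (hNR n g).1 hn
      exact ⟨fun i => i.casesOn n y, by simpa [tailSeq] using! hy⟩
    · rintro ⟨y, hy⟩
      exact ⟨y 0, (hNR (y 0) g).2 ⟨tailSeq y, hy⟩⟩
  by_cases hy : ∃ y, ¬ IllFounded (sectionTree g y)
  · obtain ⟨y, hy'⟩ := hy
    exact h'.2 ⟨y, hy'⟩ ⟨3, borelColoringLE_vertices hy'⟩
  · refine hy (h'.1 ?_)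
    push Not at hy
    rintro ⟨m, hm⟩
    exact not_borelColoringLE_vertices hy m hm

instance : PolishSpace IncSeq :=
  (isClosed_strictMono (q := fun x : NN => x) continuous_id).polishSpace

section Sigma

variable {V : ℕ → Type*} [∀ n, MeasurableSpace (V n)]

lemma measurableSet_sigma {s : Set (Σ n, V n)} :
    MeasurableSet s ↔ ∀ n, MeasurableSet (Sigma.mk n ⁻¹' s) :=
  MeasurableSpace.measurableSet_iInf

lemma measurable_sigma {Z : Type*} [MeasurableSpace Z] {f : (Σ n, V n) → Z} :
    Measurable f ↔ ∀ n, Measurable fun a => f ⟨n, a⟩ :=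
  ⟨fun h n _ ht => measurableSet_sigma.1 (h ht) n,
    fun h _ ht => measurableSet_sigma.2 fun n => h n ht⟩

instance [∀ n, TopologicalSpace (V n)] [∀ n, BorelSpace (V n)] : BorelSpace (Σ n, V n) := by
  refine ⟨le_antisymm (fun s hs => ?_) (MeasurableSpace.generateFrom_le fun s hs => ?_)⟩
  · have h : ∀ n, ∃ s', MeasurableSet[borel (Σ n, V n)] s' ∧
        Sigma.mk n ⁻¹' s' = Sigma.mk n ⁻¹' s := by
      intro n
      have h := measurableSet_sigma.1 hs n
      rwa [BorelSpace.measurable_eq (α := V n),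
        (Topology.IsOpenEmbedding.sigmaMk (σ := V) (i := n)).isInducing.eq_induced,
        borel_comap] at h
    choose s' hs' h using h
    have : s = ⋃ n, range (Sigma.mk n) ∩ s' n := by
      ext ⟨n, a⟩
      have h' : ⟨n, a⟩ ∈ s' n ↔ ⟨n, a⟩ ∈ s := Set.ext_iff.1 (h n) a
      simp only [mem_iUnion, mem_inter_iff, mem_range, Sigma.mk.injEq]
      constructor
      · exact fun ha => ⟨n, ⟨a, rfl, HEq.rfl⟩, h'.2 ha⟩
      · rintro ⟨_, ⟨_, rfl, -⟩, ha⟩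
        exact h'.1 ha
    rw [this]
    exact .iUnion fun n => .inter (.basic _ isOpen_range_sigmaMk) (hs' n)
  · exact measurableSet_sigma.2 fun n => (isOpen_sigma_iff.1 hs n).measurableSet

end Sigma

/-- If `H` maps into the shift graph on `C`, then colorings of the latter induce colorings
of `H`. -/
lemma GBorelColoringLE.of_hom {Z : Type} [MeasurableSpace Z] {H : Set (Z × Z)} {C : Set IncSeq}
    (hC : MeasurableSet C) {f : Z → IncSeq} (hf : Measurable f)
    (hfH : ∀ a b, (a, b) ∈ H → f a ∈ C ∧ f b ∈ C ∧ shiftEdge (f a) (f b)) {m : ℕ}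
    (h : BorelColoringLE C m) : GBorelColoringLE H (m + 1) := by
  obtain ⟨c, hc, hc'⟩ := h
  obtain ⟨d, hd, hdc⟩ := (MeasurableEmbedding.subtype_coe hC).exists_measurable_extend
    ((measurable_of_countable Fin.castSucc).comp hc) fun _ => ⟨0⟩
  refine ⟨fun a => d (f a), hd.comp hf, fun a b hab => ?_⟩
  obtain ⟨ha, hb, he⟩ := hfH a b hab
  beta_reduce
  rw [show d (f a) = (c ⟨f a, ha⟩).castSucc from congrFun hdc ⟨f a, ha⟩,
    show d (f b) = (c ⟨f b, hb⟩).castSucc from congrFun hdc ⟨f b, hb⟩]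
  exact fun h => hc' ⟨_, ha⟩ ⟨_, hb⟩ he (Fin.castSucc_injective _ h)

/-- No sequence of Borel graphs with unbounded Borel chromatic numbers maps into every Borel graph
with infinite Borel chromatic number. -/
lemma not_forall_exists_hom {V : ℕ → Type} [∀ n, TopologicalSpace (V n)] [∀ n, PolishSpace (V n)]
    [∀ n, MeasurableSpace (V n)] [∀ n, BorelSpace (V n)] {H : ∀ n, Set (V n × V n)}
    (hH : ∀ n, AnalyticSet (H n)) (hH' : ∀ k, ∃ n, ¬ GBorelColoringLE (H n) k) :
    ¬ ∀ (Z : Type) [TopologicalSpace Z] [PolishSpace Z] [MeasurableSpace Z] [BorelSpace Z]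
      (EZ : Set (Z × Z)), MeasurableSet EZ → (¬ ∃ m, GBorelColoringLE EZ m) →
        ∀ n, ∃ f : V n → Z, Measurable f ∧ ∀ x y, (x, y) ∈ H n → (f x, f y) ∈ EZ := by
  intro h
  have hE : AnalyticSet (⋃ n, (fun a : V n × V n =>
      ((0, ⟨n, a.1⟩, ⟨n, a.2⟩) : NN × (Σ n, V n) × (Σ n, V n))) '' H n) :=
    AnalyticSet.iUnion fun n => (hH n).image_of_continuous (by fun_prop)
  obtain ⟨C, hC, hn⟩ := exists_closed_not_iff (X := fun _ => NN) (fun _ => hE)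
    (fun _ => (measurableSet_singleton 0).analyticSet)
  refine hn ⟨fun hm => ?_, ?_⟩
  · have := hC.polishSpace
    choose f hf hfH using h C {a | shiftEdge a.1 a.2}
      (measurableSet_shiftEdge.preimage (f := fun a : C × C => (a.1.1, a.2.1)) (by fun_prop)) hm
    refine ⟨0, 0, rfl, fun a => f a.1 a.2, measurable_sigma.2 fun n =>
      measurable_subtype_coe.comp (hf n), ?_⟩
    rintro _ _ hab
    simp only [mem_iUnion, mem_image, Prod.mk.injEq, true_and] at hab
    obtain ⟨n, ⟨a, b⟩, hab, rfl, rfl⟩ := hab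
    exact ⟨(f n a).2, (f n b).2, hfH n a b hab⟩
  · rintro ⟨-, _, rfl, f, hf, hfE⟩ ⟨m, hm⟩
    obtain ⟨n, hn⟩ := hH' (m + 1)
    exact hn (.of_hom hC.measurableSet (measurable_sigma.1 hf n) (fun a b hab =>
      hfE _ _ (mem_iUnion.2 ⟨n, (a, b), hab, rfl⟩)) hm)

/-- There is no sequence `(𝒜_n)` of `Σ¹₁`-parametrizable collections of Borel graphs
(each given by a parametrization: Polish spaces `X n`, `Y n`, a `Σ¹₁` set
`E n ⊆ X n × (Y n)²` and a `Σ¹₁` set `Good n ⊆ X n` of parameters of members) such that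
for every closed `C ⊆ [ℕ]^ℕ`, `G_S|_C` has infinite Borel chromatic number iff some
members `A_{n_i} ∈ 𝒜_{n_i}` admit Borel homomorphisms into `G_S|_C`.  In particular,
there is no sequence `(𝒢_n)` of Borel graphs with finite but unbounded Borel chromatic
numbers such that every Borel graph with infinite Borel chromatic number is Borel above
every `𝒢_n`. -/
theorem no_countable_basis_for_infinite_BorelChromatic :
    (¬ ∃ (X Y : ℕ → Type) (tX : ∀ n, TopologicalSpace (X n))
        (tY : ∀ n, TopologicalSpace (Y n))
        (E : ∀ n, Set (X n × Y n × Y n)) (Good : ∀ n, Set (X n)),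
        (∀ n, @PolishSpace (X n) (tX n)) ∧ (∀ n, @PolishSpace (Y n) (tY n)) ∧
        (∀ n, @MeasureTheory.AnalyticSet (X n × Y n × Y n)
          (@instTopologicalSpaceProd _ _ (tX n) (@instTopologicalSpaceProd _ _ (tY n) (tY n)))
          (E n)) ∧
        (∀ n, @MeasureTheory.AnalyticSet (X n) (tX n) (Good n)) ∧
        (∀ C : Set IncSeq, IsClosed C →
          ((¬ ∃ m : ℕ, BorelColoringLE C m) ↔
            ∃ ns : ℕ → ℕ, ∀ i : ℕ, ∃ x ∈ Good (ns i),
              ∃ f : Y (ns i) → IncSeq, @Measurable _ _ (@borel _ (tY (ns i))) _ f ∧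
                ∀ y z : Y (ns i), (x, y, z) ∈ E (ns i) →
                  f y ∈ C ∧ f z ∈ C ∧ shiftEdge (f y) (f z)))) ∧
    (¬ ∃ (V : ℕ → Type) (tV : ∀ n, TopologicalSpace (V n)) (EV : ∀ n, Set (V n × V n)),
        (∀ n, @PolishSpace (V n) (tV n)) ∧
        (∀ n, @MeasurableSet (V n × V n)
          (@borel _ (@instTopologicalSpaceProd _ _ (tV n) (tV n))) (EV n)) ∧
        (∀ n, ∃ m : ℕ, @GBorelColoringLE (V n) (@borel _ (tV n)) (EV n) m) ∧
        (∀ k : ℕ, ∃ n : ℕ, ¬ @GBorelColoringLE (V n) (@borel _ (tV n)) (EV n) k) ∧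
        (∀ (Z : Type) [TopologicalSpace Z] [PolishSpace Z] [MeasurableSpace Z] [BorelSpace Z]
          (EZ : Set (Z × Z)), MeasurableSet EZ →
          (¬ ∃ m : ℕ, GBorelColoringLE EZ m) →
          ∀ n : ℕ, ∃ f : V n → Z, @Measurable _ _ (@borel _ (tV n)) _ f ∧
            ∀ x y : V n, (x, y) ∈ EV n → (f x, f y) ∈ EZ)) := by

  constructor
  · rintro ⟨X, Y, tX, tY, E, Good, hX, hY, hE, hG, h⟩
    let _ : ∀ n, MeasurableSpace (Y n) := fun n => borel _
    have _ : ∀ n, BorelSpace (Y n) := fun n => ⟨rfl⟩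
    obtain ⟨C, hC, hn⟩ := exists_closed_not_iff hE hG
    exact hn ((h C hC).trans ⟨fun ⟨ns, h⟩ => ⟨ns 0, h 0⟩, fun ⟨n, h⟩ => ⟨fun _ => n, fun _ => h⟩⟩)
  · rintro ⟨V, tV, EV, hV, hEV, -, hk, h⟩
    let _ : ∀ n, MeasurableSpace (V n) := fun n => borel _
    have _ : ∀ n, BorelSpace (V n) := fun n => ⟨rfl⟩
    refine not_forall_exists_hom (fun n => MeasurableSet.analyticSet ?_) hk h
    rw [BorelSpace.measurable_eq (α := V n × V n)]
    exact hEV n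
end

section
/- Let X, Y be Polish spaces and let Γ be a class of subsets of Polish spaces closed under continuous preimages, finite unions and finite intersections, and containing all closed and all open sets. Suppose Φ: Γ(X) → Π¹₁(Y) is Π¹₁ on Γ, and the family F^Φ = {A ∈ Γ(X) : Φ(A) ≠ ∅} is nicely Σ¹₁-hard on Γ. Then the uniform family U^Φ = {B ∈ Γ(ℕ^ℕ × X) : the set Φ(B) = {(s,y) : y ∈ Φ(B_s)} contains the graph of a Borel function ℕ^ℕ → Y} is Σ¹₂-hard on Γ; that is, there exists B ∈ Γ(ℕ^ℕ × (ℕ^ℕ × X)) such that {s ∈ ℕ^ℕ : B_s ∈ U^Φ} is Σ¹₂-hard. -/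
open MeasureTheory Set

/-- Coanalytic (`Π¹₁`) subsets of a topological space. -/
def IsCoanalytic {X : Type} [TopologicalSpace X] (S : Set X) : Prop := AnalyticSet Sᶜ

/-- `Σ¹₂` subsets of a topological space: projections of coanalytic subsets of `X × ℕ^ℕ`. -/
def IsSigma12 {X : Type} [TopologicalSpace X] (A : Set X) : Prop :=
  ∃ C : Set (X × NN), IsCoanalytic C ∧ A = Prod.fst '' C

/-- `A` is `Σ¹₂`-hard: every `Σ¹₂` subset of a Polish space Borel-reduces to `A`. -/
def Sigma12Hard {X : Type} [MeasurableSpace X] (A : Set X) : Prop :=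
  ∀ (Z : Type) [TopologicalSpace Z] [PolishSpace Z] [MeasurableSpace Z] [BorelSpace Z],
    ∀ A' : Set Z, IsSigma12 A' → ∃ f : Z → X, Measurable f ∧ ∀ z, z ∈ A' ↔ f z ∈ A

namespace UniformHard

/-- The sequence with even entries `a` and odd entries `b`. -/
def interleave (a b : NN) : NN := fun n => if n % 2 = 0 then a (n / 2) else b (n / 2)

/-- The even entries of a sequence. -/
def evens (v : NN) : NN := fun k => v (2 * k)

/-- The odd entries of a sequence. -/
def odds (v : NN) : NN := fun k => v (2 * k + 1)

@[simp] theorem evens_interleave (a b : NN) : evens (interleave a b) = a := by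
  funext k; simp [evens, interleave]

@[simp] theorem odds_interleave (a b : NN) : odds (interleave a b) = b := by
  funext k
  have h1 : (2 * k + 1) % 2 = 1 := by omega
  have h2 : (2 * k + 1) / 2 = k := by omega
  simp [odds, interleave, h1, h2]

@[fun_prop] theorem continuous_evens : Continuous evens := by unfold evens; fun_prop

@[fun_prop] theorem continuous_odds : Continuous odds := by unfold odds; fun_prop

@[fun_prop] theorem continuous_interleave : Continuous fun x : NN × NN => interleave x.1 x.2 := by
  refine continuous_pi fun n => ?_
  by_cases h : n % 2 = 0 <;> simp only [interleave, h, if_true, if_false] <;> fun_prop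

@[fun_prop] theorem measurable_evens : Measurable evens := continuous_evens.measurable

@[fun_prop] theorem measurable_odds : Measurable odds := continuous_odds.measurable

theorem _root_.Continuous.interleave {α : Type*} [TopologicalSpace α] {f g : α → NN}
    (hf : Continuous f) (hg : Continuous g) : Continuous fun x => interleave (f x) (g x) :=
  continuous_interleave.comp (hf.prodMk hg)

theorem _root_.Measurable.interleave {α : Type*} [MeasurableSpace α] {f g : α → NN}
    (hf : Measurable f) (hg : Measurable g) : Measurable fun x => interleave (f x) (g x) :=
  continuous_interleave.measurable.comp (hf.prodMk hg)

/-- Projections along the Baire space of measurable predicates. -/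
def Ana {α : Type*} [MeasurableSpace α] (P : α → Prop) : Prop :=
  ∃ M : α × NN → Prop, Measurable M ∧ ∀ x, P x ↔ ∃ z, M (x, z)

section Ana

variable {α β : Type*} [MeasurableSpace α] [MeasurableSpace β]

theorem Ana.of_measurable {P : α → Prop} (h : Measurable P) : Ana P :=
  ⟨fun x => P x.1, h.comp measurable_fst, fun x => by simp⟩

theorem Ana.comp {P : α → Prop} (h : Ana P) {f : β → α} (hf : Measurable f) :
    Ana fun x => P (f x) := by
  obtain ⟨M, hM, e⟩ := h
  exact ⟨fun x => M (f x.1, x.2), hM.comp (by fun_prop), fun x => e _⟩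

theorem Ana.congr {P Q : α → Prop} (h : Ana P) (e : ∀ x, Q x ↔ P x) : Ana Q := by
  rwa [show Q = P from funext fun x => propext (e x)]

theorem Ana.and {P Q : α → Prop} (hP : Ana P) (hQ : Ana Q) : Ana fun x => P x ∧ Q x := by
  obtain ⟨M, hM, e⟩ := hP
  obtain ⟨M', hM', e'⟩ := hQ
  refine ⟨fun x => M (x.1, evens x.2) ∧ M' (x.1, odds x.2),
    (hM.comp (by fun_prop)).and (hM'.comp (by fun_prop)), fun x => ?_⟩
  simp only [e, e']
  constructor
  · rintro ⟨⟨a, ha⟩, ⟨b, hb⟩⟩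
    exact ⟨interleave a b, by simpa using ⟨ha, hb⟩⟩
  · rintro ⟨z, h1, h2⟩
    exact ⟨⟨_, h1⟩, ⟨_, h2⟩⟩

theorem Ana.exists_nat {P : ℕ → α → Prop} (h : ∀ i, Ana (P i)) : Ana fun x => ∃ i, P i x := by
  choose M hM e using h
  refine ⟨fun x => ∃ i, x.2 0 = i ∧ M i (x.1, fun n => x.2 (n + 1)), ?_, fun x => ?_⟩
  · refine Measurable.exists fun i => Measurable.and ?_ ((hM i).comp (by fun_prop))
    exact Measurable.eq_const (by fun_prop) i
  · constructor
    · rintro ⟨i, hi⟩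
      obtain ⟨z, hz⟩ := (e i x).1 hi
      exact ⟨fun n => Nat.casesOn n i z, i, rfl, hz⟩
    · rintro ⟨z, i, -, hz⟩
      exact ⟨i, (e i x).2 ⟨_, hz⟩⟩

theorem Ana.exists {ι : Type*} [Countable ι] {P : ι → α → Prop} (h : ∀ i, Ana (P i)) :
    Ana fun x => ∃ i, P i x := by
  cases isEmpty_or_nonempty ι
  · exact (Ana.of_measurable (measurable_const (a := False))).congr fun x => by simp
  · obtain ⟨f, hf⟩ := exists_surjective_nat ι
    exact (Ana.exists_nat fun n => h (f n)).congr fun x => by simpa using hf.exists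

theorem Ana.or {P Q : α → Prop} (hP : Ana P) (hQ : Ana Q) : Ana fun x => P x ∨ Q x :=
  (Ana.exists (ι := Bool) (P := fun b x => bif b then P x else Q x)
    (fun b => by cases b <;> assumption)).congr fun x => by simp [or_comm]

theorem Ana.forall_nat {P : ℕ → α → Prop} (h : ∀ i, Ana (P i)) : Ana fun x => ∀ i, P i x := by
  choose M hM e using h
  refine ⟨fun x => ∀ i, M i (x.1, fun n => x.2 (Nat.pair i n)), ?_, fun x => ?_⟩
  · exact Measurable.forall fun i => (hM i).comp (by fun_prop)
  · constructor
    · intro hx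
      choose z hz using fun i => (e i x).1 (hx i)
      exact ⟨fun n => z n.unpair.1 n.unpair.2, fun i => by simpa using hz i⟩
    · rintro ⟨z, hz⟩ i
      exact (e i x).2 ⟨_, hz i⟩

theorem Ana.forall {ι : Type*} [Countable ι] {P : ι → α → Prop} (h : ∀ i, Ana (P i)) :
    Ana fun x => ∀ i, P i x := by
  cases isEmpty_or_nonempty ι
  · exact (Ana.of_measurable (measurable_const (a := True))).congr fun x => by simp
  · obtain ⟨f, hf⟩ := exists_surjective_nat ι
    exact (Ana.forall_nat fun n => h (f n)).congr fun x => by simpa using hf.forall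

theorem Ana.imp {P Q : α → Prop} (hP : Measurable P) (hQ : Ana Q) : Ana fun x => P x → Q x :=
  ((Ana.of_measurable hP.not).or hQ).congr fun _ => imp_iff_not_or

/-- Analytic predicates are closed under projections along Polish spaces. -/
theorem Ana.proj [TopologicalSpace β] [PolishSpace β] [BorelSpace β] {P : α × β → Prop}
    (h : Ana P) : Ana fun x => ∃ y, P (x, y) := by
  cases isEmpty_or_nonempty β
  · exact (Ana.of_measurable (measurable_const (a := False))).congr fun x => by simp
  · obtain ⟨g, gc, gs⟩ := PolishSpace.exists_nat_nat_continuous_surjective β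
    obtain ⟨M, hM, e⟩ := h
    refine ⟨fun x => M ((x.1, g (evens x.2)), odds x.2),
      hM.comp (by have := gc.measurable; fun_prop), fun x => ?_⟩
    constructor
    · rintro ⟨y, hy⟩
      obtain ⟨z, hz⟩ := (e _).1 hy
      obtain ⟨w, rfl⟩ := gs y
      exact ⟨interleave w z, by simpa using hz⟩
    · rintro ⟨z, hz⟩
      exact ⟨g (evens z), (e _).2 ⟨_, hz⟩⟩

theorem Ana.analyticSet [TopologicalSpace α] [PolishSpace α] [BorelSpace α] {P : α → Prop}
    (h : Ana P) : AnalyticSet {x | P x} := by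
  obtain ⟨M, hM, e⟩ := h
  have : {x | P x} = Prod.fst '' {x | M x} := by
    ext x; simp [e]
  rw [this]
  exact (measurableSet_setOfPred.2 hM).analyticSet.image_of_continuous continuous_fst

theorem _root_.MeasureTheory.AnalyticSet.ana [TopologicalSpace α] [PolishSpace α] [BorelSpace α]
    {S : Set α} (h : AnalyticSet S) : Ana fun x => x ∈ S := by
  rw [AnalyticSet] at h
  obtain rfl | ⟨f, hf, rfl⟩ := h
  · exact (Ana.of_measurable (measurable_const (a := False))).congr fun x => by simp
  · refine ⟨fun x => f x.2 = x.1, ?_, fun x => by simp⟩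
    have := hf.measurable
    exact Measurable.eq (by fun_prop) (by fun_prop)

end Ana

open PiNat Filter Topology

theorem suffix_res {α : Type*} {b : ℕ → α} {n : ℕ} {l : List α} :
    l <:+ res b n ↔ ∃ m ≤ n, l = res b m := by
  induction n with
  | zero => simp
  | succ n ih =>
    rw [res_succ, List.suffix_cons_iff, ih]
    constructor
    · rintro (rfl | ⟨m, hm, rfl⟩)
      · exact ⟨n + 1, le_rfl, rfl⟩
      · exact ⟨m, by omega, rfl⟩
    · rintro ⟨m, hm, rfl⟩
      rcases Nat.lt_or_ge n m with h | h
      · obtain rfl : m = n + 1 := by omega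
        exact Or.inl rfl
      · exact Or.inr ⟨m, h, rfl⟩

theorem measurable_res_eq {α : Type*} [MeasurableSpace α] {f : α → NN} (hf : Measurable f) (n : ℕ)
    (w : List ℕ) : Measurable fun x => res (f x) n = w := by
  induction n generalizing w with
  | zero => simp only [res_zero]; exact measurable_const
  | succ n ih =>
    cases w with
    | nil => simp only [res_succ, reduceCtorEq]; exact measurable_const
    | cons k w =>
      simp only [res_succ, List.cons.injEq]
      exact (Measurable.eq_const (by fun_prop) k).and (ih w)

/-- A sequence `c` codes, for every `z`, a tree of finite sequences, listed backwards. -/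
def OnTree (c z : NN) (l : List ℕ) : Prop :=
  ∀ l', l' <:+ l → c (Encodable.encode (res z l'.length, l')) = 0

/-- `b` is an infinite branch of the tree coded by `c` at `z`. -/
def Branch (c z b : NN) : Prop := ∀ n, OnTree c z (res b n)

theorem OnTree.suffix {c z : NN} {l l' : List ℕ} (h : OnTree c z l) (h' : l' <:+ l) :
    OnTree c z l' := fun _ h'' => h _ (h''.trans h')

theorem branch_iff {c z b : NN} :
    Branch c z b ↔ ∀ n, c (Encodable.encode (res z n, res b n)) = 0 := by
  constructor
  · intro h n
    simpa using h n (res b n) List.suffix_rfl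
  · rintro h n l' hl'
    obtain ⟨m, -, rfl⟩ := suffix_res.1 hl'
    simpa using h m

theorem onTree_congr {c z z' : NN} {l : List ℕ} (h : res z l.length = res z' l.length) :
    OnTree c z l ↔ OnTree c z' l := by
  refine forall₂_congr fun l' hl' => ?_
  have : res z l'.length = res z' l'.length := by
    rw [res_eq_res] at h ⊢
    exact fun m hm => h (hm.trans_le hl'.length_le)
  rw [this]

theorem measurable_onTree {α : Type*} [MeasurableSpace α] {f g : α → NN} (hf : Measurable f)
    (hg : Measurable g) (l : List ℕ) : Measurable fun x => OnTree (f x) (g x) l := by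
  have : (fun x => OnTree (f x) (g x) l) = fun x => ∀ l' w, l' <:+ l → res (g x) l'.length = w →
      f x (Encodable.encode (w, l')) = 0 := by
    funext x
    simp [OnTree]
  rw [this]
  refine Measurable.forall fun l' => Measurable.forall fun w => measurable_const.imp
    ((measurable_res_eq hg _ _).imp (Measurable.eq_const (by fun_prop) 0))

theorem measurable_branch {α : Type*} [MeasurableSpace α] {f g h : α → NN} (hf : Measurable f)
    (hg : Measurable g) (hh : Measurable h) : Measurable fun x => Branch (f x) (g x) (h x) := by
  have : (fun x => Branch (f x) (g x) (h x)) = fun x => ∀ n w, res (h x) n = w →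
      OnTree (f x) (g x) w := by
    funext x
    simp [Branch]
  rw [this]
  exact Measurable.forall fun n => Measurable.forall fun w => (measurable_res_eq hh _ _).imp
    (measurable_onTree hf hg w)

theorem exists_code_of_continuous {g : NN → NN} (hg : Continuous g) :
    ∃ c, ∀ z b, Branch c z b ↔ g b = z := by
  classical
  refine ⟨fun k => if ∃ a n, k = Encodable.encode (res (g a) n, res a n) then 0 else 1,
    fun z b => ?_⟩
  rw [branch_iff]
  have key : ∀ n, (if ∃ a m, Encodable.encode (res z n, res b n) =
      Encodable.encode (res (g a) m, res a m) then 0 else 1) = 0 ↔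
      ∃ a, res z n = res (g a) n ∧ res b n = res a n := by
    intro n
    simp only [ite_eq_left_iff, one_ne_zero, imp_false, not_not, Encodable.encode_inj,
      Prod.mk.injEq]
    refine exists_congr fun a => ⟨?_, fun h => ⟨n, h⟩⟩
    rintro ⟨m, h1, h2⟩
    obtain rfl : n = m := by simpa using congrArg List.length h1
    exact ⟨h1, h2⟩
  simp only [key]
  constructor
  · intro h
    choose a ha hb using h
    have hlim : Tendsto a atTop (𝓝 b) := by
      refine tendsto_pi_nhds.2 fun i => tendsto_const_nhds.congr' ?_
      filter_upwards [eventually_gt_atTop i] with n hn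
      exact res_eq_res.1 (hb n) hn
    have h1 : Tendsto (fun n => g (a n)) atTop (𝓝 (g b)) := (hg.tendsto b).comp hlim
    have h2 : Tendsto (fun n => g (a n)) atTop (𝓝 z) := by
      refine tendsto_pi_nhds.2 fun i => tendsto_const_nhds.congr' ?_
      filter_upwards [eventually_gt_atTop i] with n hn
      exact res_eq_res.1 (ha n) hn
    exact tendsto_nhds_unique h1 h2
  · rintro rfl n
    exact ⟨b, rfl, rfl⟩

theorem Ana.exists_code {P : NN → Prop} (h : Ana P) : ∃ c, ∀ z, P z ↔ ∃ b, Branch c z b := by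
  have h := h.analyticSet
  rw [AnalyticSet] at h
  obtain h | ⟨g, hg, e⟩ := h
  · refine ⟨fun _ => 1, fun z => iff_of_false (fun hz => ?_) ?_⟩
    · exact (h ▸ (show z ∈ {x | P x} from hz) : z ∈ (∅ : Set NN))
    · rintro ⟨b, hb⟩
      simpa using branch_iff.1 hb 0
  · obtain ⟨c, hc⟩ := exists_code_of_continuous hg
    refine ⟨c, fun z => ?_⟩
    have : P z ↔ z ∈ range g := by rw [e]; rfl
    simp [this, hc]

theorem ana_exists_branch {α : Type*} [MeasurableSpace α] {f g : α → NN} (hf : Measurable f)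
    (hg : Measurable g) : Ana fun x => ∃ b, Branch (f x) (g x) b :=
  Ana.proj (β := NN) (P := fun x => Branch (f x.1) (g x.1) x.2)
    (Ana.of_measurable (measurable_branch (by fun_prop) (by fun_prop) (by fun_prop)))

theorem Ana.exists_isClosed {P : NN → Prop} (h : Ana P) :
    ∃ K : Set (NN × NN), IsClosed K ∧ ∀ z, P z ↔ ∃ b, (z, b) ∈ K := by
  have h := h.analyticSet
  rw [AnalyticSet] at h
  obtain h | ⟨g, hg, e⟩ := h
  · refine ⟨∅, isClosed_empty, fun z => iff_of_false (fun hz => ?_) (by simp)⟩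
    exact (h ▸ (show z ∈ {x | P x} from hz) : z ∈ (∅ : Set NN))
  · refine ⟨{x | g x.2 = x.1}, isClosed_eq (by fun_prop) (by fun_prop), fun z => ?_⟩
    have : P z ↔ z ∈ range g := by rw [e]; rfl
    simp [this]

section Sim

variable {ι κ μ : Type*}

/-- `Sim r a r' b`: the relation `r` below `a` is simulated by `r'` below `b`.  For well-founded
relations this says that the rank of `a` is at most the rank of `b`. -/
def Sim (r : ι → ι → Prop) (a : ι) (r' : κ → κ → Prop) (b : κ) : Prop :=
  ∃ σ : ι → κ → Prop, σ a b ∧ ∀ x y, σ x y → ∀ x', r x' x → ∃ y', r' y' y ∧ σ x' y'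

variable {r : ι → ι → Prop} {r' : κ → κ → Prop} {r'' : μ → μ → Prop} {a : ι} {b : κ} {c : μ}

theorem sim_iff : Sim r a r' b ↔ ∀ a', r a' a → ∃ b', r' b' b ∧ Sim r a' r' b' := by
  constructor
  · rintro ⟨σ, h, hσ⟩ a' ha'
    obtain ⟨b', hb', h'⟩ := hσ _ _ h _ ha'
    exact ⟨b', hb', σ, h', hσ⟩
  · intro h
    refine ⟨fun x y => Sim r x r' y ∨ x = a ∧ y = b, Or.inr ⟨rfl, rfl⟩, ?_⟩
    rintro x y (⟨σ, h1, hσ⟩ | ⟨rfl, rfl⟩) x' hx'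
    · obtain ⟨y', hy', h'⟩ := hσ _ _ h1 _ hx'
      exact ⟨y', hy', Or.inl ⟨σ, h', hσ⟩⟩
    · obtain ⟨y', hy', h'⟩ := h _ hx'
      exact ⟨y', hy', Or.inl h'⟩

theorem Sim.trans (h : Sim r a r' b) (h' : Sim r' b r'' c) : Sim r a r'' c := by
  obtain ⟨σ, h, hσ⟩ := h
  obtain ⟨τ, h', hτ⟩ := h'
  refine ⟨fun x z => ∃ y, σ x y ∧ τ y z, ⟨b, h, h'⟩, ?_⟩
  rintro x z ⟨y, hxy, hyz⟩ x' hx'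
  obtain ⟨y', hy', h1⟩ := hσ _ _ hxy _ hx'
  obtain ⟨z', hz', h2⟩ := hτ _ _ hyz _ hy'
  exact ⟨z', hz', y', h1, h2⟩

theorem Sim.acc (h : Sim r a r' b) (hb : Acc r' b) : Acc r a := by
  induction hb generalizing a with
  | intro b _ ih =>
    refine Acc.intro a fun a' ha' => ?_
    obtain ⟨b', hb', h'⟩ := sim_iff.1 h a' ha'
    exact ih b' hb' h'

theorem sim_or_exists (ha : Acc r a) (r' : κ → κ → Prop) (b : κ) :
    Sim r a r' b ∨ ∃ a', r a' a ∧ Sim r' b r a' := by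
  induction ha generalizing b with
  | intro a _ ih =>
    by_contra! h
    have h1 := h.1
    rw [sim_iff] at h1
    push Not at h1
    obtain ⟨a', ha', h2⟩ := h1
    refine h.2 a' ha' (sim_iff.2 fun b' hb' => ?_)
    exact (ih a' ha' b').resolve_left (h2 b' hb')

theorem Sim.exists_reachable (h : Sim r' b r a) (ha : Acc r a) :
    ∃ w, Relation.ReflTransGen r w a ∧ Sim r' b r w ∧ Sim r w r' b := by
  induction ha with
  | intro a ha ih =>
    rcases sim_or_exists (Acc.intro a ha) r' b with h' | ⟨a', ha', h'⟩
    · exact ⟨a, .refl, h, h'⟩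
    · obtain ⟨w, hw, h1, h2⟩ := ih a' ha' h'
      exact ⟨w, hw.tail ha', h1, h2⟩

theorem Sim.exists_below (hr : ∀ x y z, r x y → r y z → r x z) {a' : ι} (ha' : r a' a)
    (h : Sim r' b r a') (hacc : Acc r a') : ∃ w, r w a ∧ Sim r' b r w ∧ Sim r w r' b := by
  obtain ⟨w, hw, h1, h2⟩ := h.exists_reachable hacc
  refine ⟨w, ?_, h1, h2⟩
  clear h1 h2 h
  induction hw using Relation.ReflTransGen.head_induction_on with
  | refl => exact ha'
  | head h _ ih => exact hr _ _ _ h ih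

end Sim

theorem exists_seq_of_not_acc {α : Type*} {r : List α → List α → Prop}
    (h : ∀ l, ¬Acc r l → ∃ e, r (e :: l) l ∧ ¬Acc r (e :: l)) (h0 : ¬Acc r []) :
    ∃ y : ℕ → α, ∀ n, r (res y (n + 1)) (res y n) ∧ ¬Acc r (res y n) := by
  choose e he he' using h
  let s : ℕ → {l : List α // ¬Acc r l} := fun n =>
    n.rec ⟨[], h0⟩ fun _ l => ⟨e l.1 l.2 :: l.1, he' l.1 l.2⟩
  let y : ℕ → α := fun n => e (s n).1 (s n).2
  have hy : ∀ n, res y n = (s n).1 := by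
    intro n
    induction n with
    | zero => rfl
    | succ n ih => rw [res_succ, ih]
  refine ⟨y, fun n => ⟨?_, hy n ▸ (s n).2⟩⟩
  rw [hy, hy]
  exact he _ _

instance polishSpace_bool : PolishSpace Bool :=
  (Topology.IsClosedEmbedding.of_continuous_injective_isClosedMap (continuous_of_discreteTopology)
    Encodable.encode_injective fun _ _ => isClosed_discrete _).polishSpace

section Measurability

variable {α : Type*} [MeasurableSpace α] {ι κ : Type} [Countable ι] [Countable κ]
  {r : α → ι → ι → Prop} {r' : α → κ → κ → Prop}

theorem ana_sim (hr : ∀ x y, Measurable fun v => r v x y) (hr' : ∀ x y, Measurable fun v => r' v x y)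
    (a : ι) (b : κ) : Ana fun v => Sim (r v) a (r' v) b := by
  classical
  have h : Ana fun v => ∃ σ : ι × κ → Bool, σ (a, b) = true ∧ ∀ x y, σ (x, y) = true → ∀ x',
      r v x' x → ∃ y', r' v y' y ∧ σ (x', y') = true := by
    refine Ana.proj (β := ι × κ → Bool) (P := fun vσ => vσ.2 (a, b) = true ∧ ∀ x y,
      vσ.2 (x, y) = true → ∀ x', r vσ.1 x' x → ∃ y', r' vσ.1 y' y ∧ vσ.2 (x', y') = true)
      (Ana.of_measurable ?_)
    have hσ : ∀ p, Measurable fun vσ : α × (ι × κ → Bool) => vσ.2 p = true := fun p =>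
      Measurable.eq_const (by fun_prop) _
    refine (hσ _).and (Measurable.forall fun x => Measurable.forall fun y => (hσ _).imp
      (Measurable.forall fun x' => Measurable.imp ((hr _ _).comp measurable_fst)
        (Measurable.exists fun y' => ((hr' _ _).comp measurable_fst).and (hσ _))))
  refine h.congr fun v => ⟨?_, ?_⟩
  · rintro ⟨σ, h⟩
    exact ⟨fun p => decide (σ p.1 p.2), by simpa using h⟩
  · rintro ⟨σ, h⟩
    exact ⟨fun x y => σ (x, y) = true, h⟩

theorem not_acc_iff_exists {ι : Type*} {r : ι → ι → Prop} {a : ι} :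
    ¬Acc r a ↔ ∃ P : ι → Prop, P a ∧ ∀ x, P x → ∃ y, P y ∧ r y x := by
  constructor
  · intro h
    refine ⟨fun x => ¬Acc r x, h, fun x hx => ?_⟩
    obtain ⟨b, hb⟩ := exists_not_acc_lt_of_not_acc hx
    exact ⟨b, hb⟩
  · rintro ⟨P, ha, hP⟩ h
    induction h with
    | intro a _ ih =>
      obtain ⟨y, hy, hya⟩ := hP a ha
      exact ih y hya hy

theorem ana_not_acc (hr : ∀ x y, Measurable fun v => r v x y) (a : ι) :
    Ana fun v => ¬Acc (r v) a := by
  classical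
  have h : Ana fun v => ∃ σ : ι → Bool, σ a = true ∧ ∀ x, σ x = true → ∃ y, σ y = true ∧
      r v y x := by
    refine Ana.proj (β := ι → Bool) (P := fun vσ => vσ.2 a = true ∧ ∀ x, vσ.2 x = true →
      ∃ y, vσ.2 y = true ∧ r vσ.1 y x) (Ana.of_measurable ?_)
    have hσ : ∀ p, Measurable fun vσ : α × (ι → Bool) => vσ.2 p = true := fun p =>
      Measurable.eq_const (by fun_prop) _
    exact (hσ _).and (Measurable.forall fun x => (hσ _).imp
        (Measurable.exists fun y' => (hσ _).and ((hr _ _).comp measurable_fst)))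
  refine h.congr fun v => not_acc_iff_exists.trans ⟨?_, ?_⟩
  · rintro ⟨σ, h⟩
    exact ⟨fun p => decide (σ p), by simpa using h⟩
  · rintro ⟨σ, h⟩
    exact ⟨fun x => σ x = true, h⟩

theorem measurable_sim_of_acc (hr : ∀ x y, Measurable fun v => r v x y) {r₀ : κ → κ → Prop} {b : κ}
    (hb : Acc r₀ b) (a : ι) : Measurable fun v => Sim (r v) a r₀ b := by
  induction hb generalizing a with
  | intro b _ ih =>
    have : (fun v => Sim (r v) a r₀ b) = fun v => ∀ a', r v a' a →
        ∃ b' : {b' // r₀ b' b}, Sim (r v) a' r₀ b' := by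
      funext v
      rw [sim_iff]
      simp
    rw [this]
    exact Measurable.forall fun a' => (hr _ _).imp (Measurable.exists fun b' => ih b' b'.2 a')

end Measurability

/-- The sequence starting with the reversal of `l` and continuing with the constant `d`. -/
def extend {α : Type*} (d : α) (l : List α) : ℕ → α := fun i => l.reverse.getD i d

theorem extend_cons_length {α : Type*} (d e : α) (l : List α) : extend d (e :: l) l.length = e := by
  simp [extend, List.getD_eq_getElem?_getD]

theorem extend_cons_of_lt {α : Type*} (d e : α) {l : List α} {i : ℕ} (h : i < l.length) :
    extend d (e :: l) i = extend d l i := by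
  simp [extend, List.getD_eq_getElem?_getD, List.getElem?_append, h]

theorem extend_res {α : Type*} (d : α) (y : ℕ → α) {n i : ℕ} (h : i < n) :
    extend d (res y n) i = y i := by
  induction n with
  | zero => omega
  | succ n ih =>
    rw [res_succ]
    rcases Nat.lt_succ_iff_lt_or_eq.1 h with h | rfl
    · rw [extend_cons_of_lt _ _ (by simpa using h), ih h]
    · have := extend_cons_length d (y i) (res y i)
      rwa [res_length] at this

theorem map_res {α β : Type*} (f : α → β) (y : ℕ → α) (n : ℕ) :
    (res y n).map f = res (fun i => f (y i)) n := by
  induction n with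
  | zero => rfl
  | succ n ih => simp [res_succ, ih]

/-- The `x`-th tree associated with `s`. -/
def OnT (s x : NN) (l : List ℕ) : Prop := OnTree (evens s) (interleave (odds s) x) l

/-- The one-step extension relation on the `x`-th tree associated with `s`. -/
def Ext (s x : NN) (l' l : List ℕ) : Prop := OnT s x l' ∧ ∃ k, l' = k :: l

theorem onT_congr {s x x' : NN} {l : List ℕ} (h : ∀ i < l.length, x i = x' i) :
    OnT s x l ↔ OnT s x' l := by
  refine onTree_congr (res_eq_res.2 fun m hm => ?_)
  unfold interleave
  split
  · rfl
  · exact h _ (by omega)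

theorem acc_ext {s x : NN} (h : ¬∃ b, Branch (evens s) (interleave (odds s) x) b) :
    Acc (Ext s x) [] := by
  by_contra h0
  refine h ?_
  obtain ⟨y, hy⟩ := exists_seq_of_not_acc (r := Ext s x) (fun l hl => by
    obtain ⟨b, hb, hbl⟩ := exists_not_acc_lt_of_not_acc hl
    obtain ⟨k, rfl⟩ := hbl.2
    exact ⟨k, hbl, hb⟩) h0
  refine ⟨y, fun n => ?_⟩
  have := (hy n).1.1
  exact OnTree.suffix this (List.suffix_cons _ _)

/-- The universal `Σ¹₂` set. -/
def UnivSigma (s : NN) : Prop := ∃ x, ¬∃ b, Branch (evens s) (interleave (odds s) x) b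

/-- The element below which the label of `σ` has to be in an attempt. -/
def parent (a : List ℕ) (φ : ℕ → List ℕ) : List ℕ → List ℕ
  | [] => a
  | _ :: σ => φ (Encodable.encode σ)

/-- One step of an attempt to build `x` together with a map from the `x`-th tree
associated with `s` to the relation `R` below `a`, decreasing along the tree. -/
def AttStep (s : NN) (R : List ℕ → List ℕ → Prop) (a : List ℕ) (e : ℕ × List ℕ)
    (l : List (ℕ × List ℕ)) : Prop :=
  OnT s (extend 0 ((e :: l).map Prod.fst)) (Denumerable.ofNat (List ℕ) l.length) →
    R e.2 (parent a (extend [] (l.map Prod.snd)) (Denumerable.ofNat (List ℕ) l.length))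

/-- The extension relation of attempts. -/
def Att (s : NN) (R : List ℕ → List ℕ → Prop) (a : List ℕ) (l' l : List (ℕ × List ℕ)) : Prop :=
  ∃ e, l' = e :: l ∧ AttStep s R a e l

/-- The finite attempts. -/
def AttValid (s : NN) (R : List ℕ → List ℕ → Prop) (a : List ℕ) : List (ℕ × List ℕ) → Prop
  | [] => True
  | e :: l => AttValid s R a l ∧ AttStep s R a e l

theorem attValid_of_reflTransGen {s : NN} {R : List ℕ → List ℕ → Prop} {a : List ℕ}
    {l : List (ℕ × List ℕ)} (h : Relation.ReflTransGen (Att s R a) l []) : AttValid s R a l := by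
  induction h using Relation.ReflTransGen.head_induction_on with
  | refl => trivial
  | head h _ ih =>
    obtain ⟨e, rfl, he⟩ := h
    exact ⟨ih, he⟩

theorem length_le_ofNat (n : ℕ) : (Denumerable.ofNat (List ℕ) n).length ≤ n := by
  simpa using Encodable.length_le_encode (Denumerable.ofNat (List ℕ) n)

theorem encode_lt_encode_cons (k : ℕ) (σ : List ℕ) :
    Encodable.encode σ < Encodable.encode (k :: σ) := by
  rw [Encodable.encode_list_cons]
  exact Nat.lt_succ_of_le (Nat.right_le_pair _ _)

theorem parent_congr {a : List ℕ} {φ φ' : ℕ → List ℕ} {n : ℕ} (h : ∀ i < n, φ i = φ' i) :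
    parent a φ (Denumerable.ofNat (List ℕ) n) = parent a φ' (Denumerable.ofNat (List ℕ) n) := by
  have h1 : Encodable.encode (Denumerable.ofNat (List ℕ) n) = n := by simp
  revert h1
  generalize Denumerable.ofNat (List ℕ) n = σ
  intro h1
  cases σ with
  | nil => rfl
  | cons k σ => exact h _ (h1 ▸ encode_lt_encode_cons k σ)

theorem acc_att {s : NN} (hs : ¬UnivSigma s) {R : List ℕ → List ℕ → Prop} {a : List ℕ}
    (ha : Acc R a) : Acc (Att s R a) [] := by
  by_contra h0
  obtain ⟨y, hy⟩ := exists_seq_of_not_acc (r := Att s R a) (fun l hl => by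
    obtain ⟨b, hb, hbl⟩ := exists_not_acc_lt_of_not_acc hl
    obtain ⟨e, rfl, he⟩ := hbl
    exact ⟨e, ⟨e, rfl, he⟩, hb⟩) h0
  have hφ : ∀ σ, OnT s (fun i => (y i).1) σ → R (y (Encodable.encode σ)).2
      (parent a (fun i => (y i).2) σ) := by
    intro σ hσ
    obtain ⟨e, he, hst⟩ := (hy (Encodable.encode σ)).1
    rw [res_succ, List.cons.injEq] at he
    rw [← he.1] at hst
    simp only [AttStep, ← res_succ, map_res, res_length] at hst
    rw [parent_congr (φ' := fun i => (y i).2) (fun i hi => extend_res _ _ hi)] at hst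
    simp only [Denumerable.ofNat_encode] at hst
    refine hst ((onT_congr fun i hi => ?_).2 hσ)
    exact extend_res _ _ (lt_trans (hi.trans_le (Encodable.length_le_encode σ)) (Nat.lt_succ_self _))
  simp only [UnivSigma, not_exists, not_forall, not_not] at hs
  obtain ⟨b, hb⟩ := hs fun i => (y i).1
  refine not_acc_iff_exists.2 ⟨fun u => u = a ∨ ∃ n, u = (y (Encodable.encode (res b n))).2,
    Or.inl rfl, ?_⟩ ha
  rintro x (rfl | ⟨n, rfl⟩)
  · exact ⟨_, Or.inr ⟨0, rfl⟩, hφ _ (hb 0)⟩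
  · exact ⟨_, Or.inr ⟨n + 1, rfl⟩, hφ _ (hb (n + 1))⟩

theorem not_acc_att {s x : NN} {R : List ℕ → List ℕ → Prop} {a u : List ℕ} (hu : R u a)
    (h : Sim (Ext s x) [] R u) : ¬Acc (Att s R a) [] := by
  refine not_acc_iff_exists.2 ⟨fun l => l.map Prod.fst = res x l.length ∧
    ∀ i < l.length, OnT s x (Denumerable.ofNat (List ℕ) i) →
      Sim (Ext s x) (Denumerable.ofNat (List ℕ) i) R (extend [] (l.map Prod.snd) i), by simp, ?_⟩
  rintro l ⟨h1, h2⟩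
  obtain ⟨w, hw⟩ : ∃ w, OnT s x (Denumerable.ofNat (List ℕ) l.length) →
      R w (parent a (extend [] (l.map Prod.snd)) (Denumerable.ofNat (List ℕ) l.length)) ∧
      Sim (Ext s x) (Denumerable.ofNat (List ℕ) l.length) R w := by
    by_cases hσ : OnT s x (Denumerable.ofNat (List ℕ) l.length)
    · have h3 : Encodable.encode (Denumerable.ofNat (List ℕ) l.length) = l.length := by simp
      revert h3 hσ
      generalize Denumerable.ofNat (List ℕ) l.length = σ
      intro hσ h3
      cases σ with
      | nil => exact ⟨u, fun _ => ⟨hu, h⟩⟩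
      | cons k σ =>
        have h4 := h2 (Encodable.encode σ) (h3 ▸ encode_lt_encode_cons k σ)
        simp only [Denumerable.ofNat_encode] at h4
        have h5 := h4 (OnTree.suffix hσ (List.suffix_cons _ _))
        obtain ⟨w, hw⟩ := sim_iff.1 h5 (k :: σ) ⟨hσ, k, rfl⟩
        exact ⟨w, fun _ => hw⟩
    · exact ⟨[], fun h => absurd h hσ⟩
  refine ⟨(x l.length, w) :: l, ⟨by simp [res_succ, h1], fun i hi => ?_⟩, _, rfl, fun hT => ?_⟩
  · simp only [List.length_cons] at hi
    intro hT
    rcases Nat.lt_succ_iff_lt_or_eq.1 hi with hi | rfl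
    · rw [List.map_cons, extend_cons_of_lt _ _ (by simpa using hi)]
      exact h2 i hi hT
    · have := extend_cons_length [] w (l.map Prod.snd)
      rw [List.length_map] at this
      rw [List.map_cons, this]
      exact (hw hT).2
  · refine (hw ((onT_congr fun i hi => ?_).1 hT)).1
    rw [List.map_cons, h1]
    exact extend_res _ _ (hi.trans_le ((length_le_ofNat _).trans (Nat.le_succ _)))

/-- Two attempts with the same first components and equivalent labels. -/
def AttEqv (s : NN) (R R' : List ℕ → List ℕ → Prop) (l l' : List (ℕ × List ℕ)) : Prop :=
  l.map Prod.fst = l'.map Prod.fst ∧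
    ∀ i < l.length, OnT s (extend 0 (l.map Prod.fst)) (Denumerable.ofNat (List ℕ) i) →
      Acc R (extend [] (l.map Prod.snd) i) ∧
      Sim R (extend [] (l.map Prod.snd) i) R' (extend [] (l'.map Prod.snd) i) ∧
      Sim R' (extend [] (l'.map Prod.snd) i) R (extend [] (l.map Prod.snd) i)

theorem AttEqv.length_eq {s : NN} {R R' : List ℕ → List ℕ → Prop} {l l' : List (ℕ × List ℕ)}
    (h : AttEqv s R R' l l') : l.length = l'.length := by
  simpa using congrArg List.length h.1

theorem AttEqv.symm {s : NN} {R R' : List ℕ → List ℕ → Prop} {l l' : List (ℕ × List ℕ)}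
    (h : AttEqv s R R' l l') : AttEqv s R' R l' l := by
  refine ⟨h.1.symm, fun i hi hT => ?_⟩
  rw [← h.1] at hT
  rw [← h.length_eq] at hi
  obtain ⟨h1, h2, h3⟩ := h.2 i hi hT
  exact ⟨h3.acc h1, h3, h2⟩

theorem AttEqv.exists_step {s : NN} {R R' : List ℕ → List ℕ → Prop}
    (hR' : ∀ x y z, R' x y → R' y z → R' x z) {a a' : List ℕ} (ha : Acc R a)
    (haa' : Sim R a R' a') (ha'a : Sim R' a' R a) {l l' : List (ℕ × List ℕ)}
    (h : AttEqv s R R' l l') {e : ℕ × List ℕ} (he : AttStep s R a e l) :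
    ∃ e', AttStep s R' a' e' l' ∧ AttEqv s R R' (e :: l) (e' :: l') := by
  have key : ∀ u u', Acc R u → Sim R u R' u' → Sim R' u' R u → R e.2 u →
      ∃ w, R' w u' ∧ Acc R e.2 ∧ Sim R e.2 R' w ∧ Sim R' w R e.2 := by
    intro u u' hu huu' hu'u heu
    obtain ⟨u'', hu'', h1⟩ := sim_iff.1 huu' _ heu
    obtain ⟨w, hw⟩ := h1.exists_below hR' hu'' ((hu'u.acc hu).inv hu'')
    exact ⟨w, hw.1, hu.inv heu, hw.2⟩
  obtain ⟨w, hw⟩ : ∃ w, OnT s (extend 0 ((e :: l).map Prod.fst))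
      (Denumerable.ofNat (List ℕ) l.length) →
      R' w (parent a' (extend [] (l'.map Prod.snd)) (Denumerable.ofNat (List ℕ) l.length)) ∧
      Acc R e.2 ∧ Sim R e.2 R' w ∧ Sim R' w R e.2 := by
    by_cases hσ : OnT s (extend 0 ((e :: l).map Prod.fst)) (Denumerable.ofNat (List ℕ) l.length)
    · have h1 := he hσ
      have h3 : Encodable.encode (Denumerable.ofNat (List ℕ) l.length) = l.length := by simp
      have h4 : (Denumerable.ofNat (List ℕ) l.length).length ≤ l.length := length_le_ofNat _
      revert h4 h3 hσ h1
      generalize Denumerable.ofNat (List ℕ) l.length = σ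
      intro hσ h1 h3 h4
      cases σ with
      | nil =>
        obtain ⟨w, hw⟩ := key _ _ ha haa' ha'a h1
        exact ⟨w, fun _ => hw⟩
      | cons k σ =>
        have h5 := h.2 (Encodable.encode σ) (h3 ▸ encode_lt_encode_cons k σ)
        simp only [Denumerable.ofNat_encode] at h5
        obtain ⟨h6, h7, h8⟩ := h5 ((onT_congr fun i hi => by
          rw [List.map_cons, extend_cons_of_lt]
          rw [List.length_map]
          exact hi.trans (lt_of_lt_of_le (Nat.lt_succ_self _) h4)).1
          (OnTree.suffix hσ (List.suffix_cons _ _)))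
        obtain ⟨w, hw⟩ := key _ _ h6 h7 h8 h1
        exact ⟨w, fun _ => hw⟩
    · exact ⟨[], fun h => absurd h hσ⟩
  have hlen := h.length_eq
  refine ⟨(e.1, w), fun hT => ?_, by simp [h.1], fun i hi hT => ?_⟩
  · have h1 : ((e.1, w) :: l').map Prod.fst = (e :: l).map Prod.fst := by simp [h.1]
    rw [h1, ← hlen] at hT
    rw [← hlen]
    exact (hw hT).1
  · simp only [List.length_cons] at hi
    rcases Nat.lt_succ_iff_lt_or_eq.1 hi with hi | rfl
    · simp only [List.map_cons]
      rw [extend_cons_of_lt _ _ (by simpa using hi),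
        extend_cons_of_lt _ _ (by rw [List.length_map, ← hlen]; exact hi)]
      refine h.2 i hi ((onT_congr fun j hj => ?_).1 hT)
      rw [List.map_cons, extend_cons_of_lt]
      rw [List.length_map]
      exact hj.trans_le ((length_le_ofNat _).trans hi.le)
    · have h1 := extend_cons_length [] e.2 (l.map Prod.snd)
      have h2 := extend_cons_length [] w (l'.map Prod.snd)
      rw [List.length_map] at h1 h2
      simp only [List.map_cons]
      rw [h1, hlen, h2]
      exact (hw hT).2

section Bisimulation

variable {s : NN} {R R' : List ℕ → List ℕ → Prop} {a a' : List ℕ}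

theorem AttEqv.sim (hR' : ∀ x y z, R' x y → R' y z → R' x z) (ha : Acc R a) (haa' : Sim R a R' a')
    (ha'a : Sim R' a' R a) {l l' : List (ℕ × List ℕ)} (h : AttEqv s R R' l l') :
    Sim (Att s R a) l (Att s R' a') l' := by
  refine ⟨AttEqv s R R', h, ?_⟩
  rintro l l' h _ ⟨e, rfl, he⟩
  obtain ⟨e', he', h'⟩ := h.exists_step hR' ha haa' ha'a he
  exact ⟨_, ⟨e', rfl, he'⟩, h'⟩

theorem attEqv_nil : AttEqv s R R' [] [] := ⟨rfl, by simp⟩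

theorem AttValid.exists_attEqv (hR' : ∀ x y z, R' x y → R' y z → R' x z) (ha : Acc R a)
    (haa' : Sim R a R' a') (ha'a : Sim R' a' R a) {l : List (ℕ × List ℕ)}
    (h : AttValid s R a l) : ∃ l', AttEqv s R R' l l' := by
  induction l with
  | nil => exact ⟨[], attEqv_nil⟩
  | cons e l ih =>
    obtain ⟨l', hl'⟩ := ih h.1
    obtain ⟨e', -, h'⟩ := hl'.exists_step hR' ha haa' ha'a h.2
    exact ⟨_, h'⟩

end Bisimulation

/-- Every attempt tree attached to a point in the well-founded part of `R` compares with `R`. -/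
def AttComparable (s : NN) (R : List ℕ → List ℕ → Prop) : Prop :=
  ∀ u, ¬Acc R u ∨ ∀ u', R u' u → Sim (Att s R u') [] R u ∨
    ∃ w, AttValid s R u' w ∧ Sim (Att s R u') w R u ∧ Sim R u (Att s R u') w

theorem attComparable {s : NN} (hs : ¬UnivSigma s) (R : List ℕ → List ℕ → Prop) :
    AttComparable s R := by
  intro u
  by_cases hu : Acc R u
  swap
  · exact Or.inl hu
  refine Or.inr fun u' hu' => ?_
  have hacc : Acc (Att s R u') [] := acc_att hs (hu.inv hu')
  refine (sim_or_exists hacc R u).imp_right ?_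
  rintro ⟨w', hw', h⟩
  obtain ⟨w, hw, h1, h2⟩ := h.exists_reachable (hacc.inv hw')
  exact ⟨w, attValid_of_reflTransGen (hw.tail hw'), h2, h1⟩

section Measurability

variable {α : Type*} [MeasurableSpace α] {s : α → NN} {R : α → List ℕ → List ℕ → Prop}

theorem measurable_attStep (hs : Measurable s) (hR : ∀ x y, Measurable fun v => R v x y)
    (a : List ℕ) (e : ℕ × List ℕ) (l : List (ℕ × List ℕ)) :
    Measurable fun v => AttStep (s v) (R v) a e l :=
  (measurable_onTree (by fun_prop)
    (Measurable.interleave (by fun_prop) measurable_const) _).imp (hR _ _)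

theorem measurable_att (hs : Measurable s) (hR : ∀ x y, Measurable fun v => R v x y)
    (a : List ℕ) (l' l : List (ℕ × List ℕ)) : Measurable fun v => Att (s v) (R v) a l' l :=
  Measurable.exists fun e => measurable_const.and (measurable_attStep hs hR a e l)

theorem measurable_attValid (hs : Measurable s) (hR : ∀ x y, Measurable fun v => R v x y)
    (a : List ℕ) (l : List (ℕ × List ℕ)) : Measurable fun v => AttValid (s v) (R v) a l := by
  induction l with
  | nil => exact measurable_const
  | cons e l ih => exact ih.and (measurable_attStep hs hR a e l)

theorem ana_attComparable (hs : Measurable s) (hR : ∀ x y, Measurable fun v => R v x y) :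
    Ana fun v => AttComparable (s v) (R v) := by
  refine Ana.forall fun u => (ana_not_acc hR u).or (Ana.forall fun u' => Ana.imp (hR _ _) ?_)
  have hA := measurable_att hs hR u'
  exact (ana_sim hA hR _ _).or (Ana.exists fun w =>
    (Ana.of_measurable (measurable_attValid hs hR u' w)).and
      ((ana_sim hA hR _ _).and (ana_sim hR hA _ _)))

theorem exists_measurable_acc {s₀ : NN} (hs₀ : UnivSigma s₀)
    (hR : ∀ x y, Measurable fun v => R v x y)
    (htrans : ∀ v x y z, R v x y → R v y z → R v x z) :
    ∃ N : α → List ℕ → Prop, (∀ u, Measurable fun v => N v u) ∧ (∀ v u, N v u → Acc (R v) u) ∧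
      ∀ v, AttComparable s₀ (R v) → ∀ u, Acc (R v) u → N v u := by
  obtain ⟨x, hx⟩ := hs₀
  have hQ := acc_ext hx
  by_cases hbig : ∃ v u, Acc (R v) u ∧ ¬Acc (Att s₀ (R v) u) []
  · obtain ⟨v₀, u₀, hu₀, hatt⟩ := hbig
    refine ⟨fun v u => Sim (R v) u (R v₀) u₀ ∨ ∃ w : {w // Acc (Att s₀ (R v₀) u₀) w},
      Sim (R v) u (Att s₀ (R v₀) u₀) w, fun u => ?_, ?_, fun v hv u hu => ?_⟩
    · exact (measurable_sim_of_acc hR hu₀ u).or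
        (Measurable.exists fun w => measurable_sim_of_acc hR w.2 u)
    · rintro v u (h | ⟨w, h⟩)
      · exact h.acc hu₀
      · exact h.acc w.2
    · refine (sim_or_exists hu (R v₀) u₀).imp_right ?_
      rintro ⟨u₁, hu₁, h⟩
      obtain ⟨u', hu', h1, h2⟩ := h.exists_below (htrans v) hu₁ (hu.inv hu₁)
      have hacc := hu.inv hu'
      rcases (hv u).resolve_left (not_not.2 hu) u' hu' with h3 | ⟨w, hw, h3, h4⟩
      · exact absurd ((attEqv_nil.sim (htrans v) hu₀ h1 h2).acc (h3.acc hu)) hatt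
      · obtain ⟨w₀, hw₀⟩ := hw.exists_attEqv (htrans v₀) hacc h2 h1
        exact ⟨⟨w₀, ((hw₀.symm.sim (htrans v) hu₀ h1 h2).trans h3).acc hu⟩,
          h4.trans (hw₀.sim (htrans v₀) hacc h2 h1)⟩
  · push Not at hbig
    refine ⟨fun v u => Sim (R v) u (Ext s₀ x) [], fun u => measurable_sim_of_acc hR hQ u,
      fun v u h => h.acc hQ, fun v _ u hu => ?_⟩
    refine (sim_or_exists hu (Ext s₀ x) []).resolve_right ?_
    rintro ⟨u', hu', h⟩
    exact not_acc_att hu' h (hbig v u hu)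

end Measurability

/-- The relation of proper extension on the tree coded by `c` at `v`. -/
def TreeRel (c v : NN) (l' l : List ℕ) : Prop := OnTree c v l' ∧ l <:+ l' ∧ l ≠ l'

theorem treeRel_trans (c v : NN) (x y z : List ℕ) (h : TreeRel c v x y) (h' : TreeRel c v y z) :
    TreeRel c v x z := by
  refine ⟨h.1, h'.2.1.trans h.2.1, ?_⟩
  rintro rfl
  exact h.2.2 (h.2.1.eq_of_length_le h'.2.1.length_le)

theorem measurable_treeRel (c : NN) (l' l : List ℕ) : Measurable fun v => TreeRel c v l' l :=
  (measurable_onTree measurable_const measurable_id l').and measurable_const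

theorem exists_cons_not_acc {c v : NN} {l : List ℕ} (h : ¬Acc (TreeRel c v) l) :
    ∃ k, TreeRel c v (k :: l) l ∧ ¬Acc (TreeRel c v) (k :: l) := by
  obtain ⟨b, hb, hT, ⟨t, rfl⟩, hne⟩ := exists_not_acc_lt_of_not_acc h
  rcases t.eq_nil_or_concat with rfl | ⟨t, k, rfl⟩
  · exact absurd rfl hne
  have hsuf : k :: l <:+ t.concat k ++ l := ⟨t, by simp⟩
  refine ⟨k, ⟨hT.suffix hsuf, List.suffix_cons _ _, by simp⟩, fun hacc => hb ?_⟩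
  by_cases h' : k :: l = t.concat k ++ l
  · rwa [← h']
  · exact hacc.inv ⟨hT, hsuf, h'⟩

theorem not_acc_of_branch {c v b : NN} (hb : Branch c v b) : ¬Acc (TreeRel c v) [] := by
  refine not_acc_iff_exists.2 ⟨fun l => ∃ n, l = res b n, ⟨0, rfl⟩, ?_⟩
  rintro _ ⟨n, rfl⟩
  exact ⟨_, ⟨n + 1, rfl⟩, hb _, List.suffix_cons _ _, by simp [res_succ]⟩

theorem exists_measurable_branch {s : NN} (hs : UnivSigma s) (c : NN) :
    ∃ a : NN → NN, Measurable a ∧ ∀ v, AttComparable s (TreeRel c v) → (∃ b, Branch c v b) →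
      Branch c v (a v) := by
  classical
  obtain ⟨N, hN, hN1, hN2⟩ := exists_measurable_acc hs (measurable_treeRel c) (treeRel_trans c)
  have hex : ∀ v l, ∃ k, ¬N v (k :: l) ∨ ∀ j, N v (j :: l) := by
    intro v l
    by_cases h : ∀ j, N v (j :: l)
    · exact ⟨0, Or.inr h⟩
    · push Not at h
      exact h.imp fun k hk => Or.inl hk
  let g : NN → List ℕ → ℕ := fun v l => Nat.find (hex v l)
  have hg : ∀ l, Measurable fun v => g v l := fun l => measurable_find _ fun k =>
    measurableSet_setOfPred.2 ((hN _).not.or (Measurable.forall fun j => hN _))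
  let L : NN → ℕ → List ℕ := fun v n => n.rec [] fun _ l => g v l :: l
  let a : NN → NN := fun v n => g v (L v n)
  have hL : ∀ v n, res (a v) n = L v n := by
    intro v n
    induction n with
    | zero => rfl
    | succ n ih => rw [res_succ, ih]
  have hmL : ∀ n, Measurable[_, ⊤] fun v => L v n := by
    let _ : MeasurableSpace (List ℕ) := ⊤
    intro n
    induction n with
    | zero => exact measurable_const
    | succ n ih =>
      have : Measurable fun p : NN × List ℕ => g p.1 p.2 :: p.2 :=
        measurable_from_prod_countable_left fun l => (measurable_from_top (f := fun k => k :: l)).comp (hg l)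
      exact this.comp (measurable_id.prodMk ih)
  refine ⟨a, measurable_pi_lambda _ fun n => ?_, ?_⟩
  · let _ : MeasurableSpace (List ℕ) := ⊤
    have : Measurable fun p : NN × List ℕ => g p.1 p.2 := measurable_from_prod_countable_left hg
    exact this.comp (measurable_id.prodMk (hmL n))
  · rintro v hv ⟨b, hb⟩
    have hacc : ∀ n, ¬Acc (TreeRel c v) (L v n) ∧ OnTree c v (L v n) := by
      intro n
      induction n with
      | zero => exact ⟨not_acc_of_branch hb, hb 0⟩
      | succ n ih =>
        have hbad : ¬Acc (TreeRel c v) (g v (L v n) :: L v n) := by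
          obtain ⟨k, -, hk⟩ := exists_cons_not_acc ih.1
          have h1 := Nat.find_spec (hex v (L v n))
          intro h2
          rcases h1 with h1 | h1
          · exact h1 (hN2 v hv _ h2)
          · exact hk (hN1 v _ (h1 k))
        refine ⟨hbad, ?_⟩
        obtain ⟨b', hb', h'⟩ := exists_not_acc_lt_of_not_acc hbad
        exact h'.1.suffix h'.2.1
    exact fun n => hL v n ▸ (hacc n).2

/-- The relation of being a child in the Borel code `p`: nodes labelled `0` have all their
immediate extensions as children, the other nodes are leaves. -/
def CodeRel (p : NN) (l' l : List ℕ) : Prop := ∃ k, l' = k :: l ∧ p (Encodable.encode l) = 0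

/-- The condition on `t` at a leaf with label `k + 1`. -/
def LeafMem (t : NN) (k : ℕ) : Prop :=
  res t (Denumerable.ofNat (List ℕ) k).length = Denumerable.ofNat (List ℕ) k

/-- `e` evaluates the Borel code `p` at `t`: nodes labelled `0` hold if none of their children
hold. -/
def Evaluates (p t : NN) (e : List ℕ → Bool) : Prop :=
  ∀ l, e l = true ↔ (∃ k, p (Encodable.encode l) = k + 1 ∧ LeafMem t k) ∨
    (p (Encodable.encode l) = 0 ∧ ∀ n, e (n :: l) = false)

theorem exists_evaluates {p : NN} (hp : ∀ l, Acc (CodeRel p) l) (t : NN) :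
    ∃ e, Evaluates p t e := by
  classical
  let e : List ℕ → Bool := WellFounded.fix ⟨hp⟩ fun l ih =>
    decide ((∃ k, p (Encodable.encode l) = k + 1 ∧ LeafMem t k) ∨
      ∃ h : p (Encodable.encode l) = 0, ∀ n, ih (n :: l) ⟨n, rfl, h⟩ = false)
  refine ⟨e, fun l => ?_⟩
  have : e l = decide ((∃ k, p (Encodable.encode l) = k + 1 ∧ LeafMem t k) ∨
      ∃ _ : p (Encodable.encode l) = 0, ∀ n, e (n :: l) = false) := WellFounded.fix_eq _ _ _
  rw [this, decide_eq_true_iff, exists_prop]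

/-- `p` is a Borel code for `S`. -/
def Codes (p : NN) (S : Set NN) : Prop :=
  (∀ l, Acc (CodeRel p) l) ∧ ∀ t e, Evaluates p t e → (e [] = true ↔ t ∈ S)

/-- The code whose root is labelled `0` and has the codes `p n` as children. -/
def norCode (p : ℕ → NN) : NN := fun m =>
  match (Denumerable.ofNat (List ℕ) m).reverse with
  | [] => 0
  | n :: l => p n (Encodable.encode l.reverse)

theorem norCode_nil (p : ℕ → NN) : norCode p (Encodable.encode ([] : List ℕ)) = 0 := by
  simp only [norCode, Denumerable.ofNat_encode, List.reverse_nil]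

theorem norCode_append (p : ℕ → NN) (l : List ℕ) (n : ℕ) :
    norCode p (Encodable.encode (l ++ [n])) = p n (Encodable.encode l) := by
  simp only [norCode, Denumerable.ofNat_encode, List.reverse_append, List.reverse_cons,
    List.reverse_nil, List.nil_append, List.cons_append, List.reverse_reverse]

theorem Evaluates.norCode {p : ℕ → NN} {t : NN} {e : List ℕ → Bool}
    (h : Evaluates (norCode p) t e) (n : ℕ) : Evaluates (p n) t fun l => e (l ++ [n]) := by
  intro l
  have := h (l ++ [n])
  rwa [norCode_append] at this

theorem acc_norCode {p : ℕ → NN} (hp : ∀ n l, Acc (CodeRel (p n)) l) (l : List ℕ) :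
    Acc (CodeRel (norCode p)) l := by
  have key : ∀ n l, Acc (CodeRel (norCode p)) (l ++ [n]) := by
    intro n l
    induction hp n l with
    | intro l _ ih =>
      refine Acc.intro _ ?_
      rintro _ ⟨k, rfl, h⟩
      rw [norCode_append] at h
      exact ih (k :: l) ⟨k, rfl, h⟩
  rcases l.eq_nil_or_concat with rfl | ⟨l, n, rfl⟩
  · refine Acc.intro _ ?_
    rintro _ ⟨k, rfl, -⟩
    exact key k []
  · rw [List.concat_eq_append]
    exact key n l

theorem Codes.nor {p : ℕ → NN} {S : ℕ → Set NN} (h : ∀ n, Codes (p n) (S n)) :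
    Codes (norCode p) {t | ∀ n, t ∉ S n} := by
  refine ⟨acc_norCode fun n => (h n).1, fun t e he => ?_⟩
  rw [he [], norCode_nil]
  have : ∀ n, e [n] = true ↔ t ∈ S n := fun n => (h n).2 t _ (he.norCode n)
  simp [← this]

theorem exists_codes {S : Set NN} (hS : MeasurableSet S) : ∃ p, Codes p S := by
  have leaf : ∀ k, ∃ p, Codes p {t | LeafMem t k} := by
    refine fun k => ⟨fun _ => k + 1, fun l => Acc.intro _ ?_, fun t e he => ?_⟩
    · rintro _ ⟨_, _, h⟩
      exact absurd h (Nat.succ_ne_zero k)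
    · rw [he []]
      simp
  have compl : ∀ S : Set NN, (∃ p, Codes p S) → ∃ p, Codes p Sᶜ := by
    rintro S ⟨p, hp⟩
    refine ⟨_, (?_ : {t | ∀ n : ℕ, t ∉ S} = Sᶜ) ▸ Codes.nor fun _ => hp⟩
    ext t
    simp
  have huniv : ∃ p, Codes p univ := by
    obtain ⟨p, hp⟩ := leaf 0
    refine ⟨p, (?_ : {t | LeafMem t 0} = univ) ▸ hp⟩
    ext t
    simp [LeafMem]
  let m : MeasurableSpace NN :=
    { MeasurableSet' := fun S => ∃ p, Codes p S
      measurableSet_empty := compl_univ (α := NN) ▸ compl _ huniv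
      measurableSet_compl := compl
      measurableSet_iUnion := by
        intro S hS
        choose p hp using hS
        refine (?_ : {t | ∀ n, t ∉ S n}ᶜ = ⋃ n, S n) ▸ compl _ ⟨_, Codes.nor hp⟩
        ext t
        simp }
  have hle : (MeasurableSpace.pi : MeasurableSpace NN) ≤ m := by
    refine iSup_le fun i => ?_
    rintro _ ⟨s, -, rfl⟩
    have : (fun t : NN => t i) ⁻¹' s = ⋃ k : {k // (Denumerable.ofNat (List ℕ) k).length = i + 1 ∧
        ∃ j ∈ s, (Denumerable.ofNat (List ℕ) k).head? = some j}, {t | LeafMem t k} := by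
      ext t
      simp only [mem_preimage, mem_iUnion, mem_ofPred_eq, LeafMem, Subtype.exists, exists_prop]
      constructor
      · intro h
        refine ⟨Encodable.encode (res t (i + 1)), ?_⟩
        simp only [Denumerable.ofNat_encode, res_length, true_and, and_true]
        exact ⟨t i, h, rfl⟩
      · rintro ⟨k, ⟨h1, j, hj, h2⟩, h3⟩
        rw [h1] at h3
        rw [← h3, res_succ, List.head?_cons, Option.some.injEq] at h2
        rwa [h2]
    rw [this]
    exact MeasurableSet.iUnion fun k => leaf k
  exact hle S hS

theorem exists_code_of_measurable {f : NN → ℕ → Bool} (hf : Measurable f) :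
    ∃ p, (∀ l, Acc (CodeRel p) l) ∧ ∀ t e, Evaluates p t e → ∀ n, e [n] = f t n := by
  choose p hp using fun n => exists_codes (S := {t | f t n = true})
    (measurableSet_setOfPred.2 (Measurable.eq_const (by fun_prop) true))
  refine ⟨norCode p, acc_norCode fun n => (hp n).1, fun t e he n => ?_⟩
  have : e [n] = true ↔ f t n = true := (hp n).2 t _ (he.norCode n)
  exact Bool.eq_iff_iff.2 this

section Measurability

variable {α : Type*} [MeasurableSpace α]

theorem measurable_evaluates {p t : α → NN} {e : α → List ℕ → Bool} (hp : Measurable p)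
    (ht : Measurable t) (he : Measurable e) :
    Measurable fun x => Evaluates (p x) (t x) (e x) := by
  have he' : ∀ l b, Measurable fun x => e x l = b := fun l b => Measurable.eq_const (by fun_prop) b
  have hp' : ∀ l k, Measurable fun x => p x l = k := fun l k => Measurable.eq_const (by fun_prop) k
  exact Measurable.forall fun l => (he' _ _).iff
    ((Measurable.exists fun k => (hp' _ _).and (measurable_res_eq ht _ _)).or
      ((hp' _ _).and (Measurable.forall fun n => he' _ _)))

theorem ana_ill_founded {p : α → NN} (hp : Measurable p) :
    Ana fun x => ¬∀ l, Acc (CodeRel (p x)) l := by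
  have hp' : ∀ l k, Measurable fun x => p x l = k := fun l k => Measurable.eq_const (by fun_prop) k
  exact (Ana.exists fun l => ana_not_acc (r := fun x => CodeRel (p x))
    (fun l' l => Measurable.exists fun k => measurable_const.and (hp' _ _)) l).congr
      fun x => not_forall

end Measurability

theorem exists_measurable_leftInverse (Y : Type*) [TopologicalSpace Y] [PolishSpace Y]
    [MeasurableSpace Y] [BorelSpace Y] [Nonempty Y] :
    ∃ (β : Y → ℕ → Bool) (δ : (ℕ → Bool) → Y), Measurable β ∧ Measurable δ ∧ ∀ y, δ (β y) = y := by
  obtain ⟨β, hβ, hinj⟩ := MeasurableSpace.measurable_injection_nat_bool_of_countablySeparated Y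
  obtain ⟨δ, hδ, h⟩ := (hβ.measurableEmbedding hinj).exists_measurable_extend measurable_id
    fun _ => inferInstance
  exact ⟨β, δ, hβ, hδ, fun y => congrFun h y⟩

theorem sigma12Hard_univSigma : Sigma12Hard {s | UnivSigma s} := by
  intro Z _ _ _ _ A' hA'
  obtain ⟨C, hC, rfl⟩ := hA'
  cases isEmpty_or_nonempty Z
  · exact ⟨fun _ _ => 0, measurable_const, fun z => isEmptyElim z⟩
  obtain ⟨β, δ, hβ, hδ, hδβ⟩ := exists_measurable_leftInverse Z
  have hg : Measurable fun (b : ℕ → Bool) (n : ℕ) => (b n).toNat :=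
    measurable_pi_lambda _ fun n => (measurable_of_countable Bool.toNat).comp (measurable_pi_apply n)
  have hh : Measurable fun (z : NN) (n : ℕ) => decide (z n = 1) :=
    measurable_pi_lambda _ fun n =>
      (measurable_of_countable fun k : ℕ => decide (k = 1)).comp (measurable_pi_apply n)
  have hP : Ana fun q : NN => (δ fun n => decide (evens q n = 1), odds q) ∈ Cᶜ :=
    (AnalyticSet.ana hC).comp ((hδ.comp (hh.comp measurable_evens)).prodMk measurable_odds)
  obtain ⟨c, hc⟩ := hP.exists_code
  refine ⟨fun z => interleave c fun n => (β z n).toNat,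
    measurable_const.interleave (hg.comp hβ), fun z => ?_⟩
  have h1 : (δ fun n => decide ((β z n).toNat = 1)) = z := by
    conv_rhs => rw [← hδβ z]
    congr 1
    funext n
    cases β z n <;> rfl
  simp only [mem_ofPred_eq, UnivSigma, evens_interleave, odds_interleave, ← hc, h1, mem_compl_iff,
    not_not, mem_image, Prod.exists, exists_and_right, exists_eq_right]

end UniformHard

/-- Let `X, Y` be Polish spaces and `Γ` a class of subsets of Polish spaces closed under
continuous preimages, finite unions and intersections, containing all closed and all open
sets.  Suppose `Φ : Γ(X) → Π¹₁(Y)` is `Π¹₁ on Γ` and `F^Φ = {A : Φ(A) ≠ ∅}` is nicely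
`Σ¹₁`-hard on `Γ`.  Then the uniform family `U^Φ` is `Σ¹₂`-hard on `Γ`: there is
`B ∈ Γ(ℕ^ℕ × (ℕ^ℕ × X))` such that `{s : B_s ∈ U^Φ}` is `Σ¹₂`-hard, where `B_s ∈ U^Φ`
means that `{(t,y) : y ∈ Φ((B_s)_t)}` contains the graph of a Borel function `ℕ^ℕ → Y`. -/
theorem uniform_family_Sigma12_hard
    (X : Type) [TopologicalSpace X] [PolishSpace X]
    (Y : Type) [TopologicalSpace Y] [PolishSpace Y] [MeasurableSpace Y] [BorelSpace Y]
    (Γ : (Z : Type) → TopologicalSpace Z → Set Z → Prop)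
    (hpre : ∀ (Z W : Type) (tZ : TopologicalSpace Z) (tW : TopologicalSpace W) (f : Z → W),
      @Continuous Z W tZ tW f → ∀ A : Set W, Γ W tW A → Γ Z tZ (f ⁻¹' A))
    (hunion : ∀ (Z : Type) (tZ : TopologicalSpace Z) (A B : Set Z),
      Γ Z tZ A → Γ Z tZ B → Γ Z tZ (A ∪ B))
    (hinter : ∀ (Z : Type) (tZ : TopologicalSpace Z) (A B : Set Z),
      Γ Z tZ A → Γ Z tZ B → Γ Z tZ (A ∩ B))
    (hclosed : ∀ (Z : Type) (tZ : TopologicalSpace Z) (A : Set Z), @IsClosed Z tZ A → Γ Z tZ A)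
    (hopen : ∀ (Z : Type) (tZ : TopologicalSpace Z) (A : Set Z), @IsOpen Z tZ A → Γ Z tZ A)
    (Φ : Set X → Set Y)
    (hΦcoanalytic : ∀ (P : Type) [TopologicalSpace P] [PolishSpace P] (A : Set (P × X)),
      Γ (P × X) instTopologicalSpaceProd A →
      IsCoanalytic {sy : P × Y | sy.2 ∈ Φ {x : X | (sy.1, x) ∈ A}})
    (hnice : ∀ A : Set NN, AnalyticSet A →
      ∃ B : Set (NN × X), Γ (NN × X) instTopologicalSpaceProd B ∧
      ∃ D : Set (NN × Y), AnalyticSet D ∧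
        (∀ s : NN, {y : Y | (s, y) ∈ D} ⊆ Φ {x : X | (s, x) ∈ B}) ∧
        (∀ s : NN, (s ∈ A ↔ {y : Y | (s, y) ∈ D}.Nonempty) ∧
          (s ∈ A ↔ (Φ {x : X | (s, x) ∈ B}).Nonempty))) :
    ∃ B : Set (NN × (NN × X)), Γ (NN × (NN × X)) instTopologicalSpaceProd B ∧
      Sigma12Hard {s : NN | ∃ f : NN → Y, Measurable f ∧
        ∀ t : NN, f t ∈ Φ {x : X | (s, (t, x)) ∈ B}} := by
  open UniformHard in
  classical
  have hA : Ana fun v : NN => ∃ b, Branch (evens v) v b :=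
    ana_exists_branch measurable_evens measurable_id
  obtain ⟨B, hB, D, hD, hDB, hAB⟩ := hnice _ hA.analyticSet
  obtain ⟨p₀, hp₀⟩ : ∃ v : NN, ∃ b, Branch (evens v) v b := by
    obtain ⟨c, hc⟩ := (Ana.of_measurable (α := NN) (measurable_const (a := True))).exists_code
    exact ⟨interleave c c, by simpa using (hc (interleave c c)).1 trivial⟩
  obtain ⟨y₀, hy₀⟩ := (hAB p₀).2.1 hp₀
  have : Nonempty Y := ⟨y₀⟩
  obtain ⟨gD, hgD, hgDr⟩ : ∃ g : NN → NN × Y, Continuous g ∧ range g = D := by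
    rw [AnalyticSet] at hD
    refine hD.resolve_left ?_
    rintro rfl
    obtain ⟨y, hy⟩ := (hAB p₀).1.1 hp₀
    exact hy
  obtain ⟨cD, hcD⟩ := exists_code_of_continuous (continuous_fst.comp hgD)
  obtain ⟨β, δ, hβ, hδ, hδβ⟩ := exists_measurable_leftInverse Y
  have hW : Ana fun v : NN => AttComparable (evens (odds v)) (TreeRel cD v) :=
    ana_attComparable (by fun_prop) (measurable_treeRel cD)
  obtain ⟨K, hK, hKW⟩ := hW.exists_isClosed
  have hcoΦ : Ana fun q : NN × Y => q.2 ∉ Φ {x | (q.1, x) ∈ B} :=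
    (AnalyticSet.ana (hΦcoanalytic NN B hB)).congr fun q => Iff.rfl
  have hV : Ana fun v : NN => ∃ M : NN, (v, M) ∈ K ∧ ((¬∀ l, Acc (CodeRel (odds (odds v))) l) ∨
      ∃ e : List ℕ → Bool, Evaluates (odds (odds v)) (interleave (odds (odds v)) M) e ∧
        δ (fun n => e [n]) ∉ Φ {x | (v, x) ∈ B}) := by
    refine Ana.proj (β := NN) (P := fun q : NN × NN => q ∈ K ∧ ((¬∀ l, Acc (CodeRel (odds (odds q.1))) l) ∨
      ∃ e : List ℕ → Bool, Evaluates (odds (odds q.1)) (interleave (odds (odds q.1)) q.2) e ∧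
        δ (fun n => e [n]) ∉ Φ {x | (q.1, x) ∈ B})) ?_
    refine (Ana.of_measurable (measurableSet_setOfPred.1 hK.measurableSet)).and
      ((ana_ill_founded (by fun_prop)).or ?_)
    refine Ana.proj (β := List ℕ → Bool) (P := fun q : (NN × NN) × (List ℕ → Bool) => Evaluates (odds (odds q.1.1))
      (interleave (odds (odds q.1.1)) q.1.2) q.2 ∧
        δ (fun n => q.2 [n]) ∉ Φ {x | (q.1.1, x) ∈ B}) ?_
    refine (Ana.of_measurable (measurable_evaluates (by fun_prop)
      (Measurable.interleave (by fun_prop) (by fun_prop)) (by fun_prop))).and ?_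
    exact hcoΦ.comp (f := fun q : (NN × NN) × (List ℕ → Bool) => (q.1.1, δ fun n => q.2 [n]))
      ((by fun_prop : Measurable fun q : (NN × NN) × (List ℕ → Bool) => q.1.1).prodMk
        (hδ.comp (by fun_prop)))
  obtain ⟨c, hc⟩ := hV.exists_code
  let w : NN → NN → NN := fun s p => interleave c (interleave s p)
  have hw : ∀ s p, (Φ {x | (w s p, x) ∈ B}).Nonempty ↔ ∃ M : NN, (w s p, M) ∈ K ∧
      ((¬∀ l, Acc (CodeRel p) l) ∨ ∃ e : List ℕ → Bool, Evaluates p (interleave p M) e ∧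
        δ (fun n => e [n]) ∉ Φ {x | (w s p, x) ∈ B}) := by
    intro s p
    rw [← (hAB (w s p)).2, mem_ofPred_eq]
    have := (hc (w s p)).symm
    simpa only [w, evens_interleave, odds_interleave] using this
  have hwc : Continuous fun q : NN × NN => w q.1 q.2 :=
    continuous_const.interleave continuous_interleave
  let Bh : Set (NN × (NN × X)) :=
    ((fun q => (w q.1 (evens q.2.1), odds q.2.1)) ⁻¹' K ∩
      (fun q => (w q.1 (evens q.2.1), q.2.2)) ⁻¹' B) ∪
    ((fun q => (w q.1 (evens q.2.1), odds q.2.1)) ⁻¹' Kᶜ ∩ (fun q => (p₀, q.2.2)) ⁻¹' B)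
  have hwc' : Continuous fun q : NN × (NN × X) => w q.1 (evens q.2.1) :=
    hwc.comp (f := fun q : NN × (NN × X) => (q.1, evens q.2.1)) (by fun_prop)
  have hslice : ∀ s t, {x | (s, (t, x)) ∈ Bh} = if (w s (evens t), odds t) ∈ K then
      {x | (w s (evens t), x) ∈ B} else {x | (p₀, x) ∈ B} := by
    intro s t
    ext x
    split_ifs with h <;> simp [Bh, h]
  refine ⟨Bh, ?_, ?_⟩
  · have hc1 : Continuous fun q : NN × (NN × X) => (w q.1 (evens q.2.1), odds q.2.1) := by fun_prop
    exact hunion _ _ _ _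
      (hinter _ _ _ _ (hpre _ _ _ _ _ hc1 _ (hclosed _ _ _ hK))
        (hpre _ _ _ _ _ (by fun_prop) _ hB))
      (hinter _ _ _ _ (hpre _ _ _ _ _ hc1 _ (hopen _ _ _ hK.isOpen_compl))
        (hpre _ _ _ _ _ (by fun_prop) _ hB))
  convert sigma12Hard_univSigma using 1
  ext s
  simp only [mem_ofPred_eq, hslice]
  constructor
  · rintro ⟨f, hf, hfΦ⟩
    by_contra hs
    obtain ⟨p, hp, hpe⟩ := exists_code_of_measurable (hβ.comp hf)
    have hWv : AttComparable (evens (odds (w s p))) (TreeRel cD (w s p)) := by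
      simpa [w] using attComparable hs _
    have hval : ∀ M, (w s p, M) ∈ K → f (interleave p M) ∈ Φ {x | (w s p, x) ∈ B} := by
      intro M hM
      simpa [hM] using hfΦ (interleave p M)
    obtain ⟨M, hM⟩ := (hKW _).1 hWv
    obtain ⟨M', hM', h | ⟨e, he, h⟩⟩ := (hw s p).1 ⟨_, hval M hM⟩
    · exact h hp
    · refine h ?_
      have : (fun n => e [n]) = β (f (interleave p M')) := funext fun n => hpe _ e he n
      rw [this, hδβ]
      exact hval M' hM'
  · intro hs
    obtain ⟨a, ha, hab⟩ := exists_measurable_branch hs cD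
    have hm : Measurable fun t : NN => w s (evens t) :=
      hwc.measurable.comp (f := fun t : NN => (s, evens t)) (by fun_prop)
    refine ⟨fun t => if (w s (evens t), odds t) ∈ K then (gD (a (w s (evens t)))).2 else y₀,
      ?_, fun t => ?_⟩
    · refine Measurable.ite ?_ ?_ measurable_const
      · exact (hm.prodMk measurable_odds) hK.measurableSet
      · exact (measurable_snd.comp hgD.measurable).comp (ha.comp hm)
    · by_cases h : (w s (evens t), odds t) ∈ K
      swap
      · simpa only [h, if_false] using hy₀
      simp only [h, if_true]
      set p := evens t
      have hWv : AttComparable s (TreeRel cD (w s p)) := by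
        simpa [w] using (hKW _).2 ⟨_, h⟩
      have hne : (Φ {x | (w s p, x) ∈ B}).Nonempty := by
        by_contra hne
        refine hne ((hw s p).2 ⟨odds t, h, ?_⟩)
        by_cases hp : ∀ l, Acc (CodeRel p) l
        · obtain ⟨e, he⟩ := exists_evaluates hp (interleave p (odds t))
          exact Or.inr ⟨e, he, fun h' => hne ⟨_, h'⟩⟩
        · exact Or.inl hp
      obtain ⟨y, hy⟩ := (hAB (w s p)).1.1 ((hAB (w s p)).2.2 hne)
      have hy' : (w s p, y) ∈ range gD := hgDr ▸ hy
      obtain ⟨b, hb⟩ := hy'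
      have h1 := hab (w s p) hWv ⟨b, (hcD _ _).2 (by simp [hb])⟩
      rw [hcD] at h1
      refine hDB (w s p) ?_
      have h2 : gD (a (w s p)) ∈ D := hgDr ▸ mem_range_self _
      rwa [show gD (a (w s p)) = (w s p, (gD (a (w s p))).2) from Prod.ext h1 rfl] at h2
end

section
/- Let X, Y = ℕ^ℕ be Polish spaces, Γ a class of subsets of Polish spaces closed under continuous preimages, finite unions and intersections and containing all closed and open sets, and let Φ: Γ(X) → Π¹₁(ℕ^ℕ) be Π¹₁ on Γ with F^Φ = {A : Φ(A) ≠ ∅} nicely Σ¹₁-hard on Γ. Then for every Π¹₁ set S ⊆ ℕ^ℕ there exist a real q ∈ ℕ^ℕ, a set B ∈ Γ(ℕ^ℕ × ℕ^ℕ × X) and a Σ¹₁ set D ⊆ ℕ^ℕ × ℕ^ℕ such that for every s ∈ ℕ^ℕ: (1) s ∈ S if and only if for all t ∈ ℕ^ℕ, Φ(B_{(s,t)}) ∩ Δ¹₁(q,s,t) ≠ ∅; and (2) for all t ∈ ℕ^ℕ, if Φ(B_{(s,t)}) ∩ Δ¹₁(q,s,t) = ∅ then D_s ≠ ∅ and D_s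 ⊆ Φ(B_{(s,t)}). -/
open MeasureTheory Set

/-- Lightface `Σ¹₁(p)` subsets of Baire space: projections along `ℕ^ℕ` of trees recursive
in the parameter `p` (the recursive predicate reads initial segments of `x`, the witness
`y`, and the parameter `p`). -/
def SigmaLightIn (p : NN) (A : Set NN) : Prop :=
  ∃ f : List ℕ → Bool, Computable f ∧
    A = {x : NN | ∃ y : NN, ∀ n : ℕ,
      f ((List.range n).map fun i => Nat.pair (x i) (Nat.pair (y i) (p i))) = true}

/-- `r` is `Δ¹₁` (hyperarithmetic) in the parameter `p`, via the classical
characterization: `r ∈ Δ¹₁(p)` iff the singleton `{r}` is `Σ¹₁(p)`. -/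
def Delta11In (p : NN) (r : NN) : Prop := SigmaLightIn p {r}

/-- Recursive join of three reals, so that `Δ¹₁(q,s,t) = Δ¹₁(join3 q s t)`. -/
def join3 (a b c : NN) : NN := fun n => Nat.pair (a n) (Nat.pair (b n) (c n))

instance polishSpace_prod {Z W : Type} [TopologicalSpace Z] [TopologicalSpace W] [PolishSpace Z]
    [PolishSpace W] : PolishSpace (Z × W) :=
  inferInstance

instance polishSpace_pi {ι : Type} [Countable ι] {Z : ι → Type} [∀ i, TopologicalSpace (Z i)]
    [∀ i, PolishSpace (Z i)] : PolishSpace (∀ i, Z i) :=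
  inferInstance

namespace MeasureTheory.AnalyticSet

variable {Z W : Type} [TopologicalSpace Z] [TopologicalSpace W]

theorem setOf_exists {C : Set (Z × W)} (hC : AnalyticSet C) :
    AnalyticSet {z | ∃ w, (z, w) ∈ C} := by
  convert hC.image_of_continuous continuous_fst using 1
  ext z
  simp

theorem inter [T2Space Z] {s t : Set Z} (hs : AnalyticSet s) (ht : AnalyticSet t) :
    AnalyticSet (s ∩ t) := by
  rw [inter_eq_iInter]
  exact AnalyticSet.iInter fun b => by cases b <;> assumption

theorem union {s t : Set Z} (hs : AnalyticSet s) (ht : AnalyticSet t) :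
    AnalyticSet (s ∪ t) := by
  rw [union_eq_iUnion]
  exact AnalyticSet.iUnion fun b => by cases b <;> assumption

/-- An analytic set is the projection of a closed subset of its product with Baire space. -/
theorem exists_isClosed_s5 [T2Space Z] {s : Set Z} (hs : AnalyticSet s) :
    ∃ F : Set (Z × NN), IsClosed F ∧ ∀ z, z ∈ s ↔ ∃ y, (z, y) ∈ F := by
  rw [AnalyticSet] at hs
  rcases hs with rfl | ⟨f, hf, rfl⟩
  · exact ⟨∅, isClosed_empty, by simp⟩
  · exact ⟨{p | f p.2 = p.1}, isClosed_eq (hf.comp continuous_snd) continuous_fst, by simp⟩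

/-- An analytic set is the result of the Souslin operation applied to closed sets. -/
theorem exists_souslin_scheme [T2Space Z] {s : Set Z} (hs : AnalyticSet s) :
    ∃ A : List ℕ → Set Z, (∀ l, IsClosed (A l)) ∧
      ∀ z, z ∈ s ↔ ∃ β : NN, ∀ n, z ∈ A (PiNat.res β n) := by
  rw [AnalyticSet] at hs
  rcases hs with rfl | ⟨g, hg, rfl⟩
  · exact ⟨fun _ => ∅, fun _ => isClosed_empty, by simp⟩
  refine ⟨fun l => closure (g '' {y | PiNat.res y l.length = l}), fun _ => isClosed_closure, ?_⟩
  intro z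
  constructor
  · rintro ⟨β, rfl⟩
    exact ⟨β, fun n => subset_closure ⟨β, by simp, rfl⟩⟩
  · rintro ⟨β, hβ⟩
    refine ⟨β, ?_⟩
    by_contra hne
    obtain ⟨u, v, hu, hv, hgu, hzv, huv⟩ := t2_separation hne
    obtain ⟨c, ⟨x, n, rfl⟩, hxc, hcu⟩ :=
      (PiNat.isTopologicalBasis_cylinders (fun _ : ℕ => ℕ)).exists_subset_of_mem_open
        (show β ∈ g ⁻¹' u from hgu) (hu.preimage hg)
    rw [PiNat.cylinder_eq_res] at hxc hcu
    have hz := hβ n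
    simp only [PiNat.res_length] at hz
    obtain ⟨_, hwv, y, hy, rfl⟩ := mem_closure_iff.1 hz v hv hzv
    exact huv.le_bot ⟨hcu (hy.trans hxc), hwv⟩

end MeasureTheory.AnalyticSet

/-- There is an analytic subset of `ℕ^ℕ × ℕ^ℕ` universal for analytic subsets of `ℕ^ℕ`. -/
theorem exists_universal_analyticSet :
    ∃ U : Set (NN × NN), AnalyticSet U ∧
      ∀ A : Set NN, AnalyticSet A → ∃ c, ∀ s, s ∈ A ↔ (c, s) ∈ U := by
  obtain ⟨b, hbc, -, hb⟩ := TopologicalSpace.exists_countable_basis (NN × NN)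
  obtain ⟨O, hO⟩ := (hbc.insert ∅).exists_eq_range (insert_nonempty _ _)
  have hOo : ∀ n, IsOpen (O n) := fun n => by
    have : O n ∈ insert ∅ b := hO ▸ mem_range_self n
    rcases this with h | h
    · rw [h]; exact isOpen_empty
    · exact hb.isOpen h
  have hcover : ∀ u : Set (NN × NN), IsOpen u → ∃ c : NN, u = ⋃ n, O (c n) := by
    intro u hu
    obtain ⟨S, hSb, rfl⟩ := hb.open_eq_sUnion hu
    obtain ⟨g, hg⟩ := ((hbc.mono hSb).insert ∅).exists_eq_range (insert_nonempty _ _)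
    have hgO : ∀ n, ∃ k, O k = g n := fun n => by
      rw [← mem_range, ← hO]
      exact insert_subset_insert hSb (hg ▸ mem_range_self n)
    choose c hc using hgO
    refine ⟨c, ?_⟩
    simp only [hc]
    rw [← sUnion_range, ← hg, sUnion_insert, empty_union]
  have hclosed : IsClosed {z : (NN × NN) × NN | ∀ n, (z.1.2, z.2) ∉ O (z.1.1 n)} := by
    rw [ofPred_forall]
    refine isClosed_iInter fun n => ?_
    have : {z : (NN × NN) × NN | (z.1.2, z.2) ∉ O (z.1.1 n)} =
        ⋂ k, ({z | z.1.1 n ≠ k} ∪ {z | (z.1.2, z.2) ∉ O k}) := by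
      ext z
      simp [or_iff_not_imp_left]
    rw [this]
    refine isClosed_iInter fun k => IsClosed.union ?_ ?_
    · exact (isClosed_discrete {k}ᶜ).preimage
        (show Continuous fun z : (NN × NN) × NN => z.1.1 n by fun_prop)
    · exact (hOo k).isClosed_compl.preimage
        (show Continuous fun z : (NN × NN) × NN => (z.1.2, z.2) by fun_prop)
  refine ⟨_, hclosed.analyticSet.setOf_exists, fun A hA => ?_⟩
  obtain ⟨F, hF, hAF⟩ := hA.exists_isClosed_s5
  obtain ⟨c, hc⟩ := hcover _ hF.isOpen_compl
  refine ⟨c, fun s => (hAF s).trans (exists_congr fun y => ?_)⟩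
  have := Set.ext_iff.1 hc (s, y)
  simp only [mem_compl_iff, mem_iUnion] at this
  simp only [mem_ofPred_eq]
  rw [← not_exists, ← this, not_not]

/-- The tree-like set `A` is simulated by `B`: there is a relation between nodes, relating the
roots, along which every step inside `A` is matched by a step inside `B`. For trees this says that
the rank of `A` is at most that of `B`. -/
def TreeSim (A B : List ℕ → Prop) : Prop :=
  ∃ R : List ℕ × List ℕ → Bool, R ([], []) ∧
    ∀ a b, R (a, b) → ∀ i, A (i :: a) → ∃ j, B (j :: b) ∧ R (i :: a, j :: b)

/-- The strict version of `TreeSim`: a single step inside `B` matches all steps inside `A`. -/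
def StrictTreeSim (A B : List ℕ → Prop) : Prop :=
  ∃ R : List ℕ × List ℕ → Bool, R ([], []) ∧
    ∀ a b, R (a, b) → ∃ j, B (j :: b) ∧ ∀ i, A (i :: a) → R (i :: a, j :: b)

theorem StrictTreeSim.treeSim {A B : List ℕ → Prop} (h : StrictTreeSim A B) : TreeSim A B := by
  obtain ⟨R, h0, hR⟩ := h
  refine ⟨R, h0, fun a b hab i hi => ?_⟩
  obtain ⟨j, hj, hji⟩ := hR a b hab
  exact ⟨j, hj, hji i hi⟩

theorem strictTreeSim_of_not_treeSim {A B : List ℕ → Prop} (h : ¬ TreeSim A B) :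
    StrictTreeSim B A := by
  classical
  -- `P a b`: some simulation relates `a` to `b`
  let P : List ℕ → List ℕ → Prop := fun a b => ∃ R : List ℕ × List ℕ → Bool, R (a, b) ∧
    ∀ a b, R (a, b) → ∀ i, A (i :: a) → ∃ j, B (j :: b) ∧ R (i :: a, j :: b)
  refine ⟨fun p => decide (¬ P p.2 p.1), decide_eq_true h, fun b a hab => ?_⟩
  simp only [decide_eq_true_eq] at hab ⊢
  by_contra! hcon
  refine hab ⟨fun p => decide (p = (a, b) ∨ P p.1 p.2), by simp, fun a' b' h' i hi => ?_⟩
  simp only [decide_eq_true_eq] at h' ⊢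
  rcases h' with h' | ⟨R, hR, hsim⟩
  · obtain ⟨rfl, rfl⟩ := Prod.mk.inj h'
    obtain ⟨j, hj, hP⟩ := hcon i hi
    exact ⟨j, hj, Or.inr hP⟩
  · obtain ⟨j, hj, hj'⟩ := hsim a' b' hR i hi
    exact ⟨j, hj, Or.inr ⟨R, hj', hsim⟩⟩

theorem TreeSim.exists_branch {A B : List ℕ → Prop} (h : TreeSim A B)
    (hA : ∃ α : NN, ∀ n, A (PiNat.res α (n + 1))) : ∃ β : NN, ∀ n, B (PiNat.res β (n + 1)) := by
  obtain ⟨R, h0, hR⟩ := h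
  obtain ⟨α, hα⟩ := hA
  have step : ∀ (n : ℕ) (b : {b : List ℕ // R (PiNat.res α n, b)}),
      ∃ j, B (j :: b.1) ∧ R (PiNat.res α (n + 1), j :: b.1) :=
    fun n b => hR _ _ b.2 _ (hα n)
  choose f hfB hfR using step
  let b : (n : ℕ) → {b : List ℕ // R (PiNat.res α n, b)} := fun n =>
    Nat.rec ⟨[], h0⟩ (fun n b => ⟨f n b :: b.1, hfR n b⟩) n
  have hb : ∀ n, (b n).1 = PiNat.res (fun n => f n (b n)) n := by
    intro n
    induction n with
    | zero => rfl
    | succ n ih =>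
      exact congrArg (List.cons (f n (b n))) ih
  refine ⟨fun n => f n (b n), fun n => ?_⟩
  rw [PiNat.res_succ, ← hb]
  exact hfB n (b n)

section Coanalytic

variable {Z : Type} [TopologicalSpace Z] [PolishSpace Z]

theorem analyticSet_setOf_treeSim {A B : List ℕ → Set Z} (hA : ∀ l, IsClosed (A l))
    (hB : ∀ l, IsClosed (B l)) :
    AnalyticSet {z | TreeSim (fun l => z ∈ A l) (fun l => z ∈ B l)} := by
  borelize Z
  refine AnalyticSet.setOf_exists (W := List ℕ × List ℕ → Bool)
    (C := {p | p.2 ([], []) ∧ ∀ a b, p.2 (a, b) → ∀ i, p.1 ∈ A (i :: a) →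
      ∃ j, p.1 ∈ B (j :: b) ∧ p.2 (i :: a, j :: b)}) (MeasurableSet.analyticSet ?_)
  have hR : ∀ c, Measurable fun p : Z × (List ℕ × List ℕ → Bool) => p.2 c = true := fun c =>
    measurableSet_setOfPred.1 ((measurableSet_singleton true).preimage
      ((measurable_pi_apply c).comp measurable_snd))
  have hA' : ∀ l, Measurable fun p : Z × (List ℕ × List ℕ → Bool) => p.1 ∈ A l := fun l =>
    measurableSet_setOfPred.1 ((hA l).measurableSet.preimage measurable_fst)
  have hB' : ∀ l, Measurable fun p : Z × (List ℕ × List ℕ → Bool) => p.1 ∈ B l := fun l =>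
    measurableSet_setOfPred.1 ((hB l).measurableSet.preimage measurable_fst)
  exact measurableSet_setOfPred.2 ((hR _).and (Measurable.forall fun a => Measurable.forall fun b =>
    (hR _).imp (Measurable.forall fun i => (hA' _).imp (Measurable.exists fun j =>
      (hB' _).and (hR _)))))

theorem analyticSet_setOf_strictTreeSim {A B : List ℕ → Set Z} (hA : ∀ l, IsClosed (A l))
    (hB : ∀ l, IsClosed (B l)) :
    AnalyticSet {z | StrictTreeSim (fun l => z ∈ A l) (fun l => z ∈ B l)} := by
  borelize Z
  refine AnalyticSet.setOf_exists (W := List ℕ × List ℕ → Bool)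
    (C := {p | p.2 ([], []) ∧ ∀ a b, p.2 (a, b) → ∃ j, p.1 ∈ B (j :: b) ∧
      ∀ i, p.1 ∈ A (i :: a) → p.2 (i :: a, j :: b)}) (MeasurableSet.analyticSet ?_)
  have hR : ∀ c, Measurable fun p : Z × (List ℕ × List ℕ → Bool) => p.2 c = true := fun c =>
    measurableSet_setOfPred.1 ((measurableSet_singleton true).preimage
      ((measurable_pi_apply c).comp measurable_snd))
  have hA' : ∀ l, Measurable fun p : Z × (List ℕ × List ℕ → Bool) => p.1 ∈ A l := fun l =>
    measurableSet_setOfPred.1 ((hA l).measurableSet.preimage measurable_fst)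
  have hB' : ∀ l, Measurable fun p : Z × (List ℕ × List ℕ → Bool) => p.1 ∈ B l := fun l =>
    measurableSet_setOfPred.1 ((hB l).measurableSet.preimage measurable_fst)
  exact measurableSet_setOfPred.2 ((hR _).and (Measurable.forall fun a => Measurable.forall fun b =>
    (hR _).imp (Measurable.exists fun j => (hB' _).and (Measurable.forall fun i =>
      (hA' _).imp (hR _)))))

/-- A form of the reduction property of coanalytic sets: the complements of countably many analytic
sets contain pairwise disjoint coanalytic sets which retain the points lying in exactly one of
these complements. -/
theorem exists_disjoint_coanalytic {U : ℕ → Set Z} (hU : ∀ m, AnalyticSet (U m)) :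
    ∃ C : ℕ → Set Z, (∀ m, IsCoanalytic (C m)) ∧
      (∀ z m m', z ∈ C m → z ∈ C m' → m = m') ∧
      ∀ z m, z ∉ U m → (∀ m', m' ≠ m → z ∈ U m') → z ∈ C m := by
  choose A hA hUA using fun m => (hU m).exists_souslin_scheme
  let T : ℕ → Z → List ℕ → Prop := fun m z l => z ∈ A m [] ∧ z ∈ A m l
  have hT : ∀ m l, IsClosed {z | T m z l} := fun m l => (hA m []).inter (hA m l)
  have hUT : ∀ m z, z ∈ U m ↔ ∃ β : NN, ∀ n, T m z (PiNat.res β (n + 1)) := by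
    intro m z
    rw [hUA]
    refine exists_congr fun β => ⟨fun h n => ⟨h 0, h (n + 1)⟩, fun h n => ?_⟩
    cases n with
    | zero => exact (h 0).1
    | succ n => exact (h n).2
  refine ⟨fun m => {z | (∀ m' < m, ¬ TreeSim (T m' z) (T m z)) ∧
    ∀ m' > m, ¬ StrictTreeSim (T m' z) (T m z)}, fun m => ?_, ?_, ?_⟩
  · have : {z | (∀ m' < m, ¬ TreeSim (T m' z) (T m z)) ∧
        ∀ m' > m, ¬ StrictTreeSim (T m' z) (T m z)}ᶜ =
        (⋃ k : {k // k < m}, {z | TreeSim (T k z) (T m z)}) ∪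
          ⋃ k : {k // k > m}, {z | StrictTreeSim (T k z) (T m z)} := by
      ext z
      simp only [mem_compl_iff, mem_ofPred_eq, not_and_or, mem_union, mem_iUnion, not_forall,
        not_not, Subtype.exists, exists_prop]
    unfold IsCoanalytic
    rw [this]
    exact (AnalyticSet.iUnion fun k : {k // k < m} => analyticSet_setOf_treeSim (hT k) (hT m)).union
      (AnalyticSet.iUnion fun k : {k // k > m} => analyticSet_setOf_strictTreeSim (hT k) (hT m))
  · have key : ∀ z m m', m < m' → (∀ k > m, ¬ StrictTreeSim (T k z) (T m z)) →
        ¬ ∀ k < m', ¬ TreeSim (T k z) (T m' z) :=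
      fun z m m' hlt h h' => h m' hlt (strictTreeSim_of_not_treeSim (h' m hlt))
    intro z m m' h h'
    rcases lt_trichotomy m m' with hlt | rfl | hlt
    · exact (key z m m' hlt h.2 h'.1).elim
    · rfl
    · exact (key z m' m hlt h'.2 h.1).elim
  · intro z m hm hm'
    rw [hUT] at hm
    exact ⟨fun k hk hs => hm (hs.exists_branch ((hUT k z).1 (hm' k hk.ne))),
      fun k hk hs => hm (hs.treeSim.exists_branch ((hUT k z).1 (hm' k hk.ne')))⟩

/-- For analytic `G` and coanalytic `Q`, a coanalytic set between the set of `z` for which `G_z` is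
a singleton contained in `Q_z` and the projection of `Q`. -/
theorem exists_coanalytic_of_unique {G Q : Set (Z × NN)} (hG : AnalyticSet G)
    (hQ : IsCoanalytic Q) :
    ∃ K : Set Z, IsCoanalytic K ∧ (∀ z ∈ K, ∃ r, (z, r) ∈ Q) ∧
      ∀ z r, {x | (z, x) ∈ G} = {r} → (z, r) ∈ Q → z ∈ K := by
  have hU : ∀ n m, AnalyticSet {z | ∃ x : NN, (z, x) ∈ G ∩ {p | p.2 n ≠ m}} := fun n m =>
    (hG.inter (((isClosed_discrete {m}ᶜ).preimage
      (show Continuous fun p : Z × NN => p.2 n by fun_prop)).analyticSet)).setOf_exists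
  choose C hC hdisj hCmem using fun n => exists_disjoint_coanalytic (hU n)
  refine ⟨{z | (∀ n, ∃ m, z ∈ C n m) ∧ ∀ r : NN, (∀ n m, m ≠ r n → z ∉ C n m) → (z, r) ∈ Q},
    ?_, ?_, ?_⟩
  · have : {z | (∀ n, ∃ m, z ∈ C n m) ∧
          ∀ r : NN, (∀ n m, m ≠ r n → z ∉ C n m) → (z, r) ∈ Q}ᶜ =
        (⋃ n, ⋂ m, (C n m)ᶜ) ∪
          {z | ∃ r : NN, (z, r) ∈ (⋂ n, ⋂ m, ({p | p.2 n = m} ∪ Prod.fst ⁻¹' (C n m)ᶜ)) ∩ Qᶜ} := by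
      ext z
      simp [or_iff_not_imp_left, eq_comm]
    unfold IsCoanalytic
    rw [this]
    refine (AnalyticSet.iUnion fun n => AnalyticSet.iInter fun m => hC n m).union
      (AnalyticSet.inter (AnalyticSet.iInter fun n => AnalyticSet.iInter fun m =>
        AnalyticSet.union ?_ ?_) hQ).setOf_exists
    · exact (isClosed_eq (show Continuous fun p : Z × NN => p.2 n by fun_prop)
        continuous_const).analyticSet
    · exact AnalyticSet.preimage (hC n m) continuous_fst
  · rintro z ⟨htot, hall⟩
    choose r hr using htot
    exact ⟨r, hall r fun n m hne hm => hne (hdisj n z m (r n) hm (hr n))⟩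
  · intro z r hGr hQr
    have hmem : ∀ x, (z, x) ∈ G ↔ x = r := fun x => by
      have := Set.ext_iff.1 hGr x
      simpa using this
    have hr : ∀ n, z ∈ C n (r n) := fun n => hCmem n z (r n)
      (by rintro ⟨x, hx, hne⟩; exact hne (by rw [(hmem x).1 hx]))
      (fun m hm => ⟨r, (hmem r).2 rfl, hm.symm⟩)
    refine ⟨fun n => ⟨_, hr n⟩, fun r' h' => ?_⟩
    have : r' = r := by
      funext n
      by_contra hne
      exact h' n (r n) (fun h => hne h.symm) (hr n)
    rwa [this]

end Coanalytic

theorem isClopen_setOf_map_range {α : Type} (f : List ℕ → α) (a : α) (n : ℕ) :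
    IsClopen {w : NN | f ((List.range n).map w) = a} := by
  have : {w : NN | f ((List.range n).map w) = a} =
      (fun (w : NN) (i : Fin n) => w i) ⁻¹' {v | f (List.ofFn v) = a} := by
    ext w
    have : (List.range n).map w = List.ofFn fun i : Fin n => w i := by
      apply List.ext_getElem <;> simp
    simp [this]
  rw [this]
  exact (isClopen_discrete _).preimage (by fun_prop)

theorem analyticSet_setOf_sigmaLight {Z : Type} [TopologicalSpace Z] [PolishSpace Z]
    {p : Z → NN} (hp : Continuous p) (f : List ℕ → Bool) :
    AnalyticSet {z : Z × NN | ∃ y : NN, ∀ n : ℕ,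
      f ((List.range n).map fun i => Nat.pair (z.2 i) (Nat.pair (y i) (p z.1 i))) = true} := by
  refine AnalyticSet.setOf_exists (C := {w : (Z × NN) × NN | ∀ n : ℕ,
    f ((List.range n).map fun i => Nat.pair (w.1.2 i) (Nat.pair (w.2 i) (p w.1.1 i))) = true})
    (IsClosed.analyticSet ?_)
  rw [ofPred_forall]
  refine isClosed_iInter fun n => ?_
  have hpair : Continuous fun a : ℕ × ℕ => Nat.pair a.1 a.2 := continuous_of_discreteTopology
  refine (isClopen_setOf_map_range f true n).isClosed.preimage (f := fun (w : (Z × NN) × NN) i =>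
    Nat.pair (w.1.2 i) (Nat.pair (w.2 i) (p w.1.1 i))) (continuous_pi fun i => ?_)
  exact hpair.comp (Continuous.prodMk (by fun_prop)
    (hpair.comp (Continuous.prodMk (by fun_prop) (by fun_prop))))

instance countable_computable : Countable {f : List ℕ → Bool // Computable f} := by
  refine Function.Injective.countable (β := {g : ℕ → ℕ // Computable g})
    (f := fun f => ⟨fun n => Encodable.encode
      ((Encodable.decode (α := List ℕ) n).map f.1), ?_⟩) ?_
  · exact Computable.encode.comp (Computable.option_map Computable.decode
      (f.2.comp Computable.snd).to₂)
  · intro f g h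
    apply Subtype.ext
    funext l
    have := congrFun (congrArg Subtype.val h) (Encodable.encode l)
    simpa using this

/-- Let `Q` be coanalytic. There is an analytic set of parameters `z` which contains every `z` with
`Q_z = ∅` and only such `z` for which `Q_z` has no element which is `Δ¹₁` in `p z`. -/
theorem exists_analyticSet_no_delta11 {Z : Type} [TopologicalSpace Z] [PolishSpace Z]
    {Q : Set (Z × NN)} (hQ : IsCoanalytic Q) {p : Z → NN} (hp : Continuous p) :
    ∃ H : Set Z, AnalyticSet H ∧ (∀ z, (∀ r, (z, r) ∉ Q) → z ∈ H) ∧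
      ∀ z ∈ H, ∀ r, (z, r) ∈ Q → ¬ Delta11In (p z) r := by
  choose K hK hKQ hKmem using fun f : {f : List ℕ → Bool // Computable f} =>
    exists_coanalytic_of_unique (analyticSet_setOf_sigmaLight hp f.1) hQ
  have : Nonempty {f : List ℕ → Bool // Computable f} := ⟨⟨fun _ => true, Computable.const true⟩⟩
  refine ⟨⋂ f, (K f)ᶜ, AnalyticSet.iInter hK, fun z hz => ?_, fun z hz r hr hd => ?_⟩
  · refine mem_iInter.2 fun f hf => ?_
    obtain ⟨r, hr⟩ := hKQ f z hf
    exact hz r hr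
  · obtain ⟨f, hf, hfr⟩ := hd
    exact mem_iInter.1 hz ⟨f, hf⟩ (hKmem ⟨f, hf⟩ z r hfr.symm hr)

/-- A real is `Δ¹₁` in every join having it as first entry. -/
theorem delta11In_join3_left (q s t : NN) : Delta11In (join3 q s t) q := by
  refine ⟨fun l => decide (∀ k ∈ l,
    (Nat.unpair k).1 = (Nat.unpair (Nat.unpair (Nat.unpair k).2).2).1), ?_, ?_⟩
  · have hfst : Primrec fun k : ℕ => (Nat.unpair k).1 := Primrec.fst.comp Primrec.unpair
    have hsnd : Primrec fun k : ℕ => (Nat.unpair k).2 := Primrec.snd.comp Primrec.unpair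
    exact (PrimrecPred.forall_mem_list
      (Primrec.eq.comp hfst (hfst.comp (hsnd.comp hsnd)))).decide.to_comp
  · ext x
    simp only [mem_singleton_iff, mem_ofPred_eq]
    constructor
    · rintro rfl
      exact ⟨0, fun n => by simp [join3]⟩
    · rintro ⟨y, hy⟩
      funext i
      have := hy (i + 1)
      simp [join3] at this
      exact this i le_rfl

/-- The diagonalization lemma: if `Φ : Γ(X) → Π¹₁(ℕ^ℕ)` is `Π¹₁ on Γ` and `F^Φ` is nicely
`Σ¹₁`-hard on `Γ`, then for every `Π¹₁` set `S ⊆ ℕ^ℕ` there are a real `q`, a set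
`B ∈ Γ(ℕ^ℕ × ℕ^ℕ × X)` and a `Σ¹₁` set `D ⊆ ℕ^ℕ × ℕ^ℕ` such that for all `s`:
(1) `s ∈ S` iff for all `t`, `Φ(B_{(s,t)}) ∩ Δ¹₁(q,s,t) ≠ ∅`, and
(2) for all `t`, if `Φ(B_{(s,t)}) ∩ Δ¹₁(q,s,t) = ∅` then `D_s ≠ ∅` and
`D_s ⊆ Φ(B_{(s,t)})`. -/
theorem diagonalization_lemma
    (X : Type) [TopologicalSpace X] [PolishSpace X]
    (Γ : (Z : Type) → TopologicalSpace Z → Set Z → Prop)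
    (hpre : ∀ (Z W : Type) (tZ : TopologicalSpace Z) (tW : TopologicalSpace W) (f : Z → W),
      @Continuous Z W tZ tW f → ∀ A : Set W, Γ W tW A → Γ Z tZ (f ⁻¹' A))
    (hunion : ∀ (Z : Type) (tZ : TopologicalSpace Z) (A B : Set Z),
      Γ Z tZ A → Γ Z tZ B → Γ Z tZ (A ∪ B))
    (hinter : ∀ (Z : Type) (tZ : TopologicalSpace Z) (A B : Set Z),
      Γ Z tZ A → Γ Z tZ B → Γ Z tZ (A ∩ B))
    (hclosed : ∀ (Z : Type) (tZ : TopologicalSpace Z) (A : Set Z), @IsClosed Z tZ A → Γ Z tZ A)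
    (hopen : ∀ (Z : Type) (tZ : TopologicalSpace Z) (A : Set Z), @IsOpen Z tZ A → Γ Z tZ A)
    (Φ : Set X → Set NN)
    (hΦcoanalytic : ∀ (P : Type) [TopologicalSpace P] [PolishSpace P] (A : Set (P × X)),
      Γ (P × X) instTopologicalSpaceProd A →
      IsCoanalytic {sy : P × NN | sy.2 ∈ Φ {x : X | (sy.1, x) ∈ A}})
    (hnice : ∀ A : Set NN, AnalyticSet A →
      ∃ B : Set (NN × X), Γ (NN × X) instTopologicalSpaceProd B ∧
      ∃ D : Set (NN × NN), AnalyticSet D ∧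
        (∀ s : NN, {y : NN | (s, y) ∈ D} ⊆ Φ {x : X | (s, x) ∈ B}) ∧
        (∀ s : NN, (s ∈ A ↔ {y : NN | (s, y) ∈ D}.Nonempty) ∧
          (s ∈ A ↔ (Φ {x : X | (s, x) ∈ B}).Nonempty))) :
    ∀ S : Set NN, IsCoanalytic S →
      ∃ (q : NN) (B : Set (NN × NN × X)) (D : Set (NN × NN)),
        Γ (NN × NN × X) instTopologicalSpaceProd B ∧ AnalyticSet D ∧
        ∀ s : NN,
          ((s ∈ S ↔ ∀ t : NN,
              (Φ {x : X | (s, t, x) ∈ B} ∩ {r : NN | Delta11In (join3 q s t) r}).Nonempty) ∧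
           ∀ t : NN,
             Φ {x : X | (s, t, x) ∈ B} ∩ {r : NN | Delta11In (join3 q s t) r} = ∅ →
               {y : NN | (s, y) ∈ D}.Nonempty ∧
               {y : NN | (s, y) ∈ D} ⊆ Φ {x : X | (s, t, x) ∈ B}) := by
  intro S hS
  let pr : NN → NN → NN := fun a b n => Nat.pair (a n) (b n)
  let sn : NN → NN := fun w n => (Nat.unpair (w n)).2
  let fs : NN → NN := fun w n => (Nat.unpair (w n)).1
  have hfs : Continuous fs := continuous_pi fun n =>
    (continuous_of_discreteTopology (f := fun k : ℕ => k.unpair.1)).comp (continuous_apply n)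
  have hsn : Continuous sn := continuous_pi fun n =>
    (continuous_of_discreteTopology (f := fun k : ℕ => k.unpair.2)).comp (continuous_apply n)
  have hpr : Continuous fun a : NN × NN => pr a.1 a.2 := continuous_pi fun n =>
    (continuous_of_discreteTopology (f := fun k : ℕ × ℕ => Nat.pair k.1 k.2)).comp
      (show Continuous fun a : NN × NN => (a.1 n, a.2 n) by fun_prop)
  have hfspr : ∀ a b, fs (pr a b) = a := fun a b => by funext n; simp [fs, pr]
  have hsnpr : ∀ a b, sn (pr a b) = b := fun a b => by funext n; simp [sn, pr]
  obtain ⟨F, hF, hSF⟩ := AnalyticSet.exists_isClosed_s5 hS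
  obtain ⟨B₁, hB₁, _, _, _, hB₁univ⟩ := hnice univ isClosed_univ.analyticSet
  obtain ⟨q, hq⟩ := (hB₁univ 0).2.1 (mem_univ _)
  obtain ⟨U, hU, hUuniv⟩ := exists_universal_analyticSet
  obtain ⟨BV, hBV, DV, hDV, hDVsub, hV⟩ := hnice {w | (fs w, w) ∈ U}
    (hU.preimage (hfs.prodMk continuous_id))
  have hQ : IsCoanalytic {z : (NN × NN) × NN | z.2 ∈ Φ {x | (z.1.1, x) ∈ BV}} :=
    hΦcoanalytic (NN × NN) ((fun a : (NN × NN) × X => (a.1.1, a.2)) ⁻¹' BV)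
      (hpre _ _ _ _ _ (by fun_prop) _ hBV)
  have hp : Continuous fun z : NN × NN => join3 q (sn z.1) z.2 := by
    have h : Continuous fun z : NN × NN => pr q (pr (sn z.1) z.2) :=
      hpr.comp (continuous_const.prodMk
        (hpr.comp ((hsn.comp continuous_fst).prodMk continuous_snd)))
    exact h
  obtain ⟨H, hH, hHempty, hHdelta⟩ := exists_analyticSet_no_delta11 hQ hp
  have hFsn : AnalyticSet {z : NN × NN | (sn z.1, z.2) ∈ F} :=
    (hF.preimage ((hsn.comp continuous_fst).prodMk continuous_snd)).analyticSet
  -- `c` codes the set defined from the section of the scheme at `c` itself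
  obtain ⟨c, hc⟩ := hUuniv _ (hFsn.inter hH).setOf_exists
  have hfix : ∀ s, (Φ {x | (pr c s, x) ∈ BV}).Nonempty ↔
      ∃ t, (s, t) ∈ F ∧ (pr c s, t) ∈ H := by
    intro s
    rw [← (hV (pr c s)).2]
    simp only [mem_ofPred_eq, hfspr]
    rw [← hc]
    simp [hsnpr]
  have hne : ∀ s t, (s, t) ∈ F → (Φ {x | (pr c s, x) ∈ BV}).Nonempty := by
    intro s t hst
    by_contra hempty
    refine hempty ((hfix s).2 ⟨t, hst, hHempty _ fun r hr => hempty ⟨r, hr⟩⟩)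
  let B : Set (NN × NN × X) :=
    ({z | (z.1, z.2.1) ∈ F} ∩ {z | (pr c z.1, z.2.2) ∈ BV}) ∪
      ({z | (z.1, z.2.1) ∉ F} ∩ {z | ((0 : NN), z.2.2) ∈ B₁})
  have hBmem : ∀ s t, (s, t) ∈ F → {x | (s, t, x) ∈ B} = {x | (pr c s, x) ∈ BV} := by
    intro s t hst
    ext x
    simp [B, hst]
  have hBnot : ∀ s t, (s, t) ∉ F → {x | (s, t, x) ∈ B} = {x | ((0 : NN), x) ∈ B₁} := by
    intro s t hst
    ext x
    simp [B, hst]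
  have hcases : ∀ s t, (s, t) ∉ F →
      (Φ {x | (s, t, x) ∈ B} ∩ {r | Delta11In (join3 q s t) r}).Nonempty := fun s t hst =>
    ⟨q, by rw [hBnot s t hst]; exact hq, delta11In_join3_left q s t⟩
  refine ⟨q, B, {z | (pr c z.1, z.2) ∈ DV}, ?_, ?_, fun s => ⟨⟨fun hs t => ?_, fun h => ?_⟩,
    fun t ht => ?_⟩⟩
  · have hcont : Continuous fun z : NN × NN × X => (z.1, z.2.1) := by fun_prop
    refine hunion _ _ _ _ (hinter _ _ _ _ (hclosed _ _ _ (hF.preimage hcont)) ?_)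
      (hinter _ _ _ _ (hopen _ _ _ (hF.isOpen_compl.preimage hcont)) ?_)
    · exact hpre _ _ _ _ (fun z : NN × NN × X => (pr c z.1, z.2.2))
        ((hpr.comp (continuous_const.prodMk continuous_fst)).prodMk (by fun_prop)) _ hBV
    · exact hpre _ _ _ _ (fun z : NN × NN × X => ((0 : NN), z.2.2)) (by fun_prop) _ hB₁
  · exact hDV.preimage ((hpr.comp (continuous_const.prodMk continuous_fst)).prodMk continuous_snd)
  · exact hcases s t fun hst => (hSF s).2 ⟨t, hst⟩ hs
  · by_contra hs
    obtain ⟨t₀, ht₀⟩ := (hSF s).1 hs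
    obtain ⟨t, hst, htH⟩ := (hfix s).1 (hne s t₀ ht₀)
    obtain ⟨r, hr, hd⟩ := h t
    rw [hBmem s t hst] at hr
    refine hHdelta _ htH r hr ?_
    simpa only [hsnpr, mem_ofPred_eq] using hd
  · have hst : (s, t) ∈ F := by
      by_contra hst
      exact (hcases s t hst).ne_empty ht
    rw [hBmem s t hst]
    exact ⟨(hV _).1.1 ((hV _).2.2 (hne s t hst)), hDVsub (pr c s)⟩
end
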